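/- Let r,s ∈ (4/3,∞] with 1 < 2/r + 3/s < 3/2. Suppose that the set of data u₀ ∈ L²_σ with limsup_{ν→0} inf_{u^ν ∈ W_ν(u₀)} ( ‖u^ν‖_{L^∞(0,∞;L²)} + √ν ‖∇u^ν‖_{L²(0,∞;L²)} + ‖u^ν‖_{L^r(0,∞;L^s)} ) < ∞ is non-meagre in L²_σ. Then 5/(3r) + 2/s = 1, and there exists C > 0 such that for every ν > 0 and every u₀ ∈ L²_σ there exists u^ν ∈ W_ν(u₀) with ‖u^ν‖_{L^∞(0,∞;L²)} + √ν ‖∇u^ν‖_{L²(0,∞;L²)} ≤ C ‖u₀‖_{L²} and ‖u^ν‖_{L^r(0,∞;L^s)} ≤ C ‖u₀‖_{L²}^{2(2/r+3/s−1)}. (This combines the implications (iv) ⇒ (v) and (iv) ⇒ (vi) of the main theorem in the case X = L^s(ℝ³;ℝ³), Z = L²_σ.) -/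

import Mathlib

open MeasureTheory ENNReal Set Filter

noncomputable section

abbrev E3 : Type := EuclideanSpace ℝ (Fin 3)

/-- Spatial partial derivative of a scalar function in the `j`-th coordinate direction. -/
def pd (f : E3 → ℝ) (j : Fin 3) (x : E3) : ℝ :=
  fderiv ℝ f x (EuclideanSpace.single j 1)

/-- Divergence-free in the sense of distributions. -/
def IsDivFree (v : E3 → E3) : Prop :=
  ∀ φ : E3 → ℝ, ContDiff ℝ (⊤ : ℕ∞) φ → HasCompactSupport φ →
    ∫ x : E3, ∑ i, v x i * pd φ i x = 0

/-- The space-time measure on `(0,∞) × ℝ³`. -/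
def μST : Measure (ℝ × E3) := (volume.restrict (Ioi (0:ℝ))).prod volume

/-- Mixed norm `L^r(I; L^s)`. -/
def mixedNorm (r s : ℝ≥0∞) (I : Set ℝ) (u : ℝ → E3 → E3) : ℝ≥0∞ :=
  if r = ∞ then essSup (fun t => eLpNorm (u t) s volume) (volume.restrict I)
  else (∫⁻ t in I, (eLpNorm (u t) s volume) ^ r.toReal) ^ (1 / r.toReal)

/-- Squared spatial `L²` norm of the (matrix-valued) gradient at time `t`. -/
def gradSq (G : ℝ → E3 → Fin 3 → Fin 3 → ℝ) (t : ℝ) : ℝ≥0∞ :=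
  ∫⁻ x : E3, ∑ i, ∑ j, ENNReal.ofReal ((G t x i j) ^ 2)

/-- `L²((0,∞); L²)` norm of the gradient. -/
def gradL2 (G : ℝ → E3 → Fin 3 → Fin 3 → ℝ) : ℝ≥0∞ :=
  (∫⁻ t in Ioi (0:ℝ), gradSq G t) ^ (1/2 : ℝ)

/-- `G` is the distributional spatial gradient of `u` on `ℝ³ × (0,∞)`. -/
def IsDistGrad (u : ℝ → E3 → E3) (G : ℝ → E3 → Fin 3 → Fin 3 → ℝ) : Prop :=
  ∀ ψ : ℝ × E3 → ℝ, ContDiff ℝ (⊤ : ℕ∞) ψ → HasCompactSupport ψ →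
    tsupport ψ ⊆ {p | 0 < p.1} → ∀ i j,
    (∫ p, u p.1 p.2 i * pd (fun y => ψ (p.1, y)) j p.2 ∂μST)
      = - ∫ p, G p.1 p.2 i j * ψ p ∂μST

/-- Admissible space-time test function: smooth, compactly supported in `ℝ³ × [0,∞)`
and divergence-free. -/
def IsTest (φ : ℝ × E3 → E3) : Prop :=
  ContDiff ℝ (⊤ : ℕ∞) φ ∧ HasCompactSupport φ ∧
    ∀ p : ℝ × E3, ∑ i, pd (fun y => φ (p.1, y) i) i p.2 = 0

def timeDeriv (φ : ℝ × E3 → E3) (p : ℝ × E3) (i : Fin 3) : ℝ :=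
  deriv (fun τ => φ (τ, p.2) i) p.1

def spaceLap (φ : ℝ × E3 → E3) (p : ℝ × E3) (i : Fin 3) : ℝ :=
  ∑ j, pd (fun y => pd (fun z => φ (p.1, z) i) j y) j p.2

def spaceGrad (φ : ℝ × E3 → E3) (p : ℝ × E3) (i j : Fin 3) : ℝ :=
  pd (fun y => φ (p.1, y) i) j p.2

/-- Weak solution of the Navier–Stokes equations on `ℝ³ × (0,∞)` with viscosity `ν`,
datum `u₀` and distributional spatial gradient `G`. -/
def IsWeakNS (ν : ℝ) (u₀ : E3 → E3) (u : ℝ → E3 → E3)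
    (G : ℝ → E3 → Fin 3 → Fin 3 → ℝ) : Prop :=
  AEStronglyMeasurable (Function.uncurry u) μST ∧
  mixedNorm ∞ 2 (Ioi 0) u < ∞ ∧
  (∀ᵐ t ∂(volume.restrict (Ioi (0:ℝ))), IsDivFree (u t)) ∧
  AEStronglyMeasurable (Function.uncurry G) μST ∧
  (∫⁻ t in Ioi (0:ℝ), gradSq G t) < ∞ ∧
  IsDistGrad u G ∧
  ∀ φ : ℝ × E3 → E3, IsTest φ →
    (∫ p,
        ((∑ i, u p.1 p.2 i * (timeDeriv φ p i + ν * spaceLap φ p i)) +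
         ∑ i, ∑ j, u p.1 p.2 i * u p.1 p.2 j * spaceGrad φ p i j) ∂μST)
      = - ∫ x : E3, ∑ i, u₀ x i * φ (0, x) i

/-- Leray–Hopf solution: weak solution satisfying the energy inequality. -/
def IsLerayHopf (ν : ℝ) (u₀ : E3 → E3) (u : ℝ → E3 → E3)
    (G : ℝ → E3 → Fin 3 → Fin 3 → ℝ) : Prop :=
  IsWeakNS ν u₀ u G ∧
  ∀ᵐ t ∂(volume.restrict (Ioi (0:ℝ))),
    ENNReal.ofReal (1/2) * (eLpNorm (u t) 2 volume) ^ (2:ℕ)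
        + ENNReal.ofReal ν * ∫⁻ τ in Ioc (0:ℝ) t, gradSq G τ
      ≤ ENNReal.ofReal (1/2) * (eLpNorm u₀ 2 volume) ^ (2:ℕ)

/-- `L²_σ`: divergence-free fields in `L²(ℝ³;ℝ³)`, as a subset of `L²`. -/
def L2σ : Set (Lp E3 2 (volume : Measure E3)) := {v | IsDivFree ⇑v}

/-- Implications (iv) ⇒ (v), (vi) of the main theorem, for `X = L^s(ℝ³;ℝ³)`, `Z = L²_σ`:
if uniform-in-viscosity bounds hold on a non-meagre set of data, then
`5/(3r) + 2/s = 1` and a uniform-in-viscosity a priori estimate holds. -/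
theorem pd_eq_of_hasFDerivAt {f : E3 → ℝ} {f' : E3 →L[ℝ] ℝ} {x : E3} (h : HasFDerivAt f f' x)
    (j : Fin 3) : pd f j x = f' (EuclideanSpace.single j 1) := by
  rw [pd, h.fderiv]

theorem ContDiff.pd {f : E3 → ℝ} (hf : ContDiff ℝ (⊤ : ℕ∞) f) (j : Fin 3) :
    ContDiff ℝ (⊤ : ℕ∞) (pd f j) := by
  unfold _root_.pd
  exact (hf.fderiv_right (m := (⊤ : ℕ∞)) (by simp)).clm_apply contDiff_const

theorem HasCompactSupport.pd {f : E3 → ℝ} (hf : HasCompactSupport f) (j : Fin 3) :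
    HasCompactSupport (pd f j) := by
  unfold _root_.pd
  exact hf.fderiv_apply ℝ _

theorem ContDiff.hasFDerivAt_top {E F : Type*} [NormedAddCommGroup E] [NormedSpace ℝ E]
    [NormedAddCommGroup F] [NormedSpace ℝ F] {f : E → F} (hf : ContDiff ℝ (⊤ : ℕ∞) f) (x : E) :
    HasFDerivAt f (fderiv ℝ f x) x :=
  (hf.differentiable (by simp) x).hasFDerivAt

theorem pd_comm {f : E3 → ℝ} (hf : ContDiff ℝ (⊤ : ℕ∞) f) (i j : Fin 3) (x : E3) :
    pd (pd f i) j x = pd (pd f j) i x := by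
  have hs : IsSymmSndFDerivAt ℝ f x :=
    (hf.contDiffAt (x := x)).isSymmSndFDerivAt (by simp; exact WithTop.coe_le_coe.2 le_top)
  have hd : ∀ k : Fin 3, HasFDerivAt (pd f k)
      ((ContinuousLinearMap.apply ℝ ℝ (EuclideanSpace.single k (1 : ℝ))).comp
        (fderiv ℝ (fderiv ℝ f) x)) x := fun k =>
    ((ContinuousLinearMap.apply ℝ ℝ (EuclideanSpace.single k (1 : ℝ))).hasFDerivAt).comp x
      ((hf.fderiv_right (m := (⊤ : ℕ∞)) (by simp)).hasFDerivAt_top x)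
  rw [pd_eq_of_hasFDerivAt (hd i), pd_eq_of_hasFDerivAt (hd j)]
  simpa using hs _ _

theorem pd_add {f g : E3 → ℝ} (hf : ContDiff ℝ (⊤ : ℕ∞) f) (hg : ContDiff ℝ (⊤ : ℕ∞) g)
    (j : Fin 3) (x : E3) : pd (fun y => f y + g y) j x = pd f j x + pd g j x := by
  rw [pd_eq_of_hasFDerivAt ((hf.hasFDerivAt_top x).fun_add (hg.hasFDerivAt_top x))]; rfl

theorem pd_sub {f g : E3 → ℝ} (hf : ContDiff ℝ (⊤ : ℕ∞) f) (hg : ContDiff ℝ (⊤ : ℕ∞) g)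
    (j : Fin 3) (x : E3) : pd (fun y => f y - g y) j x = pd f j x - pd g j x := by
  rw [pd_eq_of_hasFDerivAt ((hf.hasFDerivAt_top x).fun_sub (hg.hasFDerivAt_top x))]; rfl

theorem pd_const_mul {f : E3 → ℝ} (hf : ContDiff ℝ (⊤ : ℕ∞) f) (c : ℝ)
    (j : Fin 3) (x : E3) : pd (fun y => c * f y) j x = c * pd f j x := by
  rw [pd_eq_of_hasFDerivAt ((hf.hasFDerivAt_top x).const_mul c)]; rfl

/-- A smooth function vanishing on `[2, ∞)` has a smooth primitive vanishing on `[2, ∞)`. -/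
theorem exists_primitive_of_eq_zero {H : ℝ → ℝ} (hH : ContDiff ℝ (⊤ : ℕ∞) H)
    (h0 : ∀ s, 2 ≤ s → H s = 0) :
    ∃ F : ℝ → ℝ, ContDiff ℝ (⊤ : ℕ∞) F ∧ (∀ s, HasDerivAt F (H s) s) ∧ ∀ s, 2 ≤ s → F s = 0 := by
  have hd : ∀ s, HasDerivAt (fun s => ∫ t in (2 : ℝ)..s, H t) (H s) s := fun s =>
    hH.continuous.integral_hasStrictDerivAt 2 s |>.hasDerivAt
  refine ⟨_, ?_, hd, ?_⟩
  · rw [contDiff_infty_iff_deriv]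
    refine ⟨fun s => (hd s).differentiableAt, ?_⟩
    rwa [show deriv (fun s => ∫ t in (2 : ℝ)..s, H t) = H from funext fun s => (hd s).deriv]
  · intro s hs
    rw [intervalIntegral.integral_congr (g := fun _ => (0 : ℝ)), intervalIntegral.integral_zero]
    intro t ht
    rw [uIcc_of_le hs] at ht
    exact h0 t ht.1

theorem hasFDerivAt_comp_norm_sq {F : ℝ → ℝ} {F' c : ℝ} (x₀ y : E3)
    (hF : HasDerivAt F F' (c * ‖y - x₀‖ ^ 2)) :
    HasFDerivAt (fun z : E3 => F (c * ‖z - x₀‖ ^ 2))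
      (F' • (c • (2 • innerSL ℝ (y - x₀)))) y := by
  have h1 : HasFDerivAt (fun z : E3 => ‖z - x₀‖ ^ 2) (2 • innerSL ℝ (y - x₀)) y := by
    have := ((hasFDerivAt_id y).sub_const x₀).norm_sq
    simpa using this
  exact hF.comp_hasFDerivAt y (h1.const_mul c)

theorem pd_comp_norm_sq {F : ℝ → ℝ} {F' c : ℝ} (x₀ y : E3)
    (hF : HasDerivAt F F' (c * ‖y - x₀‖ ^ 2)) (j : Fin 3) :
    pd (fun z : E3 => F (c * ‖z - x₀‖ ^ 2)) j y = 2 * c * (y j - x₀ j) * F' := by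
  rw [pd_eq_of_hasFDerivAt (hasFDerivAt_comp_norm_sq x₀ y hF)]
  simp [EuclideanSpace.inner_single_right]
  ring

theorem laplacian_comp_norm_sq {F H H' : ℝ → ℝ} (hF : ∀ s, HasDerivAt F (H s) s)
    (hH : ∀ s, HasDerivAt H (H' s) s) (c : ℝ) (x₀ y : E3) :
    ∑ j, pd (pd (fun z : E3 => F (c * ‖z - x₀‖ ^ 2)) j) j y =
      6 * c * H (c * ‖y - x₀‖ ^ 2) + 4 * c ^ 2 * ‖y - x₀‖ ^ 2 * H' (c * ‖y - x₀‖ ^ 2) := by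
  have h1 : ∀ j, pd (fun z : E3 => F (c * ‖z - x₀‖ ^ 2)) j =
      fun z => (2 * c * (z j - x₀ j)) * H (c * ‖z - x₀‖ ^ 2) := fun j => by
    ext z; exact pd_comp_norm_sq x₀ z (hF _) j
  have h2 : ∀ j : Fin 3, pd (fun z : E3 => (2 * c * (z j - x₀ j)) * H (c * ‖z - x₀‖ ^ 2)) j y =
      2 * c * H (c * ‖y - x₀‖ ^ 2) +
        4 * c ^ 2 * (y j - x₀ j) ^ 2 * H' (c * ‖y - x₀‖ ^ 2) := by
    intro j
    have ha : HasFDerivAt (fun z : E3 => 2 * c * (z j - x₀ j))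
        ((2 * c) • (EuclideanSpace.proj j : E3 →L[ℝ] ℝ)) y :=
      (((EuclideanSpace.proj j : E3 →L[ℝ] ℝ).hasFDerivAt).sub_const (x₀ j)).const_mul (2 * c)
    rw [pd_eq_of_hasFDerivAt (ha.fun_mul (hasFDerivAt_comp_norm_sq x₀ y (hH _)))]
    simp [EuclideanSpace.inner_single_right]
    ring
  simp_rw [h1, h2]
  rw [EuclideanSpace.norm_sq_eq]
  simp only [Fin.sum_univ_three, PiLp.sub_apply, Real.norm_eq_abs, sq_abs]
  ring

theorem setIntegral_norm_le_of_memLp_two {α F : Type*} [MeasurableSpace α] {μ : Measure α}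
    [NormedAddCommGroup F] {f : α → F} (hf : MemLp f 2 μ) {s : Set α} (hs : μ s ≠ ∞) :
    ∫ x in s, ‖f x‖ ∂μ ≤ (eLpNorm f 2 μ).toReal * (μ s).toReal ^ (1 / 2 : ℝ) := by
  have hfs := hf.restrict s
  have h := eLpNorm_le_eLpNorm_mul_rpow_measure_univ (μ := μ.restrict s) (p := 1) (q := 2)
    (by norm_num) hfs.1
  rw [integral_norm_eq_lintegral_enorm hfs.1, ← eLpNorm_one_eq_lintegral_enorm,
    ENNReal.toReal_rpow, ← ENNReal.toReal_mul]
  refine ENNReal.toReal_mono (ENNReal.mul_ne_top hf.2.ne (by finiteness)) (h.trans ?_)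
  rw [Measure.restrict_apply_univ]
  have : (1 / (1 : ℝ≥0∞).toReal - 1 / (2 : ℝ≥0∞).toReal) = 1 / 2 := by norm_num
  rw [this]
  gcongr
  exact Measure.restrict_le_self

theorem MemLp.integrable_smul_bounded_compact {α F : Type*} [MeasurableSpace α] [TopologicalSpace α]
    [BorelSpace α] [R1Space α]
    {μ : Measure α} [IsFiniteMeasureOnCompacts μ] [NormedAddCommGroup F] [NormedSpace ℝ F]
    {f : α → F} (hf : MemLp f 2 μ) {k : α → ℝ}
    (hk : Continuous k) (hc : HasCompactSupport k) : Integrable (fun x => k x • f x) μ := by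
  have hk2 : MemLp k 2 μ := hk.memLp_of_hasCompactSupport hc
  exact memLp_one_iff_integrable.1 (hf.smul (r := 1) hk2)

/-- Scaled radial averages of a weakly harmonic square integrable function vanish. -/
theorem integral_radial_eq_zero {f : E3 → ℝ} (hf : MemLp f 2)
    (h : ∀ ψ : E3 → ℝ, ContDiff ℝ (⊤ : ℕ∞) ψ → HasCompactSupport ψ →
      ∫ x, f x * ∑ j, pd (pd ψ j) j x = 0)
    {H : ℝ → ℝ} (hH : ContDiff ℝ (⊤ : ℕ∞) H) (h0 : ∀ s, 2 ≤ s → H s = 0)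
    (x₀ : E3) {l : ℝ} (hl : 0 < l) :
    ∫ y, f y * H (l ^ 2 * ‖y - x₀‖ ^ 2) = 0 := by
  obtain ⟨F, hFs, hF, hF0⟩ := exists_primitive_of_eq_zero hH h0
  have hH' : ∀ s, HasDerivAt H (deriv H s) s := fun s =>
    (hH.differentiable (by simp) s).hasDerivAt
  have hH'c : Continuous (deriv H) := hH.continuous_deriv (by simp)
  have hH'0 : ∀ s, 2 < s → deriv H s = 0 := by
    intro s hs
    have : H =ᶠ[nhds s] fun _ => (0 : ℝ) := by
      filter_upwards [lt_mem_nhds hs] with t ht using h0 t ht.le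
    rw [this.deriv_eq]; simp
  obtain ⟨C, hC⟩ : ∃ C, ∀ s ∈ Icc (0 : ℝ) 2, ‖H s‖ ≤ C :=
    isCompact_Icc.exists_bound_of_continuousOn hH.continuous.continuousOn
  obtain ⟨C', hC'⟩ : ∃ C, ∀ s ∈ Icc (0 : ℝ) 2, ‖deriv H s‖ ≤ C :=
    isCompact_Icc.exists_bound_of_continuousOn hH'c.continuousOn
  have hC0 : 0 ≤ C := (norm_nonneg _).trans (hC 0 (by norm_num))
  have hC0' : 0 ≤ C' := (norm_nonneg _).trans (hC' 0 (by norm_num))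
  have hball : ∀ {r : ℝ} {y : E3}, 0 < r → r ^ 2 * ‖y - x₀‖ ^ 2 ≤ 2 →
      y ∈ Metric.closedBall x₀ (2 / r) := by
    intro r y hr hy
    rw [mem_closedBall_iff_norm, le_div_iff₀ hr]
    nlinarith [norm_nonneg (y - x₀), mul_nonneg (norm_nonneg (y - x₀)) hr.le]
  have hcs : ∀ (K : ℝ → ℝ), (∀ s, 2 < s → K s = 0) → ∀ r : ℝ, 0 < r →
      HasCompactSupport fun y : E3 => K (r ^ 2 * ‖y - x₀‖ ^ 2) := by
    intro K hK r hr
    refine HasCompactSupport.intro (isCompact_closedBall x₀ (2 / r)) fun y hy => hK _ ?_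
    by_contra hle
    exact hy (hball hr (not_lt.1 hle))
  have hloc : LocallyIntegrable f := hf.locallyIntegrable (by norm_num)
  let m : ℝ → ℝ := fun r => ∫ y, f y * (r ^ 3 * H (r ^ 2 * ‖y - x₀‖ ^ 2))
  have hInt : ∀ r : ℝ, 0 < r → ∀ K : ℝ → ℝ, Continuous K → (∀ s, 2 < s → K s = 0) →
      Integrable fun y => f y * (K (r ^ 2 * ‖y - x₀‖ ^ 2)) := by
    intro r hr K hK hK0
    have := MemLp.integrable_smul_bounded_compact hf
      (k := fun y : E3 => K (r ^ 2 * ‖y - x₀‖ ^ 2)) (by fun_prop) (hcs K hK0 r hr)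
    simpa [smul_eq_mul, mul_comm] using this
  have hderiv : ∀ r : ℝ, 0 < r → HasDerivAt m 0 r := by
    intro r hr
    have hd : ∀ (y : E3) (t : ℝ), HasDerivAt (fun t => f y * (t ^ 3 * H (t ^ 2 * ‖y - x₀‖ ^ 2)))
        (f y * (3 * t ^ 2 * H (t ^ 2 * ‖y - x₀‖ ^ 2) +
          2 * t ^ 4 * ‖y - x₀‖ ^ 2 * deriv H (t ^ 2 * ‖y - x₀‖ ^ 2))) t := by
      intro y t
      have h1 : HasDerivAt (fun t : ℝ => t ^ 2 * ‖y - x₀‖ ^ 2) (2 * t * ‖y - x₀‖ ^ 2) t := by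
        simpa using (hasDerivAt_pow 2 t).mul_const (‖y - x₀‖ ^ 2)
      have h2 : HasDerivAt (fun t : ℝ => t ^ 3) (3 * t ^ 2) t := by
        simpa using hasDerivAt_pow 3 t
      refine ((h2.fun_mul ((hH' _).comp t h1)).const_mul (f y)).congr_deriv ?_
      simp only [Function.comp]
      ring
    have hlap := h (fun y => F (r ^ 2 * ‖y - x₀‖ ^ 2))
      (hFs.comp (contDiff_const.mul ((contDiff_id.sub contDiff_const).norm_sq ℝ)))
      (hcs F (fun s hs => hF0 s hs.le) r hr)
    simp_rw [laplacian_comp_norm_sq hF hH'] at hlap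
    have hmain := hasDerivAt_integral_of_dominated_loc_of_deriv_le (μ := (volume : Measure E3))
      (F := fun t y => f y * (t ^ 3 * H (t ^ 2 * ‖y - x₀‖ ^ 2)))
      (F' := fun t y => f y * (3 * t ^ 2 * H (t ^ 2 * ‖y - x₀‖ ^ 2) +
          2 * t ^ 4 * ‖y - x₀‖ ^ 2 * deriv H (t ^ 2 * ‖y - x₀‖ ^ 2)))
      (x₀ := r) (s := Ioo (r / 2) (2 * r))
      (bound := (Metric.closedBall x₀ (4 / r)).indicator
        fun y => ‖f y‖ * (12 * r ^ 2 * C + 16 * r ^ 2 * C'))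
      (Ioo_mem_nhds (by linarith) (by linarith))
      (Eventually.of_forall fun t => hf.1.mul (Continuous.aestronglyMeasurable (by fun_prop)))
      (by
        have := (hInt r hr H hH.continuous fun s hs => h0 s hs.le).const_mul (r ^ 3)
        refine this.congr (Eventually.of_forall fun y => ?_)
        simp only; ring)
      (hf.1.mul (Continuous.aestronglyMeasurable (by fun_prop)))
      (Eventually.of_forall fun y t ht => by
        have ht0 : 0 < t := lt_trans (by linarith) ht.1
        by_cases hy : t ^ 2 * ‖y - x₀‖ ^ 2 ≤ 2
        · have hyb : y ∈ Metric.closedBall x₀ (4 / r) := by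
            refine Metric.closedBall_subset_closedBall ?_ (hball ht0 hy)
            rw [div_le_div_iff₀ ht0 hr]; linarith [ht.1]
          rw [indicator_of_mem hyb, norm_mul]
          have hmem : t ^ 2 * ‖y - x₀‖ ^ 2 ∈ Icc (0 : ℝ) 2 := ⟨by positivity, hy⟩
          have ht2 : t ^ 2 ≤ 4 * r ^ 2 := by nlinarith [ht.2]
          refine mul_le_mul_of_nonneg_left ((norm_add_le _ _).trans (add_le_add ?_ ?_))
            (norm_nonneg _)
          · rw [norm_mul, Real.norm_of_nonneg (by positivity : 0 ≤ 3 * t ^ 2)]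
            exact mul_le_mul (by linarith) (hC _ hmem) (norm_nonneg _) (by positivity)
          · rw [norm_mul, Real.norm_of_nonneg (by positivity : 0 ≤ 2 * t ^ 4 * ‖y - x₀‖ ^ 2)]
            refine mul_le_mul ?_ (hC' _ hmem) (norm_nonneg _) (by positivity)
            nlinarith [sq_nonneg t]
        · rw [not_le] at hy
          rw [h0 _ hy.le, hH'0 _ hy]
          simp only [mul_zero, add_zero, norm_zero]
          exact indicator_nonneg (fun _ _ => by positivity) _)
      (by
        rw [integrable_indicator_iff measurableSet_closedBall]
        exact ((hloc.integrableOn_isCompact (isCompact_closedBall _ _)).norm.mul_const _))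
      (Eventually.of_forall fun y t _ => hd y t)
    refine hmain.2.congr_deriv ?_
    have : ∫ y, f y * (3 * r ^ 2 * H (r ^ 2 * ‖y - x₀‖ ^ 2) +
          2 * r ^ 4 * ‖y - x₀‖ ^ 2 * deriv H (r ^ 2 * ‖y - x₀‖ ^ 2)) =
        (1 / 2) * ∫ x, f x * (6 * r ^ 2 * H (r ^ 2 * ‖x - x₀‖ ^ 2) +
          4 * (r ^ 2) ^ 2 * ‖x - x₀‖ ^ 2 * deriv H (r ^ 2 * ‖x - x₀‖ ^ 2)) := by
      rw [← integral_const_mul]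
      congr 1; ext y; ring
    rw [this, hlap, mul_zero]
  have hconst : ∀ r : ℝ, 0 < r → m r = m l := by
    intro r hr
    exact isOpen_Ioi.is_const_of_deriv_eq_zero isPreconnected_Ioi
      (fun t ht => (hderiv t ht).differentiableAt.differentiableWithinAt)
      (fun t ht => (hderiv t ht).deriv) hr hl
  have hbound : ∀ r : ℝ, 0 < r → |m r| ≤ r ^ 3 * C * ((eLpNorm f 2 volume).toReal *
      (volume (Metric.closedBall x₀ (2 / r))).toReal ^ (1 / 2 : ℝ)) := by
    intro r hr
    refine le_trans ?_ (mul_le_mul_of_nonneg_left (setIntegral_norm_le_of_memLp_two hf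
      (measure_closedBall_lt_top).ne) (by positivity))
    rw [← integral_const_mul, ← integral_indicator measurableSet_closedBall, ← Real.norm_eq_abs]
    refine norm_integral_le_of_norm_le ?_ (Eventually.of_forall fun y => ?_)
    · rw [integrable_indicator_iff measurableSet_closedBall]
      exact ((hloc.integrableOn_isCompact (isCompact_closedBall _ _)).norm.const_mul _)
    · by_cases hy : r ^ 2 * ‖y - x₀‖ ^ 2 ≤ 2
      · rw [indicator_of_mem (hball hr hy), norm_mul, norm_mul,
          Real.norm_of_nonneg (by positivity : 0 ≤ r ^ 3), mul_comm]
        exact mul_le_mul_of_nonneg_right (mul_le_mul_of_nonneg_left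
          (hC _ ⟨by positivity, hy⟩) (by positivity)) (norm_nonneg _)
      · rw [not_le] at hy
        rw [h0 _ hy.le]
        simp only [mul_zero, norm_zero]
        exact indicator_nonneg (fun _ _ => by positivity) _
  have hm0 : m l = 0 := by
    set A := C * (eLpNorm f 2 volume).toReal *
      (8 * (volume (Metric.ball (0 : E3) 1)).toReal) ^ (1 / 2 : ℝ) with hA
    have hb2 : ∀ r : ℝ, 0 < r → |m l| ≤ A * r ^ (3 / 2 : ℝ) := by
      intro r hr
      rw [← hconst r hr]
      refine (hbound r hr).trans (le_of_eq ?_)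
      rw [Measure.addHaar_closedBall _ _ (by positivity), ENNReal.toReal_mul,
        ENNReal.toReal_ofReal (by positivity)]
      have hfr : Module.finrank ℝ E3 = 3 := by simp
      rw [hfr, hA, show (2 / r) ^ 3 * (volume (Metric.ball (0 : E3) 1)).toReal =
        (8 * (volume (Metric.ball (0 : E3) 1)).toReal) * (r ^ 3)⁻¹ by field_simp; norm_num]
      rw [Real.mul_rpow (by positivity) (by positivity), Real.inv_rpow (by positivity),
        ← Real.rpow_natCast r 3, ← Real.rpow_mul hr.le]
      have : r ^ ((3 : ℕ) : ℝ) = r ^ (3 / 2 : ℝ) * r ^ (((3 : ℕ) : ℝ) * (1 / 2)) := by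
        rw [← Real.rpow_add hr]; norm_num
      rw [this]
      have h3 : r ^ (((3 : ℕ) : ℝ) * (1 / 2)) ≠ 0 := by positivity
      field_simp
    have hlim : Tendsto (fun r : ℝ => A * r ^ (3 / 2 : ℝ)) (nhdsWithin 0 (Ioi 0)) (nhds 0) := by
      have : ContinuousAt (fun r : ℝ => A * r ^ (3 / 2 : ℝ)) 0 :=
        continuousAt_const.mul (Real.continuousAt_rpow_const _ _ (Or.inr (by norm_num)))
      have := this.tendsto.mono_left (nhdsWithin_le_nhds (s := Ioi (0 : ℝ)))
      simpa using this
    have := ge_of_tendsto hlim (eventually_mem_nhdsWithin.mono fun r hr => hb2 r hr)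
    exact abs_nonpos_iff.1 this
  have hfin : m l = l ^ 3 * ∫ y, f y * H (l ^ 2 * ‖y - x₀‖ ^ 2) := by
    simp only [m]
    rw [← integral_const_mul]
    congr 1; ext y; ring
  rw [hfin] at hm0
  exact (mul_eq_zero.1 hm0).resolve_left (by positivity)

/-- Weyl and Liouville: a weakly harmonic square integrable function vanishes. -/
theorem ae_eq_zero_of_weakly_harmonic {f : E3 → ℝ} (hf : MemLp f 2)
    (h : ∀ ψ : E3 → ℝ, ContDiff ℝ (⊤ : ℕ∞) ψ → HasCompactSupport ψ →
      ∫ x, f x * ∑ j, pd (pd ψ j) j x = 0) : ∀ᵐ x, f x = 0 := by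
  have hloc : LocallyIntegrable f := hf.locallyIntegrable (by norm_num)
  have hball : ∀ (x₀ : E3) (R : ℝ), 0 < R → ∫ y in Metric.closedBall x₀ R, f y = 0 := by
    intro x₀ R hR
    let H : ℕ → ℝ → ℝ := fun k s => Real.smoothTransition (1 + (k + 1) * (1 - s))
    have hH : ∀ k, ContDiff ℝ (⊤ : ℕ∞) (H k) := fun k =>
      Real.smoothTransition.contDiff.comp
        (contDiff_const.add (contDiff_const.mul (contDiff_const.sub contDiff_id)))
    have h0 : ∀ k s, 2 ≤ s → H k s = 0 := fun k s hs =>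
      Real.smoothTransition.zero_of_nonpos (by
        have : (0 : ℝ) ≤ k := k.cast_nonneg
        nlinarith)
    have hz : ∀ k, ∫ y, f y * H k ((1 / R) ^ 2 * ‖y - x₀‖ ^ 2) = 0 := fun k =>
      integral_radial_eq_zero hf h (hH k) (h0 k) x₀ (by positivity)
    have hlim : Tendsto (fun k => ∫ y, f y * H k ((1 / R) ^ 2 * ‖y - x₀‖ ^ 2)) atTop
        (nhds (∫ y, (Metric.closedBall x₀ R).indicator f y)) := by
      refine tendsto_integral_of_dominated_convergence
        ((Metric.closedBall x₀ (2 * R)).indicator fun y => ‖f y‖) (fun k => ?_) ?_ (fun k => ?_) ?_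
      · have := (hH k).continuous
        exact hf.1.mul (Continuous.aestronglyMeasurable (by fun_prop))
      · rw [integrable_indicator_iff measurableSet_closedBall]
        exact (hloc.integrableOn_isCompact (isCompact_closedBall _ _)).norm
      · refine Eventually.of_forall fun y => ?_
        by_cases hy : y ∈ Metric.closedBall x₀ (2 * R)
        · rw [indicator_of_mem hy, norm_mul, Real.norm_of_nonneg (Real.smoothTransition.nonneg _)]
          exact mul_le_of_le_one_right (norm_nonneg _) (Real.smoothTransition.le_one _)
        · rw [indicator_of_notMem hy, h0 k, mul_zero, norm_zero]
          rw [mem_closedBall_iff_norm, not_le] at hy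
          have : (1 / R) ^ 2 * ‖y - x₀‖ ^ 2 = (‖y - x₀‖ / R) ^ 2 := by ring
          have h2 : 2 < ‖y - x₀‖ / R := by rwa [lt_div_iff₀ hR]
          rw [this]; nlinarith
      · refine Eventually.of_forall fun y => ?_
        have he : (1 / R) ^ 2 * ‖y - x₀‖ ^ 2 = (‖y - x₀‖ / R) ^ 2 := by ring
        by_cases hy : y ∈ Metric.closedBall x₀ R
        · rw [indicator_of_mem hy]
          refine tendsto_const_nhds.congr fun k => ?_
          simp only [H]
          rw [Real.smoothTransition.one_of_one_le, mul_one]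
          rw [mem_closedBall_iff_norm] at hy
          have h2 : ‖y - x₀‖ / R ≤ 1 := by rwa [div_le_one hR]
          have h3 : 0 ≤ ‖y - x₀‖ / R := by positivity
          have : (0 : ℝ) ≤ k := k.cast_nonneg
          rw [he]
          have : 0 ≤ 1 - (‖y - x₀‖ / R) ^ 2 := by nlinarith
          nlinarith
        · rw [indicator_of_notMem hy]
          rw [mem_closedBall_iff_norm, not_le] at hy
          have h2 : 1 < ‖y - x₀‖ / R := by rwa [one_lt_div hR]
          have h3 : 0 < (‖y - x₀‖ / R) ^ 2 - 1 := by nlinarith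
          obtain ⟨N, hN⟩ := exists_nat_ge (1 / ((‖y - x₀‖ / R) ^ 2 - 1))
          refine tendsto_const_nhds.congr' ?_
          filter_upwards [eventually_ge_atTop N] with k hk
          simp only [H]
          rw [Real.smoothTransition.zero_of_nonpos, mul_zero]
          rw [he]
          have hk' : (N : ℝ) ≤ k := by exact_mod_cast hk
          have := (div_le_iff₀ h3).1 hN
          nlinarith
    simp_rw [hz] at hlim
    rw [← integral_indicator measurableSet_closedBall]
    exact (tendsto_nhds_unique tendsto_const_nhds hlim).symm
  filter_upwards [IsUnifLocDoublingMeasure.ae_tendsto_average (μ := (volume : Measure E3)) hloc 1]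
    with x hx
  have hδ : Tendsto (fun n : ℕ => 1 / ((n : ℝ) + 1)) atTop (nhdsWithin 0 (Ioi 0)) :=
    tendsto_nhdsWithin_iff.2 ⟨tendsto_one_div_add_atTop_nhds_zero_nat,
      Eventually.of_forall fun n => by rw [mem_Ioi]; positivity⟩
  have := hx (fun _ => x) _ hδ (Eventually.of_forall fun n =>
    Metric.mem_closedBall_self (by positivity))
  refine (tendsto_nhds_unique this ((tendsto_const_nhds (x := (0 : ℝ))).congr fun n => ?_))
  rw [setAverage_eq, hball x _ (by positivity), smul_zero]

/-- Smooth compactly supported solenoidal fields on `ℝ³`. -/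
def IsSolenoidalTest (φ : E3 → E3) : Prop :=
  ContDiff ℝ (⊤ : ℕ∞) φ ∧ HasCompactSupport φ ∧ ∀ x, ∑ i, pd (fun y => φ y i) i x = 0

theorem ContDiff.coord {E : Type*} [NormedAddCommGroup E] [NormedSpace ℝ E] {φ : E → E3}
    (h : ContDiff ℝ (⊤ : ℕ∞) φ) (i : Fin 3) :
    ContDiff ℝ (⊤ : ℕ∞) fun y => φ y i :=
  (EuclideanSpace.proj i : E3 →L[ℝ] ℝ).contDiff.comp h

theorem HasCompactSupport.coord {E : Type*} [TopologicalSpace E] {φ : E → E3}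
    (h : HasCompactSupport φ) (i : Fin 3) :
    HasCompactSupport fun y => φ y i :=
  h.comp_left (g := fun v : E3 => v i) rfl

theorem MemLp.coord {α : Type*} [MeasurableSpace α] {μ : Measure α} {p : ℝ≥0∞} {v : α → E3}
    (hv : MemLp v p μ) (i : Fin 3) : MemLp (fun x => v x i) p μ :=
  hv.continuousLinearMap_comp (EuclideanSpace.proj i : E3 →L[ℝ] ℝ)

theorem pd_sum {ι : Type*} (s : Finset ι) {f : ι → E3 → ℝ}
    (hf : ∀ k, ContDiff ℝ (⊤ : ℕ∞) (f k)) (j : Fin 3) (x : E3) :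
    pd (fun y => ∑ k ∈ s, f k y) j x = ∑ k ∈ s, pd (f k) j x := by
  rw [pd_eq_of_hasFDerivAt (HasFDerivAt.fun_sum fun k _ => (hf k).hasFDerivAt_top x)]
  simp [pd]

/-- A square integrable solenoidal field orthogonal to all solenoidal test fields vanishes. -/
theorem ae_eq_zero_of_orthogonal_solenoidal {v : E3 → E3} (hv : MemLp v 2) (hd : IsDivFree v)
    (h : ∀ φ, IsSolenoidalTest φ → ∫ x, ∑ i, v x i * φ x i = 0) : ∀ᵐ x, v x = 0 := by
  have key : ∀ i : Fin 3, ∀ᵐ x, v x i = 0 := by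
    intro i
    refine ae_eq_zero_of_weakly_harmonic (MemLp.coord hv i) fun ψ hψ hc => ?_
    have hL : ContDiff ℝ (⊤ : ℕ∞) fun x => ∑ j, pd (pd ψ j) j x :=
      ContDiff.sum fun j _ => (hψ.pd j).pd j
    have hLc : HasCompactSupport fun x => ∑ j, pd (pd ψ j) j x := by
      refine HasCompactSupport.intro hc fun x hx => Finset.sum_eq_zero fun j _ => ?_
      have hsub : tsupport (pd (pd ψ j) j) ⊆ tsupport ψ := by
        unfold pd
        exact (tsupport_fderiv_apply_subset ℝ _).trans (tsupport_fderiv_apply_subset ℝ _)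
      exact image_eq_zero_of_notMem_tsupport fun hx' => hx (hsub hx')
    let e : E3 := EuclideanSpace.single i 1
    let φ : E3 → E3 := fun x => WithLp.toLp 2 fun j =>
      pd (pd ψ i) j x - (e j) * ∑ k, pd (pd ψ k) k x
    have hφ : IsSolenoidalTest φ := by
      refine ⟨?_, ?_, fun x => ?_⟩
      · rw [contDiff_euclidean]
        exact fun j => ((hψ.pd i).pd j).sub (contDiff_const.mul hL)
      · have hK : IsCompact (tsupport (fun x => ∑ k, pd (pd ψ k) k x) ∪ ⋃ j, tsupport (pd (pd ψ i) j)) :=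
          hLc.isCompact.union (isCompact_iUnion fun j => ((hc.pd i).pd j).isCompact)
        refine HasCompactSupport.intro hK fun x hx => ?_
        simp only [mem_union, mem_iUnion, not_or, not_exists] at hx
        ext j
        have h1 := image_eq_zero_of_notMem_tsupport hx.1
        have h2 := image_eq_zero_of_notMem_tsupport (hx.2 j)
        simp only [φ, PiLp.zero_apply, h2]
        rw [h1]; simp
      · have h1 : ∀ j, pd (fun y => φ y j) j x =
            pd (pd (pd ψ i) j) j x - e j * ∑ k, pd (pd (pd ψ k) k) j x := by
          intro j
          have : (fun y => φ y j) = fun y => pd (pd ψ i) j y - (e j) * ∑ k, pd (pd ψ k) k y := rfl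
          rw [this, pd_sub ((hψ.pd i).pd j) (contDiff_const.mul hL), pd_const_mul hL, pd_sum]
          exact fun k => (hψ.pd k).pd k
        simp_rw [h1, Finset.sum_sub_distrib]
        have h2 : ∀ j : Fin 3, e j = if j = i then 1 else 0 := fun j => by
          simp [e]
        simp_rw [h2, ite_mul, one_mul, zero_mul, Finset.sum_ite_eq', Finset.mem_univ, if_true]
        rw [sub_eq_zero]
        refine Finset.sum_congr rfl fun k _ => ?_
        rw [pd_comm (hψ.pd k) k i]
        congr 1
        ext y
        exact pd_comm hψ i k y
    have h1 := h φ hφ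
    have h2 := hd (pd ψ i) (hψ.pd i) (hc.pd i)
    have hInt : ∀ j (g : E3 → ℝ), ContDiff ℝ (⊤ : ℕ∞) g → HasCompactSupport g →
        Integrable fun x => v x j * g x := by
      intro j g hg hgc
      have := MemLp.integrable_smul_bounded_compact (MemLp.coord hv j) hg.continuous hgc
      simpa [smul_eq_mul, mul_comm] using this
    have h3 : (fun x => ∑ j, v x j * φ x j) = fun x =>
        (∑ j, v x j * pd (pd ψ i) j x) - v x i * ∑ k, pd (pd ψ k) k x := by
      ext x
      simp only [φ, mul_sub, Finset.sum_sub_distrib]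
      congr 1
      simp [e, Fin.sum_univ_three]
    rw [h3, integral_sub, h2, zero_sub, neg_eq_zero] at h1
    · exact h1
    · exact integrable_finsetSum _ fun j _ => hInt j _ ((hψ.pd i).pd j) ((hc.pd i).pd j)
    · exact hInt i _ hL hLc
  filter_upwards [ae_all_iff.2 key] with x hx
  ext i
  simpa using hx i

instance : SFinite μST := by unfold μST; infer_instance

instance : IsFiniteMeasureOnCompacts μST := by unfold μST; infer_instance

theorem measurableSet_pos_time : MeasurableSet {p : ℝ × E3 | 0 < p.1} :=
  measurableSet_lt measurable_const measurable_fst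

theorem μST_eq : μST = (volume : Measure (ℝ × E3)).restrict {p | 0 < p.1} := by
  unfold μST
  have h : {p : ℝ × E3 | 0 < p.1} = Ioi (0 : ℝ) ×ˢ univ := by ext; simp
  rw [h, Measure.volume_eq_prod, ← Measure.prod_restrict, Measure.restrict_univ]

theorem exists_inner_eq_of_le {H V : Type*} [NormedAddCommGroup H] [InnerProductSpace ℝ H]
    [CompleteSpace H] [AddCommGroup V] [Module ℝ V] (T : V →ₗ[ℝ] H) (l : V →ₗ[ℝ] ℝ) {C : ℝ}
    (hC : 0 ≤ C) (h : ∀ v, l v ≤ C * ‖T v‖) :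
    ∃ g : H, ‖g‖ ≤ C ∧ ∀ v, l v = inner ℝ g (T v) := by
  have habs : ∀ v, ‖l v‖ ≤ C * ‖T v‖ := fun v => by
    rw [Real.norm_eq_abs, abs_le]
    have := h (-v)
    simp only [map_neg, norm_neg] at this
    exact ⟨by linarith, h v⟩
  have hker : LinearMap.ker T ≤ LinearMap.ker l := fun v hv => by
    rw [LinearMap.mem_ker] at hv ⊢
    have := habs v
    rw [hv, norm_zero, mul_zero] at this
    simpa using this
  let l' : LinearMap.range T →ₗ[ℝ] ℝ :=
    (Submodule.liftQ _ l hker) ∘ₗ (T.quotKerEquivRange.symm : _ →ₗ[ℝ] _)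
  have hl' : ∀ v, l' ⟨T v, LinearMap.mem_range_self T v⟩ = l v := fun v => by
    have : T.quotKerEquivRange.symm ⟨T v, LinearMap.mem_range_self T v⟩
        = Submodule.Quotient.mk v := by
      rw [LinearEquiv.symm_apply_eq]; rfl
    simp only [l', LinearMap.comp_apply, LinearEquiv.coe_coe, this]
    rfl
  have hb : ∀ y, ‖l' y‖ ≤ C * ‖y‖ := by
    rintro ⟨_, v, rfl⟩
    rw [hl']
    exact habs v
  obtain ⟨g, hg, hgn⟩ := _root_.exists_extension_norm_eq _ (l'.mkContinuous C hb)
  refine ⟨(InnerProductSpace.toDual ℝ H).symm g, ?_, fun v => ?_⟩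
  · rw [LinearIsometryEquiv.norm_map, hgn]
    exact LinearMap.mkContinuous_norm_le _ hC _
  · rw [InnerProductSpace.toDual_symm_apply, ← hl']
    exact (hg ⟨T v, LinearMap.mem_range_self T v⟩).symm

/-- Smooth functions with compact support in `(0,∞) × ℝ³`. -/
def interiorTest (E : Type*) [NormedAddCommGroup E] [NormedSpace ℝ E] :
    Submodule ℝ (ℝ × E3 → E) where
  carrier := {ψ | ContDiff ℝ (⊤ : ℕ∞) ψ ∧ HasCompactSupport ψ ∧ tsupport ψ ⊆ {p | 0 < p.1}}
  add_mem' {f g} hf hg := ⟨hf.1.add hg.1, hf.2.1.add hg.2.1,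
    (tsupport_add f g).trans (union_subset hf.2.2 hg.2.2)⟩
  zero_mem' := ⟨contDiff_const, HasCompactSupport.zero, by simp [tsupport]⟩
  smul_mem' c f hf := ⟨contDiff_const.smul hf.1, hf.2.1.smul_left (f := fun _ => c),
    (tsupport_smul_subset_right (fun _ => c) f).trans hf.2.2⟩

theorem memLp_interiorTest {E : Type*} [NormedAddCommGroup E] [NormedSpace ℝ E] (p : ℝ≥0∞)
    (ψ : interiorTest E) : MemLp ψ.1 p μST :=
  ψ.2.1.continuous.memLp_of_hasCompactSupport ψ.2.2.1

theorem exists_memLp_of_bound {E : Type*} [NormedAddCommGroup E] [InnerProductSpace ℝ E]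
    [CompleteSpace E] (l : interiorTest E →ₗ[ℝ] ℝ) {C : ℝ≥0∞} (hC : C ≠ ∞)
    (h : ∀ ψ : interiorTest E, l ψ ≤ (C * eLpNorm ψ.1 2 μST).toReal) :
    ∃ g : ℝ × E3 → E, MemLp g 2 μST ∧ eLpNorm g 2 μST ≤ C ∧
      ∀ ψ : interiorTest E, l ψ = ∫ p, inner ℝ (g p) (ψ.1 p) ∂μST := by
  let T : interiorTest E →ₗ[ℝ] Lp E 2 μST :=
    { toFun := fun ψ => (memLp_interiorTest 2 ψ).toLp ψ.1
      map_add' := fun a b => MemLp.toLp_add (memLp_interiorTest 2 a) (memLp_interiorTest 2 b)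
      map_smul' := fun c a => MemLp.toLp_const_smul c (memLp_interiorTest 2 a) }
  obtain ⟨g, hg, hgl⟩ := exists_inner_eq_of_le T l (C := C.toReal) toReal_nonneg fun ψ => by
    have : ‖T ψ‖ = (eLpNorm ψ.1 2 μST).toReal :=
      Lp.norm_toLp _ (memLp_interiorTest 2 ψ)
    rw [this, ← toReal_mul]
    exact h ψ
  refine ⟨g, Lp.memLp g, ?_, fun ψ => ?_⟩
  · rw [Lp.norm_def] at hg
    exact (toReal_le_toReal (Lp.eLpNorm_ne_top g) hC).1 hg
  · rw [hgl, L2.inner_def]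
    refine integral_congr_ae ?_
    filter_upwards [(memLp_interiorTest 2 ψ).coeFn_toLp] with p hp
    rw [show T ψ = (memLp_interiorTest 2 ψ).toLp ψ.1 from rfl, hp]

/-- A locally integrable function whose pairing with test functions is bounded by their `L²`
norm is square integrable. -/
theorem eLpNorm_le_of_pairing_le {F : ℝ × E3 → ℝ} (hF : LocallyIntegrable F μST) {C : ℝ≥0∞}
    (h : ∀ ψ ∈ interiorTest ℝ, ∫ p, F p * ψ p ∂μST ≤ (C * eLpNorm ψ 2 μST).toReal) :
    eLpNorm F 2 μST ≤ C := by
  by_cases hC : C = ∞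
  · simp [hC]
  have hInt : ∀ ψ ∈ interiorTest ℝ, Integrable (fun p => F p * ψ p) μST := fun ψ hψ => by
    simpa [mul_comm] using
      hF.integrable_smul_left_of_hasCompactSupport hψ.1.continuous hψ.2.1
  let l : interiorTest ℝ →ₗ[ℝ] ℝ :=
    { toFun := fun ψ => ∫ p, F p * ψ.1 p ∂μST
      map_add' := fun a b => by
        rw [← integral_add (hInt _ a.2) (hInt _ b.2)]
        simp [mul_add]
      map_smul' := fun c a => by
        simp only [Submodule.coe_smul, Pi.smul_apply, smul_eq_mul, RingHom.id_apply]
        rw [← integral_const_mul]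
        congr 1; ext p; ring }
  obtain ⟨g, hg2, hgC, hgl⟩ := exists_memLp_of_bound l hC fun ψ => h ψ.1 ψ.2
  have hopen : IsOpen {p : ℝ × E3 | 0 < p.1} := isOpen_lt continuous_const continuous_fst
  have hgloc : LocallyIntegrable g μST := hg2.locallyIntegrable (by norm_num)
  have key : ∀ᵐ p ∂(volume : Measure (ℝ × E3)), p ∈ {p : ℝ × E3 | 0 < p.1} → (F - g) p = 0 := by
    refine hopen.ae_eq_zero_of_integral_contDiff_smul_eq_zero ?_ fun ψ hψ hψc hψs => ?_
    · rw [locallyIntegrableOn_iff hopen.isLocallyClosed]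
      intro k hk hkc
      have := (hF.sub hgloc).integrableOn_isCompact hkc
      rwa [IntegrableOn, μST_eq, Measure.restrict_restrict hkc.measurableSet,
        inter_eq_left.2 hk] at this
    · have h1 := hgl ⟨ψ, hψ, hψc, hψs⟩
      have h2 : (∫ p, F p * ψ p ∂μST) = ∫ p, g p * ψ p ∂μST := by
        rw [show (∫ p, F p * ψ p ∂μST) = l ⟨ψ, hψ, hψc, hψs⟩ from rfl, h1]
        simp [mul_comm]
      have hig : Integrable (fun p => g p * ψ p) μST := by
        simpa [mul_comm] using
          hgloc.integrable_smul_left_of_hasCompactSupport hψ.continuous hψc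
      have h3 : ∫ p, ψ p • (F - g) p ∂μST = 0 := by
        rw [← sub_eq_zero, ← integral_sub (hInt ψ ⟨hψ, hψc, hψs⟩) hig] at h2
        rw [← h2]
        congr 1; ext p; simp; ring
      rw [μST_eq, setIntegral_eq_integral_of_forall_compl_eq_zero] at h3
      · exact h3
      · intro p hp
        rw [image_eq_zero_of_notMem_tsupport fun hp' => hp (hψs hp'), zero_smul]
  have : F =ᵐ[μST] g := by
    rw [μST_eq, EventuallyEq, ae_restrict_iff' measurableSet_pos_time]
    filter_upwards [key] with p hp hp'
    exact sub_eq_zero.1 (hp hp')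
  rwa [eLpNorm_congr_ae this]

theorem pd_slice {ψ : ℝ × E3 → ℝ} (hψ : ContDiff ℝ (⊤ : ℕ∞) ψ) (j : Fin 3) (t : ℝ) (x : E3) :
    pd (fun y => ψ (t, y)) j x = fderiv ℝ ψ (t, x) (0, EuclideanSpace.single j 1) := by
  have h1 : HasFDerivAt (fun y : E3 => (t, y)) (ContinuousLinearMap.inr ℝ ℝ E3) x :=
    hasFDerivAt_prodMk_right t x
  have h2 : HasFDerivAt (fun y : E3 => ψ (t, y)) _ x := (hψ.hasFDerivAt_top (t, x)).comp x h1
  rw [pd_eq_of_hasFDerivAt h2]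
  simp

theorem measurePreserving_shift (h : E3) :
    MeasurePreserving (fun p : ℝ × E3 => (p.1, p.2 + h)) μST μST := by
  unfold μST
  exact (MeasurePreserving.id _).prod (measurePreserving_add_right volume h)

theorem E3_sum_single (h : E3) : h = ∑ j, h j • EuclideanSpace.single j (1 : ℝ) := by
  ext i; simp [Fin.sum_univ_three]; fin_cases i <;> simp

theorem shift_mem_interiorTest {E : Type*} [NormedAddCommGroup E] [NormedSpace ℝ E]
    {ψ : ℝ × E3 → E} (hψ : ψ ∈ interiorTest E) (h : E3) :
    (fun p => ψ (p.1, p.2 + h)) ∈ interiorTest E := by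
  let e : ℝ × E3 ≃ₜ ℝ × E3 := (Homeomorph.refl ℝ).prodCongr (Homeomorph.addRight h)
  have he : (fun p => ψ (p.1, p.2 + h)) = ψ ∘ e := rfl
  refine ⟨?_, ?_, ?_⟩
  · exact hψ.1.comp (contDiff_fst.prodMk (contDiff_snd.add contDiff_const))
  · rw [he]; exact hψ.2.1.comp_homeomorph e
  · rw [he, tsupport_comp_eq_preimage ψ e]
    intro p hp
    have : e p ∈ {p : ℝ × E3 | 0 < p.1} := hψ.2.2 (mem_preimage.1 hp)
    exact this

theorem hasDerivAt_pairing_shift {f : ℝ × E3 → ℝ} (hf : LocallyIntegrable f μST)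
    {ψ : ℝ × E3 → ℝ} (hψ : ψ ∈ interiorTest ℝ) (h : E3) (s₀ : ℝ) :
    HasDerivAt (fun s : ℝ => ∫ p, f p * ψ (p.1, p.2 + s • h) ∂μST)
      (∫ p, f p * fderiv ℝ ψ (p.1, p.2 + s₀ • h) (0, h) ∂μST) s₀ := by
  have hc : Continuous (fderiv ℝ ψ) := hψ.1.continuous_fderiv (by simp)
  obtain ⟨M, hM⟩ := hψ.2.1.fderiv (𝕜 := ℝ) |>.exists_bound_of_continuous hc
  have hK : IsCompact ((fun q : (ℝ × E3) × ℝ => (q.1.1, q.1.2 - q.2 • h)) ''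
      (tsupport ψ ×ˢ Metric.closedBall s₀ 1)) :=
    (hψ.2.1.isCompact.prod (isCompact_closedBall _ _)).image (by fun_prop)
  set K := (fun q : (ℝ × E3) × ℝ => (q.1.1, q.1.2 - q.2 • h)) ''
      (tsupport ψ ×ˢ Metric.closedBall s₀ 1) with hKdef
  have hInt : ∀ s : ℝ, Integrable (fun p => f p * ψ (p.1, p.2 + s • h)) μST := fun s => by
    have := shift_mem_interiorTest hψ (s • h)
    simpa [mul_comm] using
      hf.integrable_smul_left_of_hasCompactSupport this.1.continuous this.2.1
  refine (hasDerivAt_integral_of_dominated_loc_of_deriv_le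
    (bound := K.indicator fun p => ‖f p‖ * (M * ‖((0 : ℝ), h)‖))
    (F' := fun s p => f p * fderiv ℝ ψ (p.1, p.2 + s • h) (0, h))
    (Metric.ball_mem_nhds s₀ one_pos) ?_ (hInt s₀) ?_ ?_ ?_ ?_).2
  · exact Eventually.of_forall fun s => (hInt s).1
  · refine hf.aestronglyMeasurable.mul (Continuous.aestronglyMeasurable ?_)
    exact (hc.comp (by fun_prop)).clm_apply continuous_const
  · refine Eventually.of_forall fun p s hs => ?_
    by_cases hp : p ∈ K
    · rw [indicator_of_mem hp, norm_mul]
      gcongr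
      exact ((fderiv ℝ ψ (p.1, p.2 + s • h)).le_opNorm _).trans (by gcongr; exact hM _)
    · rw [indicator_of_notMem hp]
      have : (p.1, p.2 + s • h) ∉ tsupport ψ := fun hp' =>
        hp ⟨((p.1, p.2 + s • h), s), ⟨hp', Metric.ball_subset_closedBall hs⟩, by simp⟩
      rw [fderiv_of_notMem_tsupport (𝕜 := ℝ) this]
      simp
  · rw [integrable_indicator_iff hK.measurableSet]
    exact ((hf.integrableOn_isCompact hK).norm).mul_const _
  · refine Eventually.of_forall fun p s _ => ?_
    refine HasDerivAt.const_mul _ ?_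
    have h1 : HasDerivAt (fun s : ℝ => (p.1, p.2 + s • h)) ((0 : ℝ), h) s := by
      refine (hasDerivAt_const s p.1).prodMk ?_
      simpa using ((hasDerivAt_id s).smul_const h).const_add p.2
    exact ((hψ.1.hasFDerivAt_top _).comp_hasDerivAt s h1)

theorem integral_mul_le_eLpNorm_mul {α : Type*} [MeasurableSpace α] {μ : Measure α} {E : Type*}
    [NormedAddCommGroup E] [InnerProductSpace ℝ E]
    {f : α → E} {g : α → E} (hf : MemLp f 2 μ) (hg : MemLp g 2 μ) :
    |∫ x, inner ℝ (f x) (g x) ∂μ| ≤ (eLpNorm f 2 μ * eLpNorm g 2 μ).toReal := by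
  have h1 := L2.inner_def (𝕜 := ℝ) (hf.toLp f) (hg.toLp g)
  have h2 : ∫ x, inner ℝ (f x) (g x) ∂μ = inner ℝ (hf.toLp f) (hg.toLp g) := by
    rw [h1]
    refine integral_congr_ae ?_
    filter_upwards [hf.coeFn_toLp, hg.coeFn_toLp] with x h3 h4
    rw [h3, h4]
  rw [h2, toReal_mul, ← Lp.norm_toLp f hf, ← Lp.norm_toLp g hg]
  exact abs_real_inner_le_norm _ _

theorem eLpNorm_shift_sub_le {f : ℝ × E3 → ℝ} (hf : LocallyIntegrable f μST)
    {g : ℝ × E3 → E3} (hg : MemLp g 2 μST)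
    (hgrad : ∀ ψ ∈ interiorTest ℝ, ∀ j, ∫ p, f p * pd (fun y => ψ (p.1, y)) j p.2 ∂μST
      = - ∫ p, g p j * ψ p ∂μST) (h : E3) (hfh : LocallyIntegrable (fun p => f (p.1, p.2 + h)) μST) :
    eLpNorm (fun p => f (p.1, p.2 + h) - f p) 2 μST ≤ ENNReal.ofReal ‖h‖ * eLpNorm g 2 μST := by
  refine eLpNorm_le_of_pairing_le (hfh.sub hf) fun ψ hψ => ?_
  let I : ℝ → ℝ := fun s : ℝ => ∫ p, f p * ψ (p.1, p.2 + s • (-h)) ∂μST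
  have hψ2 : MemLp ψ 2 μST := memLp_interiorTest 2 ⟨ψ, hψ⟩
  have hd : ∀ s₀, ∃ d, HasDerivAt I d s₀ ∧
      ‖d‖ ≤ (ENNReal.ofReal ‖h‖ * eLpNorm g 2 μST * eLpNorm ψ 2 μST).toReal := by
    intro s₀
    refine ⟨_, hasDerivAt_pairing_shift hf hψ (-h) s₀, ?_⟩
    have hs := shift_mem_interiorTest hψ (s₀ • (-h))
    set ψs : ℝ × E3 → ℝ := fun p => ψ (p.1, p.2 + s₀ • (-h)) with hψs
    have hn : eLpNorm ψs 2 μST = eLpNorm ψ 2 μST :=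
      eLpNorm_comp_measurePreserving hψ2.1 (measurePreserving_shift _)
    have hψs2 : MemLp ψs 2 μST := memLp_interiorTest 2 ⟨ψs, hs⟩
    have h1 : ∀ p : ℝ × E3, fderiv ℝ ψ (p.1, p.2 + s₀ • (-h)) (0, -h) =
        ∑ j, -(h j) * pd (fun y => ψs (p.1, y)) j p.2 := by
      intro p
      have h2 : ∀ j, pd (fun y => ψs (p.1, y)) j p.2 =
          fderiv ℝ ψ (p.1, p.2 + s₀ • (-h)) (0, EuclideanSpace.single j 1) := by
        intro j
        have h3 : HasFDerivAt (fun y : E3 => (p.1, y + s₀ • (-h)))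
            (ContinuousLinearMap.inr ℝ ℝ E3) p.2 :=
          (hasFDerivAt_const p.1 p.2).prodMk ((hasFDerivAt_id p.2).add_const _)
        have h4 : HasFDerivAt (fun y : E3 => ψs (p.1, y)) _ p.2 :=
          (hψ.1.hasFDerivAt_top (p.1, p.2 + s₀ • (-h))).comp p.2 h3
        rw [pd_eq_of_hasFDerivAt h4]
        simp
      simp_rw [h2, neg_mul, Finset.sum_neg_distrib, ← smul_eq_mul, ← map_smul, ← map_sum,
        ← map_neg]
      congr 1
      refine Prod.ext (by simp [Prod.fst_sum]) ?_
      simp only [Prod.snd_neg, Prod.snd_sum, Prod.smul_snd]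
      rw [← E3_sum_single]
    have hdint : ∀ j, Integrable (fun p => f p * pd (fun y => ψs (p.1, y)) j p.2) μST := by
      intro j
      simp_rw [pd_slice hs.1]
      have : Continuous fun p : ℝ × E3 =>
          fderiv ℝ ψs (p.1, p.2) (0, EuclideanSpace.single j 1) :=
        ((hs.1.continuous_fderiv (by simp)).clm_apply continuous_const)
      simpa [mul_comm] using
        hf.integrable_smul_left_of_hasCompactSupport this (hs.2.1.fderiv_apply ℝ _)
    have hgint : ∀ j, Integrable (fun p => g p j * ψs p) μST := fun j =>
      (MemLp.coord hg j).integrable_mul hψs2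
    have h4 : (∫ p, f p * fderiv ℝ ψ (p.1, p.2 + s₀ • (-h)) (0, -h) ∂μST) =
        ∫ p, inner ℝ (g p) (ψs p • h) ∂μST := by
      simp_rw [h1, Finset.mul_sum]
      rw [integral_finsetSum _ fun j _ => by
        simpa [mul_left_comm] using (hdint j).const_mul (-(h j))]
      have h5 : ∀ p, inner ℝ (g p) (ψs p • h) = ∑ j, h j * (g p j * ψs p) := fun p => by
        rw [PiLp.inner_apply]
        refine Finset.sum_congr rfl fun j _ => ?_
        simp; ring
      simp_rw [h5]
      rw [integral_finsetSum _ fun j _ => (hgint j).const_mul _]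
      refine Finset.sum_congr rfl fun j _ => ?_
      rw [integral_const_mul, ← neg_neg (∫ p, g p j * ψs p ∂μST), ← hgrad ψs hs j,
        mul_neg, ← neg_mul, ← integral_const_mul]
      congr 1; ext p; ring
    rw [h4, Real.norm_eq_abs]
    have hm : MemLp (fun p => ψs p • h) 2 μST :=
      hψs2.continuousLinearMap_comp (ContinuousLinearMap.toSpanSingleton ℝ h)
    refine (integral_mul_le_eLpNorm_mul hg hm).trans (le_of_eq ?_)
    congr 1
    have : eLpNorm (fun p => ψs p • h) 2 μST = ENNReal.ofReal ‖h‖ * eLpNorm ψs 2 μST := by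
      rw [← eLpNorm_norm]
      simp_rw [norm_smul, mul_comm _ ‖h‖]
      rw [show (fun p => ‖h‖ * ‖ψs p‖) = ‖h‖ • fun p => ‖ψs p‖ from rfl, eLpNorm_const_smul,
        eLpNorm_norm, Real.enorm_eq_ofReal (norm_nonneg _)]
    rw [this, hn]; ring
  choose d hd1 hd2 using hd
  have hmv := (convex_univ (𝕜 := ℝ) (E := ℝ)).norm_image_sub_le_of_norm_hasDerivWithin_le
    (f := I) (f' := d) (fun x _ => (hd1 x).hasDerivWithinAt) (fun x _ => hd2 x)
    (mem_univ 0) (mem_univ 1)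
  have hI0 : I 0 = ∫ p, f p * ψ p ∂μST := by simp [I]
  have hI1 : I 1 = ∫ p, f (p.1, p.2 + h) * ψ p ∂μST := by
    have e : MeasurableEmbedding (fun p : ℝ × E3 => (p.1, p.2 + h)) :=
      ((Homeomorph.refl ℝ).prodCongr (Homeomorph.addRight h)).measurableEmbedding
    simp only [I]
    rw [← (measurePreserving_shift h).integral_comp e]
    simp
  have hInt : ∀ F : ℝ × E3 → ℝ, LocallyIntegrable F μST → Integrable (fun p => F p * ψ p) μST :=
    fun F hF => by
      simpa [mul_comm] using hF.integrable_smul_left_of_hasCompactSupport hψ.1.continuous hψ.2.1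
  simp only [Pi.sub_apply, sub_mul]
  rw [integral_sub (hInt _ hfh) (hInt _ hf), ← hI0, ← hI1]
  refine (le_abs_self _).trans ?_
  simpa using hmv

theorem eLpNorm_two_sq {α E : Type*} [MeasurableSpace α] [NormedAddCommGroup E] (f : α → E)
    (μ : Measure α) : eLpNorm f 2 μ ^ 2 = ∫⁻ x, ‖f x‖ₑ ^ 2 ∂μ := by
  have := eLpNorm_nnreal_pow_eq_lintegral (f := f) (μ := μ) (p := 2) (by norm_num)
  simpa using this

theorem eLpNorm_two_le_iff {α E : Type*} [MeasurableSpace α] [NormedAddCommGroup E] {f : α → E}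
    {μ : Measure α} {C : ℝ≥0∞} : eLpNorm f 2 μ ≤ C ↔ ∫⁻ x, ‖f x‖ₑ ^ 2 ∂μ ≤ C ^ 2 := by
  rw [← eLpNorm_two_sq]
  exact ⟨fun h => pow_le_pow_left' h 2, fun h => by
    rwa [ENNReal.pow_le_pow_left_iff (by norm_num)] at h⟩

/-- A measurable field whose time slices are solenoidal and bounded in `L²`. -/
structure IsTame (K : ℝ≥0∞) (u : ℝ → E3 → E3) : Prop where
  meas : StronglyMeasurable (Function.uncurry u)
  bound : ∀ t, eLpNorm (u t) 2 volume ≤ K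
  div : ∀ t, IsDivFree (u t)

theorem IsTame.slice_meas {K : ℝ≥0∞} {u : ℝ → E3 → E3} (h : IsTame K u) (t : ℝ) :
    StronglyMeasurable (u t) :=
  h.meas.comp_measurable measurable_prodMk_left

theorem IsTame.memLp {K : ℝ≥0∞} {u : ℝ → E3 → E3} (h : IsTame K u) (hK : K ≠ ∞) (t : ℝ) :
    MemLp (u t) 2 volume :=
  ⟨(h.slice_meas t).aestronglyMeasurable, (h.bound t).trans_lt hK.lt_top⟩

theorem IsTame.eLpNorm_prod_le {K : ℝ≥0∞} {u : ℝ → E3 → E3} (h : IsTame K u)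
    (μ₁ : Measure ℝ) [SFinite μ₁] (μ₂ : Measure E3) [SFinite μ₂] (hμ : μ₂ ≤ volume) :
    ∫⁻ p, ‖u p.1 p.2‖ₑ ^ 2 ∂(μ₁.prod μ₂) ≤ K ^ 2 * μ₁ univ := by
  rw [lintegral_prod _ (by
    exact ((h.meas.enorm).pow_const 2).aemeasurable)]
  calc _ ≤ ∫⁻ t, K ^ 2 ∂μ₁ := lintegral_mono fun t => by
        refine (lintegral_mono' hμ le_rfl).trans ?_
        rw [← eLpNorm_two_sq]
        exact pow_le_pow_left' (h.bound t) 2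
    _ = _ := by rw [lintegral_const]

theorem IsTame.memLp_compact {K : ℝ≥0∞} {u : ℝ → E3 → E3} (h : IsTame K u) (hK : K ≠ ∞)
    {s : Set (ℝ × E3)} (hs : IsCompact s) : MemLp (Function.uncurry u) 2 (μST.restrict s) := by
  refine ⟨h.meas.aestronglyMeasurable, ?_⟩
  obtain ⟨I, hI, hsI⟩ : ∃ I : Set ℝ, IsCompact I ∧ s ⊆ I ×ˢ univ :=
    ⟨Prod.fst '' s, hs.image continuous_fst, fun p hp => ⟨mem_image_of_mem _ hp, mem_univ _⟩⟩
  refine lt_of_le_of_lt (eLpNorm_mono_measure _ (Measure.restrict_mono hsI le_rfl)) ?_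
  unfold μST
  rw [← Measure.prod_restrict, Measure.restrict_univ, Measure.restrict_restrict hI.measurableSet]
  suffices h2 : eLpNorm (Function.uncurry u) 2
      ((volume.restrict (I ∩ Ioi 0)).prod volume) ^ 2 < ∞ by
    rcases ENNReal.pow_lt_top_iff.1 h2 with h3 | h3
    · exact h3
    · norm_num at h3
  rw [eLpNorm_two_sq]
  refine (h.eLpNorm_prod_le _ _ le_rfl).trans_lt ?_
  rw [Measure.restrict_apply_univ]
  exact mul_lt_top (by finiteness) ((measure_mono inter_subset_left).trans_lt hI.measure_lt_top)

theorem IsTame.locallyIntegrable {K : ℝ≥0∞} {u : ℝ → E3 → E3} (h : IsTame K u) (hK : K ≠ ∞)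
    (i : Fin 3) : LocallyIntegrable (fun p : ℝ × E3 => u p.1 p.2 i) μST := by
  rw [locallyIntegrable_iff]
  intro s hs
  have : IsFiniteMeasure (μST.restrict s) := ⟨by
    rw [Measure.restrict_apply_univ]; exact hs.measure_lt_top⟩
  exact (MemLp.coord (h.memLp_compact hK hs) i).integrable (by norm_num)

theorem isDivFree_shift {v : E3 → E3} (hv : IsDivFree v) (h : E3) :
    IsDivFree fun x => v (x + h) := by
  intro φ hφ hc
  have := hv (fun x => φ (x - h)) (hφ.comp (contDiff_id.sub contDiff_const))
    (hc.comp_homeomorph (Homeomorph.subRight h))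
  rw [← integral_add_right_eq_self _ h] at this
  rw [← this]
  congr 1; ext x
  refine Finset.sum_congr rfl fun i _ => ?_
  congr 1
  have h2 : HasFDerivAt (fun y : E3 => φ (y - h)) (fderiv ℝ φ x) (x + h) := by
    have h3 := hφ.hasFDerivAt_top (x + h - h)
    have h4 := h3.comp (x + h) ((hasFDerivAt_id (x + h)).sub_const h)
    rw [add_sub_cancel_right] at h4
    exact h4
  rw [pd_eq_of_hasFDerivAt h2]; rfl

theorem IsTame.shift {K : ℝ≥0∞} {u : ℝ → E3 → E3} (h : IsTame K u) (y : E3) :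
    IsTame K fun t x => u t (x + y) where
  meas := h.meas.comp_measurable
    (measurable_fst.prodMk (measurable_snd.add_const y))
  bound t := by
    refine le_of_eq_of_le ?_ (h.bound t)
    exact eLpNorm_comp_measurePreserving (h.slice_meas t).aestronglyMeasurable
      (measurePreserving_add_right volume y)
  div t := isDivFree_shift (h.div t) y

/-- The uniform probability measure on a ball centred at the origin. -/
def ballMeasure (ε : ℝ) : Measure E3 := ProbabilityTheory.cond volume (Metric.ball 0 ε)

theorem ballMeasure_eq (ε : ℝ) : ballMeasure ε =
    (volume (Metric.ball (0 : E3) ε))⁻¹ • volume.restrict (Metric.ball 0 ε) := rfl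

theorem isProbabilityMeasure_ballMeasure {ε : ℝ} (hε : 0 < ε) :
    IsProbabilityMeasure (ballMeasure ε) :=
  ProbabilityTheory.cond_isProbabilityMeasure_of_finite (Metric.measure_ball_pos _ _ hε).ne'
    measure_ball_lt_top.ne

instance (ε : ℝ) : SFinite (ballMeasure ε) := by rw [ballMeasure_eq]; infer_instance

theorem ae_ballMeasure (ε : ℝ) : ∀ᵐ h ∂(ballMeasure ε), ‖h‖ ≤ ε := by
  rw [ballMeasure_eq]
  refine Measure.ae_smul_measure ?_ _
  filter_upwards [ae_restrict_mem Metric.isOpen_ball.measurableSet] with h hh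
  simpa using (mem_ball_zero_iff.1 hh).le

theorem sq_lintegral_le {α : Type*} [MeasurableSpace α] {P : Measure α} [IsProbabilityMeasure P]
    {f : α → ℝ≥0∞} (hf : AEMeasurable f P) : (∫⁻ x, f x ∂P) ^ 2 ≤ ∫⁻ x, f x ^ 2 ∂P := by
  have := ENNReal.lintegral_mul_le_Lp_mul_Lq P (p := 2) (q := 2) Real.HolderConjugate.two_two hf
    (aemeasurable_const (b := (1 : ℝ≥0∞)))
  simp only [Pi.mul_apply, mul_one, one_rpow, lintegral_const, measure_univ] at this
  calc _ ≤ ((∫⁻ x, f x ^ (2 : ℝ) ∂P) ^ (1 / 2 : ℝ)) ^ 2 := pow_le_pow_left' this 2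
    _ = _ := by
      rw [← ENNReal.rpow_natCast, ← ENNReal.rpow_mul]
      norm_num

theorem lintegral_ballAverage_sub_le {f : ℝ × E3 → ℝ} (hfm : StronglyMeasurable f) {g : ℝ × E3 → E3}
    {ε : ℝ} (hε : 0 < ε) (hInt : ∀ p : ℝ × E3, Integrable (fun h => f (p.1, p.2 + h)) (ballMeasure ε))
    (hle : ∀ h, eLpNorm (fun p => f (p.1, p.2 + h) - f p) 2 μST
      ≤ ENNReal.ofReal ‖h‖ * eLpNorm g 2 μST) :
    eLpNorm (fun p => (∫ h, f (p.1, p.2 + h) ∂(ballMeasure ε)) - f p) 2 μST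
      ≤ ENNReal.ofReal ε * eLpNorm g 2 μST := by
  have := isProbabilityMeasure_ballMeasure hε
  have hm : Measurable fun q : (ℝ × E3) × E3 => ‖f (q.1.1, q.1.2 + q.2) - f q.1‖ₑ := by
    have h1 : StronglyMeasurable fun q : (ℝ × E3) × E3 => f (q.1.1, q.1.2 + q.2) :=
      hfm.comp_measurable (by fun_prop)
    have h2 : StronglyMeasurable fun q : (ℝ × E3) × E3 => f q.1 :=
      hfm.comp_measurable measurable_fst
    exact (h1.sub h2).enorm
  rw [eLpNorm_two_le_iff]
  calc ∫⁻ p, ‖(∫ h, f (p.1, p.2 + h) ∂(ballMeasure ε)) - f p‖ₑ ^ 2 ∂μST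
      ≤ ∫⁻ p, ∫⁻ h, ‖f (p.1, p.2 + h) - f p‖ₑ ^ 2 ∂(ballMeasure ε) ∂μST := by
        refine lintegral_mono fun p => ?_
        have h1 : (∫ h, f (p.1, p.2 + h) ∂(ballMeasure ε)) - f p =
            ∫ h, (f (p.1, p.2 + h) - f p) ∂(ballMeasure ε) := by
          rw [integral_sub (hInt p) (integrable_const _)]; simp
        rw [h1]
        refine (pow_le_pow_left' (enorm_integral_le_lintegral_enorm _) 2).trans ?_
        exact sq_lintegral_le (hm.comp measurable_prodMk_left).aemeasurable
    _ = ∫⁻ h, ∫⁻ p, ‖f (p.1, p.2 + h) - f p‖ₑ ^ 2 ∂μST ∂(ballMeasure ε) :=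
        lintegral_lintegral_swap (by exact (hm.pow_const 2).aemeasurable)
    _ ≤ ∫⁻ _, (ENNReal.ofReal ε * eLpNorm g 2 μST) ^ 2 ∂(ballMeasure ε) := by
        refine lintegral_mono_ae ?_
        filter_upwards [ae_ballMeasure ε] with h hh
        rw [← eLpNorm_two_le_iff]
        exact (hle h).trans (by gcongr)
    _ = _ := by simp

/-- The weak formulation of the Navier–Stokes equations, tested against `φ`. -/
def WeakForm (ν : ℝ) (u₀ : E3 → E3) (u : ℝ → E3 → E3) : Prop :=
  ∀ φ : ℝ × E3 → E3, IsTest φ →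
    (∫ p,
        ((∑ i, u p.1 p.2 i * (timeDeriv φ p i + ν * spaceLap φ p i)) +
         ∑ i, ∑ j, u p.1 p.2 i * u p.1 p.2 j * spaceGrad φ p i j) ∂μST)
      = - ∫ x : E3, ∑ i, u₀ x i * φ (0, x) i

/-- Spatial part of the weak formulation for the velocity value `v` at the point `x`. -/
def spaceForm (ν : ℝ) (φ : E3 → E3) (v x : E3) : ℝ :=
  (∑ i, v i * (ν * ∑ j, pd (fun y => pd (fun z => φ z i) j y) j x)) +
    ∑ i, ∑ j, v i * v j * pd (fun z => φ z i) j x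

theorem tsupport_pd_subset (f : E3 → ℝ) (j : Fin 3) : tsupport (pd f j) ⊆ tsupport f := by
  unfold pd
  exact tsupport_fderiv_apply_subset ℝ _

theorem tsupport_coord_subset {α : Type*} [TopologicalSpace α] (φ : α → E3) (i : Fin 3) :
    tsupport (fun y => φ y i) ⊆ tsupport φ := by
  refine closure_mono fun x hx hx' => hx ?_
  simp [hx']

theorem spaceForm_bound {φ : E3 → E3} (hφ : ContDiff ℝ (⊤ : ℕ∞) φ) (hc : HasCompactSupport φ)
    (ν : ℝ) : ∃ c : ℝ, 0 ≤ c ∧ ∀ v x, ‖spaceForm ν φ v x‖ ≤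
      (tsupport φ).indicator (fun _ => c * (1 + ‖v‖ ^ 2)) x := by
  have h1 : ∀ i j, ∃ M, ∀ x, ‖pd (fun z => φ z i) j x‖ ≤ M := fun i j =>
    ((hc.coord i).pd j).exists_bound_of_continuous ((hφ.coord i).pd j).continuous
  have h2 : ∀ i j, ∃ M, ∀ x, ‖pd (fun y => pd (fun z => φ z i) j y) j x‖ ≤ M := fun i j =>
    (((hc.coord i).pd j).pd j).exists_bound_of_continuous (((hφ.coord i).pd j).pd j).continuous
  choose M hM using h1
  choose N hN using h2
  have hM0 : ∀ i j, 0 ≤ M i j := fun i j => (norm_nonneg _).trans (hM i j 0)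
  have hN0 : ∀ i j, 0 ≤ N i j := fun i j => (norm_nonneg _).trans (hN i j 0)
  refine ⟨(∑ i, |ν| * ∑ j, N i j) + ∑ i, ∑ j, M i j, ?_, fun v x => ?_⟩
  · exact add_nonneg (Finset.sum_nonneg fun i _ => mul_nonneg (abs_nonneg _)
      (Finset.sum_nonneg fun j _ => hN0 i j))
      (Finset.sum_nonneg fun i _ => Finset.sum_nonneg fun j _ => hM0 i j)
  · by_cases hx : x ∈ tsupport φ
    · rw [indicator_of_mem hx]
      have hv : ∀ i, ‖v i‖ ≤ ‖v‖ := fun i => PiLp.norm_apply_le v i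
      have hv1 : ‖v‖ ≤ 1 + ‖v‖ ^ 2 := by nlinarith [sq_nonneg (‖v‖ - 1), norm_nonneg v]
      refine (norm_add_le _ _).trans ?_
      rw [add_mul]
      refine add_le_add ?_ ?_
      · rw [Finset.sum_mul]
        refine norm_sum_le_of_le _ fun i _ => ?_
        rw [norm_mul, norm_mul, mul_comm, Real.norm_eq_abs ν]
        refine mul_le_mul ?_ ((hv i).trans hv1) (norm_nonneg _) ?_
        · gcongr
          exact norm_sum_le_of_le _ fun j _ => hN i j x
        · exact mul_nonneg (abs_nonneg _) (Finset.sum_nonneg fun j _ => hN0 i j)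
      · rw [Finset.sum_mul]
        refine norm_sum_le_of_le _ fun i _ => ?_
        rw [Finset.sum_mul]
        refine norm_sum_le_of_le _ fun j _ => ?_
        rw [norm_mul, norm_mul, mul_comm]
        refine mul_le_mul (hM i j x) ?_ (by positivity) (hM0 i j)
        nlinarith [mul_le_mul (hv i) (hv j) (norm_nonneg _) (norm_nonneg _)]
    · rw [indicator_of_notMem hx]
      have e1 : ∀ i j, pd (fun z => φ z i) j x = 0 := fun i j =>
        image_eq_zero_of_notMem_tsupport fun h =>
          hx (tsupport_coord_subset φ i (tsupport_pd_subset _ j h))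
      have e2 : ∀ i j, pd (fun y => pd (fun z => φ z i) j y) j x = 0 := fun i j =>
        image_eq_zero_of_notMem_tsupport fun h =>
          hx (tsupport_coord_subset φ i (tsupport_pd_subset _ j (tsupport_pd_subset _ j h)))
      simp [spaceForm, e1, e2]

theorem measurable_spaceForm {φ : E3 → E3} (hφ : ContDiff ℝ (⊤ : ℕ∞) φ) (ν : ℝ)
    {α : Type*} [MeasurableSpace α] {v x : α → E3} (hv : Measurable v) (hx : Measurable x) :
    Measurable fun a => spaceForm ν φ (v a) (x a) := by
  have hvi : ∀ i, Measurable fun a => v a i := fun i =>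
    (EuclideanSpace.proj i : E3 →L[ℝ] ℝ).continuous.measurable.comp hv
  refine Measurable.add ?_ ?_
  · refine Finset.measurable_sum _ fun i _ => (hvi i).mul (Measurable.const_mul ?_ _)
    exact Finset.measurable_sum _ fun j _ =>
      (((hφ.coord i).pd j).pd j).continuous.measurable.comp hx
  · refine Finset.measurable_sum _ fun i _ => Finset.measurable_sum _ fun j _ => ?_
    exact ((hvi i).mul (hvi j)).mul (((hφ.coord i).pd j).continuous.measurable.comp hx)

theorem integrable_one_add_sq {K : ℝ≥0∞} (hK : K ≠ ∞) {v : E3 → E3} (hv : MemLp v 2 volume)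
    (hvK : eLpNorm v 2 volume ≤ K) {S : Set E3} (hS : IsCompact S) {c : ℝ} (hc : 0 ≤ c) :
    Integrable (S.indicator fun x => c * (1 + ‖v x‖ ^ 2)) ∧
      ∫ x, S.indicator (fun x => c * (1 + ‖v x‖ ^ 2)) x
        ≤ c * ((volume S).toReal + K.toReal ^ 2) := by
  have h2 : Integrable fun x => ‖v x‖ ^ 2 := hv.integrable_norm_pow (by norm_num)
  have h1 : IntegrableOn (fun x => 1 + ‖v x‖ ^ 2) S :=
    (integrableOn_const hS.measure_lt_top.ne).add h2.integrableOn
  refine ⟨(integrable_indicator_iff hS.measurableSet).2 (h1.const_mul c), ?_⟩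
  rw [integral_indicator hS.measurableSet, integral_const_mul]
  gcongr
  have h3 : Integrable (fun _ : E3 => (1 : ℝ)) (volume.restrict S) :=
    integrableOn_const hS.measure_lt_top.ne
  rw [integral_add h3 h2.integrableOn]
  gcongr
  · simp [Measure.real]
  · refine (setIntegral_le_integral h2 (Eventually.of_forall fun x => by positivity)).trans ?_
    have : ∫ x, ‖v x‖ ^ 2 = (eLpNorm v 2 volume ^ 2).toReal := by
      rw [eLpNorm_two_sq, integral_eq_lintegral_of_nonneg_ae
        (Eventually.of_forall fun x => sq_nonneg ‖v x‖) (by exact hv.1.norm.pow 2)]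
      congr 1
      refine lintegral_congr fun x => ?_
      rw [ENNReal.ofReal_pow (norm_nonneg _), ofReal_norm]
    rw [this, toReal_pow]
    gcongr

/-- Integration by parts against an indefinite integral on the half line. -/
theorem integral_Ioi_primitive_mul {k ζ : ℝ → ℝ} (hk : Measurable k) {L : ℝ}
    (hkL : ∀ t, ‖k t‖ ≤ L) (hζ : Continuous ζ) (hc : HasCompactSupport ζ) :
    ∫ t in Ioi (0:ℝ), (∫ τ in Ioi t, ζ τ) * k t = ∫ τ in Ioi (0:ℝ), ζ τ * ∫ t in (0:ℝ)..τ, k t := by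
  obtain ⟨T, hT⟩ : ∃ T : ℝ, ∀ τ, T < τ → ζ τ = 0 := by
    obtain ⟨T, hT⟩ := hc.isCompact.bddAbove
    exact ⟨T, fun τ hτ => image_eq_zero_of_notMem_tsupport fun h => not_le.2 hτ (hT h)⟩
  let F : ℝ → ℝ → ℝ := fun t τ => (Ioi t).indicator ζ τ * k t
  have hFm : Measurable (Function.uncurry F) := by
    have h1 : Function.uncurry F = fun p : ℝ × ℝ =>
        {p : ℝ × ℝ | p.1 < p.2}.indicator (fun p => ζ p.2) p * k p.1 := by
      ext ⟨t, τ⟩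
      simp only [Function.uncurry, F, indicator, mem_Ioi, mem_ofPred_eq]
    rw [h1]
    exact ((hζ.measurable.comp measurable_snd).indicator
      (measurableSet_lt measurable_fst measurable_snd)).mul (hk.comp measurable_fst)
  have hζi : Integrable ζ := hζ.integrable_of_hasCompactSupport hc
  have hFi : Integrable (Function.uncurry F)
      ((volume.restrict (Ioi (0:ℝ))).prod (volume.restrict (Ioi (0:ℝ)))) := by
    have hb : Integrable (fun p : ℝ × ℝ => (Iic T).indicator (fun _ => L) p.1 * ‖ζ p.2‖)
        ((volume.restrict (Ioi (0:ℝ))).prod (volume.restrict (Ioi (0:ℝ)))) := by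
      refine Integrable.mul_prod ?_ hζi.integrableOn.norm
      rw [integrable_indicator_iff measurableSet_Iic]
      refine integrableOn_const ?_
      rw [Measure.restrict_apply measurableSet_Iic]
      exact ((measure_mono (fun x hx => ⟨le_of_lt hx.2, hx.1⟩ :
        Iic T ∩ Ioi 0 ⊆ Icc 0 T)).trans_lt measure_Icc_lt_top).ne
    refine hb.mono' hFm.aestronglyMeasurable (Eventually.of_forall fun ⟨t, τ⟩ => ?_)
    simp only [Function.uncurry, F, norm_mul]
    have hL : 0 ≤ L := (norm_nonneg _).trans (hkL 0)
    by_cases h1 : t < τ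
    · rw [indicator_of_mem (mem_Ioi.2 h1)]
      by_cases h2 : t ≤ T
      · rw [indicator_of_mem (mem_Iic.2 h2), mul_comm]
        gcongr
        exact hkL t
      · rw [hT τ (by linarith)]; simp
    · rw [indicator_of_notMem (by simpa using h1)]
      simp only [norm_zero, zero_mul]
      exact mul_nonneg (indicator_nonneg (fun _ _ => hL) _) (norm_nonneg _)
  have hsw := integral_integral_swap hFi
  have e1 : ∀ t ∈ Ioi (0:ℝ), ∫ τ in Ioi (0:ℝ), F t τ = (∫ τ in Ioi t, ζ τ) * k t := by
    intro t ht
    simp only [F]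
    rw [integral_mul_const, integral_indicator measurableSet_Ioi,
      Measure.restrict_restrict measurableSet_Ioi,
      inter_eq_left.2 (Ioi_subset_Ioi (le_of_lt ht))]
  have e2 : ∀ τ ∈ Ioi (0:ℝ), ∫ t in Ioi (0:ℝ), F t τ = ζ τ * ∫ t in (0:ℝ)..τ, k t := by
    intro τ hτ
    have : ∀ t, F t τ = ζ τ * (Iio τ).indicator k t := fun t => by
      simp only [F, indicator, mem_Ioi, mem_Iio]
      split_ifs <;> ring
    simp_rw [this]
    rw [integral_const_mul, integral_indicator measurableSet_Iio,
      Measure.restrict_restrict measurableSet_Iio, intervalIntegral.integral_of_le (le_of_lt hτ),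
      integral_Ioc_eq_integral_Ioo]
    congr 3
    ext x; simp [and_comm]
  rw [setIntegral_congr_fun measurableSet_Ioi e1, setIntegral_congr_fun measurableSet_Ioi e2] at hsw
  exact hsw

theorem deriv_smul_coord {Θ : ℝ → ℝ} {θ' t : ℝ} (h : HasDerivAt Θ θ' t) (v : E3) (i : Fin 3) :
    deriv (fun τ => (Θ τ • v) i) t = θ' * v i := by
  have : HasDerivAt (fun τ => (Θ τ • v) i) (θ' * v i) t := by
    simpa using h.mul_const (v i)
  exact this.deriv

theorem isTest_smul {Θ : ℝ → ℝ} (hΘ : ContDiff ℝ (⊤ : ℕ∞) Θ) (hc : HasCompactSupport Θ)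
    {φ : E3 → E3} (hφ : IsSolenoidalTest φ) : IsTest fun p => Θ p.1 • φ p.2 := by
  refine ⟨(hΘ.comp contDiff_fst).smul (hφ.1.comp contDiff_snd), ?_, fun p => ?_⟩
  · refine HasCompactSupport.intro (hc.isCompact.prod hφ.2.1.isCompact) fun p hp => ?_
    rw [mem_prod, not_and_or] at hp
    rcases hp with hp | hp
    · simp [image_eq_zero_of_notMem_tsupport hp]
    · simp [image_eq_zero_of_notMem_tsupport hp]
  · simp only [PiLp.smul_apply, smul_eq_mul]
    simp_rw [pd_const_mul (hφ.1.coord _), ← Finset.mul_sum, hφ.2.2, mul_zero]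

theorem weak_integrand_smul {Θ : ℝ → ℝ} {φ : E3 → E3} (hφ : ContDiff ℝ (⊤ : ℕ∞) φ) (ν : ℝ)
    (v : E3) {θ' : ℝ} (p : ℝ × E3) (h : HasDerivAt Θ θ' p.1) :
    (∑ i, v i * (timeDeriv (fun p => Θ p.1 • φ p.2) p i
        + ν * spaceLap (fun p => Θ p.1 • φ p.2) p i)) +
      ∑ i, ∑ j, v i * v j * spaceGrad (fun p => Θ p.1 • φ p.2) p i j
    = θ' * (∑ i, v i * φ p.2 i) + Θ p.1 * spaceForm ν φ v p.2 := by
  have h1 : ∀ i, timeDeriv (fun p => Θ p.1 • φ p.2) p i = θ' * φ p.2 i := fun i => by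
    unfold timeDeriv
    exact deriv_smul_coord h (φ p.2) i
  have h2 : ∀ i j, spaceGrad (fun p => Θ p.1 • φ p.2) p i j
      = Θ p.1 * pd (fun z => φ z i) j p.2 := fun i j => by
    simp only [spaceGrad, PiLp.smul_apply, smul_eq_mul]
    exact pd_const_mul (hφ.coord i) _ _ _
  have h3 : ∀ i, spaceLap (fun p => Θ p.1 • φ p.2) p i
      = Θ p.1 * ∑ j, pd (fun y => pd (fun z => φ z i) j y) j p.2 := fun i => by
    simp only [spaceLap, PiLp.smul_apply, smul_eq_mul]
    simp_rw [pd_const_mul (hφ.coord i)]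
    rw [Finset.mul_sum]
    exact Finset.sum_congr rfl fun j _ => pd_const_mul ((hφ.coord i).pd j) _ _ _
  simp_rw [h1, h2, h3, spaceForm, mul_add, Finset.sum_add_distrib, Finset.mul_sum]
  rw [add_assoc]
  congr 1
  · exact Finset.sum_congr rfl fun i _ => by ring
  · congr 1
    · exact Finset.sum_congr rfl fun i _ => Finset.sum_congr rfl fun j _ => by ring
    · exact Finset.sum_congr rfl fun i _ => Finset.sum_congr rfl fun j _ => by ring

theorem integral_mul_solenoidal_bound {K : ℝ≥0∞} {u : ℝ → E3 → E3} (hu : IsTame K u) (hK : K ≠ ∞)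
    {φ : E3 → E3} (hφ : IsSolenoidalTest φ) (t : ℝ) :
    |∫ x, ∑ i, u t x i * φ x i| ≤ (K * eLpNorm φ 2 volume).toReal := by
  have hφ2 : MemLp φ 2 volume := hφ.1.continuous.memLp_of_hasCompactSupport hφ.2.1
  have h := integral_mul_le_eLpNorm_mul (hu.memLp hK t) hφ2
  have e : ∀ x, inner ℝ (u t x) (φ x) = ∑ i, u t x i * φ x i := fun x => by
    rw [PiLp.inner_apply]
    exact Finset.sum_congr rfl fun i _ => by simp [mul_comm]
  simp_rw [e] at h
  refine h.trans (toReal_mono (mul_ne_top hK hφ2.2.ne) ?_)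
  gcongr
  exact hu.bound t

/-- Pairings of a weak solution with a solenoidal test field are Lipschitz in time, with a
constant depending only on the energy bound. -/
theorem exists_lipschitz_pairing {K : ℝ≥0∞} (hK : K ≠ ∞) (ν : ℝ) {φ : E3 → E3}
    (hφ : IsSolenoidalTest φ) :
    ∃ L : ℝ, ∀ (u₀ : E3 → E3) (u : ℝ → E3 → E3), IsTame K u → WeakForm ν u₀ u →
      ∃ H : ℝ → ℝ, (∀ s t, |H s - H t| ≤ L * |s - t|) ∧ H 0 = (∫ x, ∑ i, u₀ x i * φ x i) ∧
        ∀ᵐ t ∂(volume.restrict (Ioi (0:ℝ))), ∫ x, ∑ i, u t x i * φ x i = H t := by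
  obtain ⟨c, hc0, hc⟩ := spaceForm_bound hφ.1 hφ.2.1 ν
  set L := c * ((volume (tsupport φ)).toReal + K.toReal ^ 2) with hL
  refine ⟨L, fun u₀ u hu hw => ?_⟩
  have hN : Measurable fun p : ℝ × E3 => spaceForm ν φ (u p.1 p.2) p.2 :=
    measurable_spaceForm hφ.1 ν hu.meas.measurable measurable_snd
  have hslice : ∀ t, Integrable (fun x => spaceForm ν φ (u t x) x) := fun t =>
    (integrable_one_add_sq hK (hu.memLp hK t) (hu.bound t) hφ.2.1.isCompact hc0).1.mono'
      (hN.comp measurable_prodMk_left).aestronglyMeasurable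
      (Eventually.of_forall fun x => hc (u t x) x)
  let k : ℝ → ℝ := fun t => ∫ x, spaceForm ν φ (u t x) x
  let m : ℝ → ℝ := fun t => ∫ x, ∑ i, u t x i * φ x i
  have hkm : Measurable k := (hN.stronglyMeasurable.integral_prod_right (ν := volume)).measurable
  have hknorm : ∀ t, ∫ x, ‖spaceForm ν φ (u t x) x‖ ≤ L := fun t =>
    (integral_mono (hslice t).norm
      (integrable_one_add_sq hK (hu.memLp hK t) (hu.bound t) hφ.2.1.isCompact hc0).1
      fun x => hc (u t x) x).trans
      (integrable_one_add_sq hK (hu.memLp hK t) (hu.bound t) hφ.2.1.isCompact hc0).2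
  have hkL : ∀ t, ‖k t‖ ≤ L := fun t => (norm_integral_le_integral_norm _).trans (hknorm t)
  have hki : ∀ a b, IntervalIntegrable k volume a b := fun a b =>
    (intervalIntegrable_const (c := L)).mono_fun hkm.aestronglyMeasurable
      (Eventually.of_forall fun t => (hkL t).trans (le_abs_self _))
  have hmm : Measurable m := by
    have : Measurable fun p : ℝ × E3 => ∑ i, u p.1 p.2 i * φ p.2 i := by
      refine Finset.measurable_sum _ fun i _ => Measurable.mul ?_ ?_
      · exact (EuclideanSpace.proj i : E3 →L[ℝ] ℝ).continuous.measurable.comp hu.meas.measurable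
      · exact (hφ.1.coord i).continuous.measurable.comp measurable_snd
    exact (this.stronglyMeasurable.integral_prod_right (ν := volume)).measurable
  let m₀ := ∫ x, ∑ i, u₀ x i * φ x i
  refine ⟨fun t => m₀ + ∫ τ in (0:ℝ)..t, k τ, fun s t => ?_, by simp [m₀], ?_⟩
  · rw [add_sub_add_left_eq_sub, intervalIntegral.integral_interval_sub_left (hki _ _) (hki _ _)]
    exact intervalIntegral.norm_integral_le_of_norm_le_const fun x _ => hkL x
  have hmb := integral_mul_solenoidal_bound hu hK hφ
  have hprim : Continuous fun t => ∫ τ in (0:ℝ)..t, k τ :=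
    intervalIntegral.continuous_primitive hki 0
  have key : ∀ᵐ t ∂(volume : Measure ℝ), t ∈ Ioi (0:ℝ) →
      (m t - (m₀ + ∫ τ in (0:ℝ)..t, k τ)) = 0 := by
    have hloc : LocallyIntegrable (fun t => m t - (m₀ + ∫ τ in (0:ℝ)..t, k τ)) := by
      refine LocallyIntegrable.sub ?_ (continuous_const.add hprim).locallyIntegrable
      refine ((continuous_const (y := (K * eLpNorm φ 2 volume).toReal)).locallyIntegrable).mono
        hmm.aestronglyMeasurable (Eventually.of_forall fun t => (hmb t).trans (le_abs_self _))
    refine isOpen_Ioi.ae_eq_zero_of_integral_contDiff_smul_eq_zero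
      (hloc.locallyIntegrableOn _) fun ζ hζ hζc hζs => ?_
    have hζi : Integrable ζ := hζ.continuous.integrable_of_hasCompactSupport hζc
    let I := ∫ τ in Ioi (0:ℝ), ζ τ
    let Z : ℝ → ℝ := fun t => ∫ τ in (0:ℝ)..t, ζ τ
    have hZ : ∀ t, HasDerivAt Z (ζ t) t := fun t =>
      (hζ.continuous.integral_hasStrictDerivAt 0 t).hasDerivAt
    have hZI : ∀ t, Z t - I = -∫ τ in Ioi t, ζ τ := fun t => by
      have := intervalIntegral.integral_interval_add_Ioi (f := ζ) (μ := volume) (a := 0) (b := t)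
        hζi.integrableOn hζi.integrableOn
      simp only [Z, I]; linarith
    have hZs : ContDiff ℝ (⊤ : ℕ∞) Z := by
      rw [contDiff_infty_iff_deriv]
      refine ⟨fun t => (hZ t).differentiableAt, ?_⟩
      have : deriv Z = ζ := funext fun t => (hZ t).deriv
      rwa [this]
    obtain ⟨T, hT⟩ : ∃ T : ℝ, ∀ τ, T < τ → ζ τ = 0 := by
      obtain ⟨T, hT⟩ := hζc.isCompact.bddAbove
      exact ⟨T, fun τ hτ => image_eq_zero_of_notMem_tsupport fun h => not_le.2 hτ (hT h)⟩
    let Θ : ℝ → ℝ := fun t => (Z t - I) * Real.smoothTransition (t + 2)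
    have hΘs : ContDiff ℝ (⊤ : ℕ∞) Θ :=
      (hZs.sub contDiff_const).mul
        (Real.smoothTransition.contDiff.comp (contDiff_id.add contDiff_const))
    have hΘc : HasCompactSupport Θ := by
      refine HasCompactSupport.intro (isCompact_Icc (a := -2) (b := T)) fun t ht => ?_
      rw [mem_Icc, not_and_or, not_le, not_le] at ht
      rcases ht with ht | ht
      · simp only [Θ, Real.smoothTransition.zero_of_nonpos (show t + 2 ≤ 0 by linarith), mul_zero]
      · simp only [Θ, hZI]
        rw [setIntegral_congr_fun (g := fun _ => (0 : ℝ)) measurableSet_Ioi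
          fun τ hτ => hT τ (lt_trans ht hτ)]
        simp
    have hΘpos : ∀ t, -1 < t → Θ t = Z t - I := fun t ht => by
      simp only [Θ, Real.smoothTransition.one_of_one_le (show 1 ≤ t + 2 by linarith), mul_one]
    have hΘd : ∀ t, 0 < t → HasDerivAt Θ (ζ t) t := fun t ht => by
      refine ((hZ t).sub_const I).congr_of_eventuallyEq ?_
      filter_upwards [lt_mem_nhds (show (-1:ℝ) < t by linarith)] with s hs
      exact hΘpos s hs
    have hΘ0 : Θ 0 = -I := by rw [hΘpos 0 (by norm_num)]; simp [Z]
    have hw1 := hw _ (isTest_smul hΘs hΘc hφ)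
    have hpos : ∀ᵐ p ∂μST, (0:ℝ) < p.1 := by
      rw [μST_eq]; exact ae_restrict_mem measurableSet_pos_time
    have e1 : ∀ᵐ p ∂μST, ((∑ i, u p.1 p.2 i * (timeDeriv (fun p => Θ p.1 • φ p.2) p i
          + ν * spaceLap (fun p => Θ p.1 • φ p.2) p i)) +
        ∑ i, ∑ j, u p.1 p.2 i * u p.1 p.2 j * spaceGrad (fun p => Θ p.1 • φ p.2) p i j)
        = ζ p.1 * (∑ i, u p.1 p.2 i * φ p.2 i) + Θ p.1 * spaceForm ν φ (u p.1 p.2) p.2 := by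
      filter_upwards [hpos] with p hp
      exact weak_integrand_smul hφ.1 ν _ p (hΘd p.1 hp)
    rw [integral_congr_ae e1] at hw1
    have hint1 : Integrable (fun p : ℝ × E3 => ζ p.1 * ∑ i, u p.1 p.2 i * φ p.2 i) μST := by
      simp_rw [Finset.mul_sum]
      refine integrable_finsetSum _ fun i _ => ?_
      have hcont : Continuous fun p : ℝ × E3 => ζ p.1 * φ p.2 i :=
        (hζ.continuous.comp continuous_fst).mul ((hφ.1.coord i).continuous.comp continuous_snd)
      have hcs : HasCompactSupport fun p : ℝ × E3 => ζ p.1 * φ p.2 i := by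
        refine HasCompactSupport.intro (hζc.isCompact.prod (hφ.2.1.coord i).isCompact) fun p hp => ?_
        rw [mem_prod, not_and_or] at hp
        rcases hp with hp | hp
        · simp [image_eq_zero_of_notMem_tsupport hp]
        · rw [image_eq_zero_of_notMem_tsupport hp, mul_zero]
      refine ((hu.locallyIntegrable hK i).integrable_smul_left_of_hasCompactSupport hcont hcs).congr
        (Eventually.of_forall fun p => ?_)
      simp only [smul_eq_mul]; ring
    have hΘi : Integrable Θ := hΘs.continuous.integrable_of_hasCompactSupport hΘc
    have hint2 : Integrable (fun p : ℝ × E3 => Θ p.1 * spaceForm ν φ (u p.1 p.2) p.2) μST := by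
      have hm : Measurable fun p : ℝ × E3 => Θ p.1 * spaceForm ν φ (u p.1 p.2) p.2 :=
        (hΘs.continuous.measurable.comp measurable_fst).mul hN
      unfold μST
      rw [integrable_prod_iff hm.aestronglyMeasurable]
      refine ⟨Eventually.of_forall fun t => ?_, ?_⟩
      · exact (hslice t).const_mul (Θ t)
      refine (hΘi.integrableOn.norm.mul_const L).mono'
        (hm.stronglyMeasurable.norm.integral_prod_right (ν := volume)).aestronglyMeasurable
        (Eventually.of_forall fun t => ?_)
      rw [Real.norm_of_nonneg (integral_nonneg fun _ => norm_nonneg _)]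
      simp only [norm_mul]
      rw [integral_const_mul]
      exact mul_le_mul_of_nonneg_left (hknorm t) (norm_nonneg _)
    rw [integral_add hint1 hint2] at hw1
    unfold μST at hw1 hint1 hint2
    rw [integral_prod _ hint1, integral_prod _ hint2] at hw1
    simp only [integral_const_mul] at hw1
    have e2 : ∫ t in Ioi (0:ℝ), Θ t * k t = -∫ τ in Ioi (0:ℝ), ζ τ * ∫ t in (0:ℝ)..τ, k t := by
      rw [← integral_Ioi_primitive_mul hkm hkL hζ.continuous hζc, ← integral_neg]
      refine setIntegral_congr_fun measurableSet_Ioi fun t ht => ?_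
      rw [mem_Ioi] at ht
      change Θ t * k t = -((∫ τ in Ioi t, ζ τ) * k t)
      rw [hΘpos t (by linarith), hZI, neg_mul]
    have e3 : -∫ x, ∑ i, u₀ x i * (Θ 0 • φ x) i = I * m₀ := by
      simp only [PiLp.smul_apply, smul_eq_mul, hΘ0, m₀]
      rw [← integral_const_mul, ← integral_neg]
      congr 1; ext x
      rw [Finset.mul_sum, ← Finset.sum_neg_distrib]
      exact Finset.sum_congr rfl fun i _ => by ring
    rw [e3] at hw1
    have hw2 : (∫ t in Ioi (0:ℝ), ζ t * m t) - ∫ τ in Ioi (0:ℝ), ζ τ * ∫ t in (0:ℝ)..τ, k t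
        = I * m₀ := by
      rw [← hw1, sub_eq_add_neg, ← e2]
    rw [← setIntegral_eq_integral_of_forall_compl_eq_zero (s := Ioi (0:ℝ)) fun t ht => by
      rw [image_eq_zero_of_notMem_tsupport fun h => ht (hζs h), zero_smul]]
    have i1 : IntegrableOn (fun t => ζ t * m t) (Ioi 0) := by
      refine (hζi.norm.mul_const (K * eLpNorm φ 2 volume).toReal).integrableOn.mono'
        (hζ.continuous.measurable.mul hmm).aestronglyMeasurable (Eventually.of_forall fun t => ?_)
      rw [norm_mul]
      exact mul_le_mul_of_nonneg_left (hmb t) (norm_nonneg _)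
    have i2 : IntegrableOn (fun t => ζ t * ∫ τ in (0:ℝ)..t, k τ) (Ioi 0) :=
      ((hζ.continuous.mul hprim).integrable_of_hasCompactSupport hζc.mul_right).integrableOn
    have i3 : IntegrableOn (fun t => ζ t * m₀) (Ioi 0) := (hζi.mul_const m₀).integrableOn
    have e4 : ∀ t, ζ t • (m t - (m₀ + ∫ τ in (0:ℝ)..t, k τ))
        = ζ t * m t - ζ t * m₀ - ζ t * ∫ τ in (0:ℝ)..t, k τ := fun t => by
      rw [smul_eq_mul]; ring
    simp_rw [e4]
    have i4 : Integrable (fun t => ζ t * m t - ζ t * m₀) (volume.restrict (Ioi 0)) := i1.sub i3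
    rw [integral_sub i4 i2, integral_sub i1 i3, integral_mul_const]
    change (∫ t in Ioi (0:ℝ), ζ t * m t) - I * m₀ - _ = 0
    linarith
  rw [ae_restrict_iff' measurableSet_Ioi]
  filter_upwards [key] with t ht htp
  exact sub_eq_zero.1 (ht htp)

theorem inner_E3 (v w : E3) : inner ℝ v w = ∑ i, v i * w i := by
  rw [PiLp.inner_apply]
  exact Finset.sum_congr rfl fun i _ => by simp [mul_comm]

theorem inner_Lp_eq {f : E3 → E3} (hf : MemLp f 2 volume) {g : E3 → E3} (hg : MemLp g 2 volume) :
    inner ℝ (hf.toLp f) (hg.toLp g) = ∫ x, ∑ i, f x i * g x i := by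
  rw [L2.inner_def]
  refine integral_congr_ae ?_
  filter_upwards [hf.coeFn_toLp, hg.coeFn_toLp] with x h1 h2
  rw [h1, h2, inner_E3]

theorem IsSolenoidalTest.memLp {φ : E3 → E3} (hφ : IsSolenoidalTest φ) : MemLp φ 2 volume :=
  hφ.1.continuous.memLp_of_hasCompactSupport hφ.2.1

/-- A countable family of solenoidal test fields, dense among all of them in `L²`. -/
theorem exists_dense_solenoidal : ∃ φ : ℕ → E3 → E3, ∃ h : ∀ k, IsSolenoidalTest (φ k),
    ∀ (ψ : E3 → E3) (hψ : IsSolenoidalTest ψ),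
      hψ.memLp.toLp ψ ∈ closure (range fun k => (h k).memLp.toLp (φ k)) := by
  have : Fact ((2:ℝ≥0∞) ≠ ∞) := ⟨by norm_num⟩
  let ι : {ψ : E3 → E3 // IsSolenoidalTest ψ} → Lp E3 2 (volume : Measure E3) :=
    fun ψ => ψ.2.memLp.toLp ψ.1
  have h0 : IsSolenoidalTest (fun _ => 0) := by
    refine ⟨contDiff_const, HasCompactSupport.zero, fun x => ?_⟩
    simp [pd]
  have : Nonempty (range ι) := ⟨⟨_, ⟨⟨_, h0⟩, rfl⟩⟩⟩
  choose c hc using fun k => (TopologicalSpace.denseSeq (range ι) k).2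
  refine ⟨fun k => (c k).1, fun k => (c k).2, fun ψ hψ => ?_⟩
  have h1 : (⟨ι ⟨ψ, hψ⟩, mem_range_self _⟩ : range ι) ∈
      closure (range (TopologicalSpace.denseSeq (range ι))) :=
    TopologicalSpace.denseRange_denseSeq (range ι) _
  rw [closure_subtype] at h1
  convert h1 using 2
  ext f
  simp only [mem_range, mem_image, exists_exists_eq_and]
  exact exists_congr fun k => by rw [← hc k]

/-- The vectors against which a bounded sequence has convergent inner products form a closed
subspace. -/
theorem exists_submodule_cauchySeq {E : Type*} [NormedAddCommGroup E] [InnerProductSpace ℝ E]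
    (v : ℕ → E) {B : ℝ} (hB : ∀ n, ‖v n‖ ≤ B) :
    ∃ M : Submodule ℝ E, IsClosed (M : Set E) ∧
      ∀ f, f ∈ M ↔ CauchySeq fun n => inner ℝ (v n) f := by
  let M : Submodule ℝ E :=
    { carrier := {f | CauchySeq fun n => inner ℝ (v n) f}
      zero_mem' := by
        simp only [mem_ofPred_eq, inner_zero_right]
        exact cauchySeq_const 0
      add_mem' := fun {f g} hf hg => by
        simp only [mem_ofPred_eq, inner_add_right]
        exact CauchySeq.add hf hg
      smul_mem' := fun c f hf => by
        simp only [mem_ofPred_eq, inner_smul_right] at hf ⊢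
        obtain ⟨a, ha⟩ := cauchySeq_tendsto_of_complete hf
        exact (ha.const_mul c).cauchySeq }
  refine ⟨M, ?_, fun f => Iff.rfl⟩
  rw [← closure_subset_iff_isClosed]
  intro f hf
  change CauchySeq fun n => inner ℝ (v n) f
  have hB0 : 0 ≤ B := (norm_nonneg _).trans (hB 0)
  rw [Metric.cauchySeq_iff]
  intro ε hε
  obtain ⟨g, hg, hgf⟩ := Metric.mem_closure_iff.1 hf (ε / (3 * (B + 1))) (by positivity)
  obtain ⟨N, hN⟩ := Metric.cauchySeq_iff.1 hg (ε / 3) (by positivity)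
  refine ⟨N, fun m hm n hn => ?_⟩
  have key : ∀ n, |inner ℝ (v n) f - inner ℝ (v n) g| < ε / 3 := fun n => by
    rw [← inner_sub_right]
    calc |inner ℝ (v n) (f - g)| ≤ ‖v n‖ * ‖f - g‖ := abs_real_inner_le_norm _ _
      _ ≤ (B + 1) * ‖f - g‖ := by gcongr; linarith [hB n]
      _ < (B + 1) * (ε / (3 * (B + 1))) := by
          rw [← dist_eq_norm]; gcongr
      _ = ε / 3 := by field_simp
  have h3 := hN m hm n hn
  rw [Real.dist_eq] at h3 ⊢
  have h1 := key m
  have h2 := key n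
  rw [abs_lt] at *
  constructor <;> linarith [h1.1, h1.2, h2.1, h2.2, h3.1, h3.2]

/-- A bounded sequence of divergence-free fields whose pairings with solenoidal test fields
converge is weakly convergent in `L²`. -/
theorem cauchySeq_inner_of_solenoidal {v : ℕ → E3 → E3} {K : ℝ≥0∞} (hK : K ≠ ∞)
    (hv : ∀ n, MemLp (v n) 2 volume) (hb : ∀ n, eLpNorm (v n) 2 volume ≤ K)
    (hd : ∀ n, IsDivFree (v n)) {φ : ℕ → E3 → E3} (hφ : ∀ k, IsSolenoidalTest (φ k))
    (hdense : ∀ (ψ : E3 → E3) (hψ : IsSolenoidalTest ψ),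
      hψ.memLp.toLp ψ ∈ closure (range fun k => (hφ k).memLp.toLp (φ k)))
    (hc : ∀ k, CauchySeq fun n => ∫ x, ∑ i, v n x i * φ k x i)
    {f : E3 → E3} (hf : MemLp f 2 volume) : CauchySeq fun n => ∫ x, ∑ i, v n x i * f x i := by
  obtain ⟨M, hMc, hM⟩ := exists_submodule_cauchySeq (fun n => (hv n).toLp (v n)) (B := K.toReal)
    fun n => by
      rw [Lp.norm_toLp]
      exact toReal_mono hK (hb n)
  have hM' : ∀ {g : E3 → E3} (hg : MemLp g 2 volume), hg.toLp g ∈ M ↔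
      CauchySeq fun n => ∫ x, ∑ i, v n x i * g x i := fun hg => by
    rw [hM]
    simp_rw [inner_Lp_eq]
  rw [← hM' hf]
  have : CompleteSpace M := hMc.completeSpace_coe
  suffices h : M = ⊤ by rw [h]; trivial
  rw [← Submodule.orthogonal_eq_bot_iff, Submodule.eq_bot_iff]
  intro w hw
  rw [Submodule.mem_orthogonal'] at hw
  have hw' : ∀ {g : E3 → E3} (hg : MemLp g 2 volume), hg.toLp g ∈ M →
      ∫ x, ∑ i, w x i * g x i = 0 := fun hg h => by
    rw [← hw _ h, ← inner_Lp_eq (Lp.memLp w) hg, Lp.toLp_coeFn]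
  have hφM : ∀ ψ, IsSolenoidalTest ψ → ∫ x, ∑ i, w x i * ψ x i = 0 := fun ψ hψ =>
    hw' hψ.memLp (closure_minimal (range_subset_iff.2 fun k => (hM' _).2 (hc k)) hMc
      (hdense ψ hψ))
  have hwd : IsDivFree w := fun ψ hψ hψc => by
    let g : E3 → E3 := fun x => WithLp.toLp 2 fun i => pd ψ i x
    have hg : MemLp g 2 volume := by
      refine Continuous.memLp_of_hasCompactSupport ?_ ?_
      · exact (PiLp.continuous_toLp 2 _).comp (continuous_pi fun i => (hψ.pd i).continuous)
      · refine HasCompactSupport.intro hψc.isCompact fun x hx => ?_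
        ext i
        exact image_eq_zero_of_notMem_tsupport (f := pd ψ i) fun h => hx (tsupport_pd_subset ψ i h)
    refine hw' hg ((hM' hg).2 ?_)
    have : ∀ n, ∫ x, ∑ i, v n x i * g x i = 0 := fun n => hd n ψ hψ hψc
    simp_rw [this]
    exact cauchySeq_const 0
  have h := ae_eq_zero_of_orthogonal_solenoidal (Lp.memLp w) hwd hφM
  exact (Lp.eq_zero_iff_ae_eq_zero).2 h

/-- Equi-Lipschitz functions converging at all rational points converge everywhere. -/
theorem cauchySeq_of_rat {H : ℕ → ℝ → ℝ} {L : ℝ} (hL : ∀ n s t, |H n s - H n t| ≤ L * |s - t|)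
    (hq : ∀ q : ℚ, CauchySeq fun n => H n q) (t : ℝ) : CauchySeq fun n => H n t := by
  have hL0 : 0 ≤ L := by
    have := (abs_nonneg _).trans (hL 0 1 0)
    simpa using this
  rw [Metric.cauchySeq_iff]
  intro ε hε
  obtain ⟨q, hq1, hq2⟩ := exists_rat_btwn (show t < t + ε / (3 * (L + 1)) by
    linarith [show 0 < ε / (3 * (L + 1)) by positivity])
  obtain ⟨N, hN⟩ := Metric.cauchySeq_iff.1 (hq q) (ε / 3) (by positivity)
  refine ⟨N, fun m hm n hn => ?_⟩
  have key : ∀ n, |H n t - H n q| < ε / 3 := fun n => by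
    calc |H n t - H n q| ≤ L * |t - q| := hL n t q
      _ ≤ (L + 1) * |t - q| := by gcongr; linarith
      _ < (L + 1) * (ε / (3 * (L + 1))) := by
          gcongr; rw [abs_lt]; constructor <;> linarith
      _ = ε / 3 := by field_simp
  have h3 := hN m hm n hn
  rw [Real.dist_eq] at h3 ⊢
  have h1 := key m
  have h2 := key n
  rw [abs_lt] at *
  constructor <;> linarith [h1.1, h1.2, h2.1, h2.2, h3.1, h3.2]

/-- Along a subsequence, weak solutions with a common energy bound converge weakly in `L²` at
almost every time. -/
theorem exists_subseq_weak {K : ℝ≥0∞} (hK : K ≠ ∞) (ν : ℝ) {u₀ : ℕ → E3 → E3}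
    {u : ℕ → ℝ → E3 → E3} (hu : ∀ n, IsTame K (u n)) (hw : ∀ n, WeakForm ν (u₀ n) (u n))
    (h0 : ∀ φ, IsSolenoidalTest φ → CauchySeq fun n => ∫ x, ∑ i, u₀ n x i * φ x i) :
    ∃ σ : ℕ → ℕ, StrictMono σ ∧ ∀ᵐ t ∂(volume.restrict (Ioi (0:ℝ))), ∀ f : E3 → E3,
      MemLp f 2 volume → CauchySeq fun n => ∫ x, ∑ i, u (σ n) t x i * f x i := by
  obtain ⟨φ, hφ, hdense⟩ := exists_dense_solenoidal
  choose L hL using fun k => exists_lipschitz_pairing hK ν (hφ k)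
  choose H hHL hH0 hH using fun k n => hL k (u₀ n) (u n) (hu n) (hw n)
  have hbd : ∀ k, ∃ B, ∀ n, |H k n 0| ≤ B := fun k => by
    obtain ⟨a, ha⟩ := cauchySeq_tendsto_of_complete (h0 (φ k) (hφ k))
    obtain ⟨B, hB⟩ := ha.abs.bddAbove_range
    refine ⟨B, fun n => ?_⟩
    rw [hH0]
    exact hB (mem_range_self n)
  choose B hB using hbd
  let F : ℕ → ℕ × ℚ → ℝ := fun n p => H p.1 n p.2
  have hF : ∀ n, F n ∈ univ.pi fun p : ℕ × ℚ =>
      Icc (-(B p.1 + L p.1 * |(p.2 : ℝ)|)) (B p.1 + L p.1 * |(p.2 : ℝ)|) := fun n p _ => by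
    rw [mem_Icc, ← abs_le]
    have h1 := hHL p.1 n p.2 0
    rw [sub_zero] at h1
    calc |H p.1 n p.2| = |H p.1 n 0 + (H p.1 n p.2 - H p.1 n 0)| := by congr 1; ring
      _ ≤ |H p.1 n 0| + |H p.1 n p.2 - H p.1 n 0| := abs_add_le _ _
      _ ≤ _ := add_le_add (hB _ n) h1
  obtain ⟨a, -, σ, hσ, ha⟩ := (isCompact_univ_pi fun p : ℕ × ℚ => isCompact_Icc).tendsto_subseq hF
  rw [tendsto_pi_nhds] at ha
  refine ⟨σ, hσ, ?_⟩
  have hall := ae_all_iff.2 fun k => ae_all_iff.2 fun n => hH k n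
  filter_upwards [hall] with t ht f hf
  refine cauchySeq_inner_of_solenoidal hK (fun n => (hu (σ n)).memLp hK t)
    (fun n => (hu (σ n)).bound t) (fun n => (hu (σ n)).div t) hφ hdense (fun k => ?_) hf
  simp_rw [ht]
  exact cauchySeq_of_rat (fun n => hHL k (σ n)) (fun q => (ha (k, q)).cauchySeq) t

theorem tendsto_eLpNorm_two_iff {α E ι : Type*} [MeasurableSpace α] [NormedAddCommGroup E]
    {μ : Measure α} {f : ι → α → E} {l : Filter ι} :
    Tendsto (fun n => eLpNorm (f n) 2 μ) l (nhds 0) ↔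
      Tendsto (fun n => ∫⁻ x, ‖f n x‖ₑ ^ 2 ∂μ) l (nhds 0) := by
  simp_rw [← eLpNorm_two_sq]
  constructor
  · intro h
    simpa using ENNReal.Tendsto.pow (n := 2) h
  · intro h
    have h2 := (ENNReal.continuous_rpow_const (y := (1 / 2 : ℝ))).tendsto 0 |>.comp h
    have e : ∀ a : ℝ≥0∞, (a ^ 2) ^ (1 / 2 : ℝ) = a := fun a => by
      rw [← ENNReal.rpow_natCast, ← ENNReal.rpow_mul]; norm_num
    rw [ENNReal.zero_rpow_of_pos (by norm_num)] at h2
    refine h2.congr fun n => ?_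
    exact e _

theorem exists_tendsto_eLpNorm_of_bounded {α : Type*} [MeasurableSpace α] {μ : Measure α}
    [IsFiniteMeasure μ] {b : ℕ → α → ℝ} (hb : ∀ n, Measurable (b n)) {C : ℝ}
    (hC : ∀ n p, |b n p| ≤ C) (hc : ∀ᵐ p ∂μ, CauchySeq fun n => b n p) :
    ∃ g : α → ℝ, Measurable g ∧ Tendsto (fun n => eLpNorm (b n - g) 2 μ) atTop (nhds 0) := by
  obtain ⟨g, hgm, hg⟩ := measurable_limit_of_tendsto_metrizable_ae (μ := μ) (L := atTop)
    (fun n => (hb n).aemeasurable) (hc.mono fun p hp => cauchySeq_tendsto_of_complete hp)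
  refine ⟨g, hgm, tendsto_eLpNorm_two_iff.2 ?_⟩
  have h0 : (0 : ℝ≥0∞) = ∫⁻ _, 0 ∂μ := by simp
  rw [h0]
  refine tendsto_lintegral_of_dominated_convergence (fun _ => ENNReal.ofReal (2 * C) ^ 2)
    (fun n => ((hb n).sub hgm).enorm.pow_const 2) (fun n => ?_) ?_ ?_
  · filter_upwards [hg] with p hp
    refine pow_le_pow_left' ?_ 2
    rw [← ofReal_norm, Pi.sub_apply]
    refine ENNReal.ofReal_le_ofReal ?_
    have hgC : |g p| ≤ C := le_of_tendsto hp.abs (Eventually.of_forall fun n => hC n p)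
    rw [Real.norm_eq_abs]
    calc |b n p - g p| ≤ |b n p| + |g p| := abs_sub _ _
      _ ≤ 2 * C := by linarith [hC n p]
  · rw [lintegral_const]
    exact mul_ne_top (by finiteness) (measure_ne_top μ _)
  · filter_upwards [hg] with p hp
    have h1 : Tendsto (fun n => ‖b n p - g p‖ₑ ^ 2) atTop (nhds (‖g p - g p‖ₑ ^ 2)) :=
      ENNReal.Tendsto.pow ((hp.sub_const _).enorm)
    simpa using h1

/-- A sequence uniformly approximable in `L²` by bounded, almost everywhere convergent sequences
converges in `L²`. -/
theorem exists_tendsto_eLpNorm_of_approx {α : Type*} [MeasurableSpace α] {μ : Measure α}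
    [IsFiniteMeasure μ] {f : ℕ → α → ℝ} (hf : ∀ n, StronglyMeasurable (f n))
    (h : ∀ ε : ℝ≥0∞, ε ≠ 0 → ∃ b : ℕ → α → ℝ, (∀ n, Measurable (b n)) ∧
      (∃ C : ℝ, ∀ n p, |b n p| ≤ C) ∧ (∀ᵐ p ∂μ, CauchySeq fun n => b n p) ∧
      ∀ n, eLpNorm (b n - f n) 2 μ ≤ ε) :
    (∀ n, MemLp (f n) 2 μ) ∧ ∃ g : α → ℝ, MemLp g 2 μ ∧ StronglyMeasurable g ∧
      Tendsto (fun n => eLpNorm (f n - g) 2 μ) atTop (nhds 0) := by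
  have hfL : ∀ n, MemLp (f n) 2 μ := fun n => by
    obtain ⟨b, hbm, ⟨C, hC⟩, -, hbf⟩ := h 1 (by norm_num)
    have h1 : MemLp (b n) 2 μ :=
      MemLp.of_bound (hbm n).aestronglyMeasurable C (Eventually.of_forall fun p => hC n p)
    have h2 : MemLp (b n - f n) 2 μ :=
      ⟨(hbm n).aestronglyMeasurable.sub (hf n).aestronglyMeasurable,
        (hbf n).trans_lt one_lt_top⟩
    simpa using h1.sub h2
  refine ⟨hfL, ?_⟩
  have hcs : CauchySeq fun n => (hfL n).toLp (f n) := by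
    rw [EMetric.cauchySeq_iff]
    intro ε hε
    obtain ⟨δ, hδ0, hδ⟩ : ∃ δ : ℝ≥0∞, δ ≠ 0 ∧ 4 * δ = ε ⊓ 1 := by
      refine ⟨(ε ⊓ 1) / 4, ?_, ENNReal.mul_div_cancel (by norm_num) (by norm_num)⟩
      rw [Ne, ENNReal.div_eq_zero_iff]
      simp [hε.ne']
    have hδt : δ ≠ ∞ := by
      rintro rfl
      have : (ε ⊓ 1 : ℝ≥0∞) ≤ 1 := inf_le_right
      rw [← hδ] at this
      norm_num at this
    obtain ⟨b, hbm, ⟨C, hC⟩, hbc, hbf⟩ := h δ hδ0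
    obtain ⟨g, hgm, hg⟩ := exists_tendsto_eLpNorm_of_bounded hbm hC hbc
    obtain ⟨N, hN⟩ := (ENNReal.tendsto_atTop_zero.1 hg) (δ / 2) (by
      simpa using hδ0)
    refine ⟨N, fun m hm n hn => ?_⟩
    rw [Lp.edist_toLp_toLp]
    have e : f m - f n = (b m - g) - (b n - g) - ((b m - f m) - (b n - f n)) := by
      ext x; simp only [Pi.sub_apply]; ring
    have hbs : ∀ n, AEStronglyMeasurable (b n) μ := fun n => (hbm n).aestronglyMeasurable
    have hfs : ∀ n, AEStronglyMeasurable (f n) μ := fun n => (hf n).aestronglyMeasurable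
    have hgs : AEStronglyMeasurable g μ := hgm.aestronglyMeasurable
    have h2 : (1:ℝ≥0∞) ≤ 2 := by norm_num
    calc eLpNorm (f m - f n) 2 μ
        ≤ eLpNorm ((b m - g) - (b n - g)) 2 μ + eLpNorm ((b m - f m) - (b n - f n)) 2 μ := by
          rw [e]
          exact eLpNorm_sub_le (((hbs m).sub hgs).sub ((hbs n).sub hgs))
            (((hbs m).sub (hfs m)).sub ((hbs n).sub (hfs n))) h2
      _ ≤ (eLpNorm (b m - g) 2 μ + eLpNorm (b n - g) 2 μ) +
          (eLpNorm (b m - f m) 2 μ + eLpNorm (b n - f n) 2 μ) :=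
          add_le_add (eLpNorm_sub_le ((hbs m).sub hgs) ((hbs n).sub hgs) h2)
            (eLpNorm_sub_le ((hbs m).sub (hfs m)) ((hbs n).sub (hfs n)) h2)
      _ ≤ (δ / 2 + δ / 2) + (δ + δ) :=
          add_le_add (add_le_add (hN m hm) (hN n hn)) (add_le_add (hbf m) (hbf n))
      _ = 3 * δ := by rw [ENNReal.add_halves]; ring
      _ < 4 * δ := by
          rw [ENNReal.mul_lt_mul_iff_left hδ0 hδt]; norm_num
      _ ≤ ε := by rw [hδ]; exact inf_le_left
  obtain ⟨g, hg⟩ := cauchySeq_tendsto_of_complete hcs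
  refine ⟨g, Lp.memLp g, Lp.stronglyMeasurable g, ?_⟩
  rw [tendsto_iff_edist_tendsto_0] at hg
  refine hg.congr fun n => ?_
  rw [Lp.edist_def]
  exact eLpNorm_congr_ae ((hfL n).coeFn_toLp.sub (ae_eq_refl _))

/-- A field with square-integrable distributional spatial gradient, bounded by `κ`. -/
def HasGradBound (κ : ℝ≥0∞) (u : ℝ → E3 → E3) : Prop :=
  ∀ i, ∃ g : ℝ × E3 → E3, MemLp g 2 μST ∧ eLpNorm g 2 μST ≤ κ ∧
    ∀ ψ ∈ interiorTest ℝ, ∀ j, ∫ p, u p.1 p.2 i * pd (fun y => ψ (p.1, y)) j p.2 ∂μST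
      = - ∫ p, g p j * ψ p ∂μST

/-- A positive continuous integrable weight on space-time. -/
def weight (p : ℝ × E3) : ℝ := (1 + ‖p.1‖) ^ (-(2:ℝ)) * (1 + ‖p.2‖) ^ (-(4:ℝ))

theorem weight_pos (p : ℝ × E3) : 0 < weight p := by unfold weight; positivity

theorem weight_le_one (p : ℝ × E3) : weight p ≤ 1 := by
  have h : ∀ (a c : ℝ), 0 ≤ a → 0 ≤ c → (1 + a) ^ (-c) ≤ 1 := fun a c ha hc =>
    Real.rpow_le_one_of_one_le_of_nonpos (by linarith) (by linarith)
  exact mul_le_one₀ (h _ _ (norm_nonneg _) (by norm_num)) (by positivity)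
    (h _ _ (norm_nonneg _) (by norm_num))

theorem continuous_weight : Continuous weight := by
  unfold weight
  refine Continuous.mul ?_ ?_
  · exact (continuous_const.add continuous_fst.norm).rpow_const fun p =>
      Or.inl (add_pos_of_pos_of_nonneg one_pos (norm_nonneg _)).ne'
  · exact (continuous_const.add continuous_snd.norm).rpow_const fun p =>
      Or.inl (add_pos_of_pos_of_nonneg one_pos (norm_nonneg _)).ne'

theorem integrable_weight : Integrable weight μST := by
  have h1 : Integrable (fun t : ℝ => (1 + ‖t‖) ^ (-(2:ℝ))) :=
    integrable_one_add_norm (by simp)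
  have h2 : Integrable (fun t : E3 => (1 + ‖t‖) ^ (-(4:ℝ))) :=
    integrable_one_add_norm (by simp; norm_num)
  exact Integrable.mul_prod h1.integrableOn h2

/-- A finite measure with positive density on space-time. -/
def μW : Measure (ℝ × E3) := μST.withDensity fun p => ENNReal.ofReal (weight p)

instance : IsFiniteMeasure μW := isFiniteMeasure_withDensity_ofReal integrable_weight.2

theorem μW_le : μW ≤ μST := by
  unfold μW
  conv_rhs => rw [← withDensity_one (μ := μST)]
  refine withDensity_mono (Eventually.of_forall fun p => ?_)
  exact ofReal_le_one.2 (weight_le_one p)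

theorem lintegral_compact_le_weight {s : Set (ℝ × E3)} (hs : IsCompact s) :
    ∃ c : ℝ≥0∞, c ≠ ∞ ∧ μST.restrict s ≤ c • μW := by
  obtain ⟨δ, hδ, hle⟩ : ∃ δ > 0, ∀ p ∈ s, δ ≤ weight p := by
    rcases s.eq_empty_or_nonempty with rfl | hne
    · exact ⟨1, one_pos, by simp⟩
    · obtain ⟨p, hp, hmin⟩ := hs.exists_isMinOn hne continuous_weight.continuousOn
      exact ⟨weight p, weight_pos p, fun q hq => hmin hq⟩
  have hδ' : ENNReal.ofReal δ ≠ 0 := by simpa using hδ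
  refine ⟨(ENNReal.ofReal δ)⁻¹, by simpa using hδ, ?_⟩
  refine Measure.le_iff.2 fun A hA => ?_
  rw [Measure.smul_apply, smul_eq_mul, Measure.restrict_apply hA]
  have h1 : ENNReal.ofReal δ * μST (A ∩ s) ≤ μW A := by
    unfold μW
    rw [withDensity_apply _ hA, ← setLIntegral_const]
    refine (setLIntegral_mono' (hA.inter hs.measurableSet) fun p hp =>
      ENNReal.ofReal_le_ofReal (hle p hp.2)).trans (lintegral_mono_set inter_subset_left)
  calc μST (A ∩ s) = (ENNReal.ofReal δ)⁻¹ * (ENNReal.ofReal δ * μST (A ∩ s)) := by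
        rw [← mul_assoc, ENNReal.inv_mul_cancel hδ' ofReal_ne_top, one_mul]
    _ ≤ _ := by gcongr

theorem integral_ballMeasure_eq (v : E3 → E3) (i : Fin 3) (x : E3) (ε : ℝ) :
    ∫ h, v (x + h) i ∂(ballMeasure ε) = ∫ y, ∑ j, v y j *
      ((Metric.ball x ε).indicator (fun _ => EuclideanSpace.single i
        ((volume (Metric.ball (0 : E3) ε))⁻¹.toReal)) y : E3) j := by
  rw [ballMeasure_eq, integral_smul_measure, smul_eq_mul, ← integral_indicator
    Metric.isOpen_ball.measurableSet, ← integral_const_mul]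
  refine Eq.trans ?_ (integral_add_left_eq_self _ x)
  congr 1; ext h
  have hb : x + h ∈ Metric.ball x ε ↔ h ∈ Metric.ball (0 : E3) ε := by simp
  by_cases hh : h ∈ Metric.ball (0 : E3) ε
  · rw [indicator_of_mem hh, indicator_of_mem (hb.2 hh)]
    simp [PiLp.single_apply, mul_comm]
  · rw [indicator_of_notMem hh, indicator_of_notMem (fun h' => hh (hb.1 h'))]
    simp

theorem memLp_ball_indicator (i : Fin 3) (x : E3) (ε c : ℝ) :
    MemLp (fun y => ((Metric.ball x ε).indicator (fun _ => EuclideanSpace.single i c) y : E3)) 2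
      volume :=
  memLp_indicator_const 2 Metric.isOpen_ball.measurableSet _ (Or.inr measure_ball_lt_top.ne)

theorem integrable_ballMeasure {v : E3 → E3} (hv : MemLp v 2 volume) (i : Fin 3) (x : E3) (ε : ℝ) :
    Integrable (fun h => v (x + h) i) (ballMeasure ε) := by
  rw [ballMeasure_eq]
  by_cases hε : 0 < ε
  · refine Integrable.smul_measure ?_ (by simpa using (Metric.measure_ball_pos volume (0:E3) hε).ne')
    have h1 : MemLp (fun h => v (x + h)) 2 volume :=
      hv.comp_measurePreserving (measurePreserving_add_left volume x)
    have : IsFiniteMeasure (volume.restrict (Metric.ball (0:E3) ε)) :=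
      ⟨by rw [Measure.restrict_apply_univ]; exact measure_ball_lt_top⟩
    exact ((MemLp.coord h1 i).restrict _).integrable (by norm_num)
  · rw [Metric.ball_eq_empty.2 (not_lt.1 hε)]
    simp

theorem abs_ballAverage_le {K : ℝ≥0∞} (hK : K ≠ ∞) (ε : ℝ) : ∃ C : ℝ, ∀ (v : E3 → E3)
    (_ : MemLp v 2 volume) (_ : eLpNorm v 2 volume ≤ K) (i : Fin 3) (x : E3),
    |∫ h, v (x + h) i ∂(ballMeasure ε)| ≤ C := by
  set c := ((volume (Metric.ball (0 : E3) ε))⁻¹).toReal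
  refine ⟨(K * (‖c‖ₑ * volume (Metric.ball (0 : E3) ε) ^ (1 / (2:ℝ≥0∞).toReal))).toReal,
    fun v hv hb i x => ?_⟩
  rw [integral_ballMeasure_eq]
  have hm := memLp_ball_indicator i x ε c
  have h := integral_mul_le_eLpNorm_mul hv hm
  simp_rw [inner_E3] at h
  refine h.trans (toReal_mono ?_ ?_)
  · refine mul_ne_top hK (mul_ne_top enorm_ne_top ?_)
    exact rpow_ne_top_of_nonneg (by positivity) measure_ball_lt_top.ne
  · rw [eLpNorm_indicator_const Metric.isOpen_ball.measurableSet (by norm_num) (by norm_num),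
      Measure.addHaar_ball_center volume x]
    gcongr
    rw [← ofReal_norm, ← ofReal_norm, PiLp.norm_single]

/-- Weak convergence at almost every time together with a gradient bound gives strong local
convergence in space-time. -/
theorem exists_strong_limit {K κ : ℝ≥0∞} (hK : K ≠ ∞) (hκ : κ ≠ ∞) {u : ℕ → ℝ → E3 → E3}
    (hu : ∀ n, IsTame K (u n)) (hg : ∀ n, HasGradBound κ (u n))
    (hweak : ∀ᵐ t ∂(volume.restrict (Ioi (0:ℝ))), ∀ f : E3 → E3,
      MemLp f 2 volume → CauchySeq fun n => ∫ x, ∑ i, u n t x i * f x i) :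
    ∃ v : ℝ × E3 → E3, StronglyMeasurable v ∧ ∀ i, (∀ n, MemLp (fun p => u n p.1 p.2 i) 2 μW) ∧
      MemLp (fun p => v p i) 2 μW ∧
      Tendsto (fun n => eLpNorm (fun p => u n p.1 p.2 i - v p i) 2 μW) atTop (nhds 0) := by
  have hcm : ∀ n i, StronglyMeasurable fun p : ℝ × E3 => u n p.1 p.2 i := fun n i =>
    (EuclideanSpace.proj i : E3 →L[ℝ] ℝ).continuous.comp_stronglyMeasurable (hu n).meas
  have hacW : μW ≪ μST := μW_le.absolutelyContinuous
  have key : ∀ i, (∀ n, MemLp (fun p => u n p.1 p.2 i) 2 μW) ∧ ∃ g : ℝ × E3 → ℝ, MemLp g 2 μW ∧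
      StronglyMeasurable g ∧
      Tendsto (fun n => eLpNorm ((fun p => u n p.1 p.2 i) - g) 2 μW) atTop (nhds 0) := fun i => by
    refine exists_tendsto_eLpNorm_of_approx (fun n => hcm n i) fun ε hε => ?_
    obtain ⟨δ, hδ, hδε⟩ : ∃ δ : ℝ, 0 < δ ∧ ENNReal.ofReal δ * κ ≤ ε := by
      rcases eq_or_ne ε ∞ with rfl | hεt
      · exact ⟨1, one_pos, le_top⟩
      · refine ⟨ε.toReal / (κ.toReal + 1), ?_, ?_⟩
        · have := toReal_pos hε hεt
          positivity
        · rw [← ofReal_toReal hκ, ← ENNReal.ofReal_mul (by positivity),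
            ← ofReal_toReal hεt, toReal_ofReal (toReal_nonneg), toReal_ofReal (toReal_nonneg)]
          refine ENNReal.ofReal_le_ofReal ?_
          rw [div_mul_eq_mul_div, div_le_iff₀ (by positivity)]
          nlinarith [toReal_nonneg (a := ε), toReal_nonneg (a := κ)]
    refine ⟨fun n p => ∫ h, u n p.1 (p.2 + h) i ∂(ballMeasure δ), fun n => ?_, ?_, ?_, fun n => ?_⟩
    · have : StronglyMeasurable fun q : (ℝ × E3) × E3 => u n q.1.1 (q.1.2 + q.2) i :=
        (hcm n i).comp_measurable
          (g := fun q : (ℝ × E3) × E3 => ((q.1.1, q.1.2 + q.2) : ℝ × E3)) (by fun_prop)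
      exact (this.integral_prod_right (ν := ballMeasure δ)).measurable
    · obtain ⟨C, hC⟩ := abs_ballAverage_le hK δ
      exact ⟨C, fun n p => hC _ ((hu n).memLp hK _) ((hu n).bound _) i _⟩
    · refine hacW ?_
      have h1 : ∀ᵐ p ∂μST, ∀ f : E3 → E3, MemLp f 2 volume →
          CauchySeq fun n => ∫ x, ∑ i, u n p.1 x i * f x i := by
        unfold μST
        exact Measure.quasiMeasurePreserving_fst.ae hweak
      filter_upwards [h1] with p hp
      simp_rw [integral_ballMeasure_eq]
      exact hp _ (memLp_ball_indicator _ _ _ _)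
    · obtain ⟨g, hgL, hgκ, hgd⟩ := hg n i
      refine (eLpNorm_mono_measure _ μW_le).trans (le_trans ?_ ((mul_le_mul_right hgκ
        (ENNReal.ofReal δ)).trans hδε))
      exact lintegral_ballAverage_sub_le (hcm n i) hδ
        (fun p => integrable_ballMeasure ((hu n).memLp hK p.1) i p.2 δ) fun h =>
          eLpNorm_shift_sub_le ((hu n).locallyIntegrable hK i) hgL hgd h
            (((hu n).shift h).locallyIntegrable hK i)
  choose hL g hgL hgm hgt using key
  refine ⟨fun p => WithLp.toLp 2 fun i => g i p, ?_, fun i => ⟨hL i, hgL i, hgt i⟩⟩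
  exact (PiLp.continuous_toLp 2 _).comp_stronglyMeasurable
    (measurable_pi_iff.2 fun i => (hgm i).measurable).stronglyMeasurable

theorem contDiff_fderiv_apply {ψ : ℝ × E3 → ℝ} (h : ContDiff ℝ (⊤ : ℕ∞) ψ) (w : ℝ × E3) :
    ContDiff ℝ (⊤ : ℕ∞) fun p => fderiv ℝ ψ p w :=
  (h.fderiv_right (by simp)).clm_apply contDiff_const

theorem timeDeriv_eq {φ : ℝ × E3 → E3} (h : ContDiff ℝ (⊤ : ℕ∞) φ) (p : ℝ × E3) (i : Fin 3) :
    timeDeriv φ p i = fderiv ℝ (fun q => φ q i) p (1, 0) := by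
  have h1 : HasFDerivAt (fun q => φ q i) (fderiv ℝ (fun q => φ q i) p) p :=
    ((h.coord i).differentiable (by simp) p).hasFDerivAt
  have h2 : HasDerivAt (fun τ : ℝ => ((τ, p.2) : ℝ × E3)) (1, 0) p.1 :=
    (hasDerivAt_id p.1).prodMk (hasDerivAt_const p.1 p.2)
  exact (h1.comp_hasDerivAt (f := fun τ : ℝ => ((τ, p.2) : ℝ × E3)) p.1 h2).deriv

theorem spaceGrad_eq {φ : ℝ × E3 → E3} (h : ContDiff ℝ (⊤ : ℕ∞) φ) (p : ℝ × E3) (i j : Fin 3) :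
    spaceGrad φ p i j = fderiv ℝ (fun q => φ q i) p (0, EuclideanSpace.single j 1) :=
  pd_slice (h.coord i) j p.1 p.2

theorem spaceLap_eq {φ : ℝ × E3 → E3} (h : ContDiff ℝ (⊤ : ℕ∞) φ) (p : ℝ × E3) (i : Fin 3) :
    spaceLap φ p i = ∑ j, fderiv ℝ (fun q => fderiv ℝ (fun q => φ q i) q
      (0, EuclideanSpace.single j 1)) p (0, EuclideanSpace.single j 1) := by
  unfold spaceLap
  refine Finset.sum_congr rfl fun j _ => ?_
  have : (fun y => pd (fun z => φ (p.1, z) i) j y) = fun y =>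
      (fun q => fderiv ℝ (fun q => φ q i) q (0, EuclideanSpace.single j 1)) (p.1, y) :=
    funext fun y => pd_slice (h.coord i) j p.1 y
  rw [this]
  exact pd_slice (contDiff_fderiv_apply (h.coord i) _) j p.1 p.2

/-- Square integrability on compact subsets of space-time, coordinate by coordinate. -/
def LocSq (u : ℝ → E3 → E3) : Prop :=
  ∀ s : Set (ℝ × E3), IsCompact s → ∀ i, MemLp (fun p => u p.1 p.2 i) 2 (μST.restrict s)

/-- Convergence in `L²` on compact subsets of space-time. -/
def LocTendsto (u : ℕ → ℝ → E3 → E3) (v : ℝ → E3 → E3) : Prop :=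
  ∀ s : Set (ℝ × E3), IsCompact s → ∀ i, Tendsto
    (fun n => eLpNorm (fun p => u n p.1 p.2 i - v p.1 p.2 i) 2 (μST.restrict s)) atTop (nhds 0)

theorem tendsto_integral_mul_of_eLpNorm {α : Type*} [MeasurableSpace α] {μ : Measure α}
    {f g : ℕ → α → ℝ} {f₀ g₀ : α → ℝ} (hf : ∀ n, MemLp (f n) 2 μ) (hf₀ : MemLp f₀ 2 μ)
    (hg : ∀ n, MemLp (g n) 2 μ) (hg₀ : MemLp g₀ 2 μ)
    (hft : Tendsto (fun n => eLpNorm (fun x => f n x - f₀ x) 2 μ) atTop (nhds 0))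
    (hgt : Tendsto (fun n => eLpNorm (fun x => g n x - g₀ x) 2 μ) atTop (nhds 0)) :
    Tendsto (fun n => ∫ x, f n x * g n x ∂μ) atTop (nhds (∫ x, f₀ x * g₀ x ∂μ)) := by
  have conv : ∀ {f : ℕ → α → ℝ} {f₀ : α → ℝ} (hf : ∀ n, MemLp (f n) 2 μ) (hf₀ : MemLp f₀ 2 μ),
      Tendsto (fun n => eLpNorm (fun x => f n x - f₀ x) 2 μ) atTop (nhds 0) →
      Tendsto (fun n => (hf n).toLp (f n)) atTop (nhds (hf₀.toLp f₀)) := fun hf hf₀ h => by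
    rw [tendsto_iff_edist_tendsto_0]
    simp_rw [Lp.edist_toLp_toLp]
    exact h
  have hin : ∀ {f g : α → ℝ} (hf : MemLp f 2 μ) (hg : MemLp g 2 μ),
      inner ℝ (hf.toLp f) (hg.toLp g) = ∫ x, f x * g x ∂μ := fun hf hg => by
    rw [L2.inner_def]
    refine integral_congr_ae ?_
    filter_upwards [hf.coeFn_toLp, hg.coeFn_toLp] with x h1 h2
    rw [h1, h2]
    simp [mul_comm]
  have := (conv hf hf₀ hft).inner (𝕜 := ℝ) (conv hg hg₀ hgt)
  simp_rw [hin] at this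
  exact this

theorem setIntegral_tsupport_mul (f a : ℝ × E3 → ℝ) :
    ∫ p, f p * a p ∂μST = ∫ p in tsupport a, f p * a p ∂μST :=
  (setIntegral_eq_integral_of_forall_compl_eq_zero fun p hp => by
    rw [image_eq_zero_of_notMem_tsupport hp, mul_zero]).symm

theorem memLp_test {a : ℝ × E3 → ℝ} (ha : Continuous a) (hc : HasCompactSupport a)
    (s : Set (ℝ × E3)) (q : ℝ≥0∞) : MemLp a q (μST.restrict s) :=
  (ha.memLp_of_hasCompactSupport hc).restrict s

theorem memLp_mul_test {a : ℝ × E3 → ℝ} (ha : Continuous a) (hc : HasCompactSupport a)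
    {s : Set (ℝ × E3)} {f : ℝ × E3 → ℝ} (hf : MemLp f 2 (μST.restrict s)) :
    MemLp (fun p => f p * a p) 2 (μST.restrict s) :=
  (memLp_test ha hc s ∞).mul hf

theorem LocSq.integrable_linear {u : ℝ → E3 → E3} (hu : LocSq u) {a : ℝ × E3 → ℝ}
    (ha : Continuous a) (hc : HasCompactSupport a) (i : Fin 3) :
    Integrable (fun p => u p.1 p.2 i * a p) μST := by
  have h : IntegrableOn (fun p => u p.1 p.2 i * a p) (tsupport a) μST :=
    (hu _ hc i).integrable_mul (memLp_test ha hc _ 2)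
  refine (integrableOn_iff_integrable_of_support_subset fun p hp => ?_).1 h
  refine subset_tsupport a ?_
  rw [Function.mem_support] at hp ⊢
  exact right_ne_zero_of_mul hp

theorem LocSq.integrable_quadratic {u : ℝ → E3 → E3} (hu : LocSq u) {a : ℝ × E3 → ℝ}
    (ha : Continuous a) (hc : HasCompactSupport a) (i j : Fin 3) :
    Integrable (fun p => u p.1 p.2 i * u p.1 p.2 j * a p) μST := by
  have h : IntegrableOn (fun p => u p.1 p.2 i * (u p.1 p.2 j * a p)) (tsupport a) μST :=
    (hu _ hc i).integrable_mul (memLp_mul_test ha hc (hu _ hc j))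
  simp_rw [← mul_assoc] at h
  refine (integrableOn_iff_integrable_of_support_subset fun p hp => ?_).1 h
  refine subset_tsupport a ?_
  rw [Function.mem_support] at hp ⊢
  exact right_ne_zero_of_mul hp

theorem LocTendsto.linear {u : ℕ → ℝ → E3 → E3} {v : ℝ → E3 → E3} (h : LocTendsto u v)
    (hu : ∀ n, LocSq (u n)) (hv : LocSq v) {a : ℝ × E3 → ℝ} (ha : Continuous a)
    (hc : HasCompactSupport a) (i : Fin 3) :
    Tendsto (fun n => ∫ p, u n p.1 p.2 i * a p ∂μST) atTop
      (nhds (∫ p, v p.1 p.2 i * a p ∂μST)) := by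
  simp_rw [setIntegral_tsupport_mul]
  refine tendsto_integral_mul_of_eLpNorm (fun n => hu n _ hc i) (hv _ hc i)
    (fun _ => memLp_test ha hc _ 2) (memLp_test ha hc _ 2) (h _ hc i) ?_
  simp

theorem LocTendsto.quadratic {u : ℕ → ℝ → E3 → E3} {v : ℝ → E3 → E3} (h : LocTendsto u v)
    (hu : ∀ n, LocSq (u n)) (hv : LocSq v) {a : ℝ × E3 → ℝ} (ha : Continuous a)
    (hc : HasCompactSupport a) (i j : Fin 3) :
    Tendsto (fun n => ∫ p, u n p.1 p.2 i * u n p.1 p.2 j * a p ∂μST) atTop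
      (nhds (∫ p, v p.1 p.2 i * v p.1 p.2 j * a p ∂μST)) := by
  simp_rw [setIntegral_tsupport_mul, mul_assoc]
  refine tendsto_integral_mul_of_eLpNorm (fun n => hu n _ hc i) (hv _ hc i)
    (fun n => memLp_mul_test ha hc (hu n _ hc j)) (memLp_mul_test ha hc (hv _ hc j)) (h _ hc i) ?_
  obtain ⟨C, hC⟩ := hc.exists_bound_of_continuous ha
  have hlim : Tendsto (fun n => ENNReal.ofReal C *
      eLpNorm (fun p => u n p.1 p.2 j - v p.1 p.2 j) 2 (μST.restrict (tsupport a))) atTop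
      (nhds 0) := by
    have := ENNReal.Tendsto.const_mul (h _ hc j) (Or.inr (ofReal_ne_top (r := C)))
    rwa [mul_zero] at this
  refine tendsto_of_tendsto_of_tendsto_of_le_of_le tendsto_const_nhds hlim (fun _ => zero_le)
    fun n => eLpNorm_le_mul_eLpNorm_of_ae_le_mul (Eventually.of_forall fun p => ?_) 2
  rw [← sub_mul, norm_mul, mul_comm]
  gcongr
  exact hC p

theorem IsTest.coeffs {φ : ℝ × E3 → E3} (hφ : IsTest φ) (i : Fin 3) :
    (Continuous (fun p => timeDeriv φ p i) ∧ HasCompactSupport fun p => timeDeriv φ p i) ∧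
    (Continuous (fun p => spaceLap φ p i) ∧ HasCompactSupport fun p => spaceLap φ p i) ∧
    ∀ j, Continuous (fun p => spaceGrad φ p i j) ∧
      HasCompactSupport fun p => spaceGrad φ p i j := by
  have hs := hφ.1.coord i
  have hc : HasCompactSupport fun p => φ p i := hφ.2.1.coord i
  simp_rw [timeDeriv_eq hφ.1, spaceGrad_eq hφ.1, spaceLap_eq hφ.1]
  refine ⟨⟨(contDiff_fderiv_apply hs _).continuous, hc.fderiv_apply ℝ _⟩, ⟨?_, ?_⟩,
    fun j => ⟨(contDiff_fderiv_apply hs _).continuous, hc.fderiv_apply ℝ _⟩⟩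
  · exact continuous_finsetSum _ fun j _ =>
      (contDiff_fderiv_apply (contDiff_fderiv_apply hs _) _).continuous
  · refine HasCompactSupport.intro hc.isCompact fun p hp => ?_
    refine Finset.sum_eq_zero fun j _ => image_eq_zero_of_notMem_tsupport
      (f := fun p => fderiv ℝ (fun q => fderiv ℝ (fun q => φ q i) q
        (0, EuclideanSpace.single j 1)) p (0, EuclideanSpace.single j 1)) fun h => hp ?_
    exact tsupport_fderiv_apply_subset ℝ _ (tsupport_fderiv_apply_subset ℝ _ h)

theorem weak_lhs_expand (ν : ℝ) {u : ℝ → E3 → E3} (hu : LocSq u) {φ : ℝ × E3 → E3}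
    (hφ : IsTest φ) :
    (∫ p, ((∑ i, u p.1 p.2 i * (timeDeriv φ p i + ν * spaceLap φ p i)) +
         ∑ i, ∑ j, u p.1 p.2 i * u p.1 p.2 j * spaceGrad φ p i j) ∂μST) =
      ((∑ i, ∫ p, u p.1 p.2 i * timeDeriv φ p i ∂μST) +
        ν * ∑ i, ∫ p, u p.1 p.2 i * spaceLap φ p i ∂μST) +
      ∑ i, ∑ j, ∫ p, u p.1 p.2 i * u p.1 p.2 j * spaceGrad φ p i j ∂μST := by
  have i1 : ∀ i, Integrable (fun p => u p.1 p.2 i * timeDeriv φ p i) μST := fun i =>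
    hu.integrable_linear (hφ.coeffs i).1.1 (hφ.coeffs i).1.2 i
  have i2 : ∀ i, Integrable (fun p => u p.1 p.2 i * spaceLap φ p i) μST := fun i =>
    hu.integrable_linear (hφ.coeffs i).2.1.1 (hφ.coeffs i).2.1.2 i
  have i3 : ∀ i j, Integrable (fun p => u p.1 p.2 i * u p.1 p.2 j * spaceGrad φ p i j) μST :=
    fun i j => hu.integrable_quadratic ((hφ.coeffs i).2.2 j).1 ((hφ.coeffs i).2.2 j).2 i j
  have i4 : ∀ i, Integrable (fun p => u p.1 p.2 i * (timeDeriv φ p i + ν * spaceLap φ p i)) μST :=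
    fun i => ((i1 i).add ((i2 i).const_mul ν)).congr (Eventually.of_forall fun p => by
      simp only [Pi.add_apply]; ring)
  rw [integral_add (integrable_finsetSum _ fun i _ => i4 i)
    (integrable_finsetSum _ fun i _ => integrable_finsetSum _ fun j _ => i3 i j),
    integral_finsetSum _ fun i _ => i4 i,
    integral_finsetSum _ fun i _ => integrable_finsetSum _ fun j _ => i3 i j]
  congr 1
  · rw [Finset.mul_sum, ← Finset.sum_add_distrib]
    refine Finset.sum_congr rfl fun i _ => ?_
    rw [← integral_const_mul, ← integral_add (i1 i) ((i2 i).const_mul ν)]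
    congr 1; ext p; ring
  · exact Finset.sum_congr rfl fun i _ => integral_finsetSum _ fun j _ => i3 i j

/-- The weak formulation passes to limits in `L²_loc`, viscosity and initial data. -/
theorem WeakForm.of_tendsto {ν : ℕ → ℝ} {ν₀ : ℝ} (hν : Tendsto ν atTop (nhds ν₀))
    {u₀ : ℕ → E3 → E3} {v₀ : E3 → E3} {u : ℕ → ℝ → E3 → E3} {v : ℝ → E3 → E3}
    (h : LocTendsto u v) (hu : ∀ n, LocSq (u n)) (hv : LocSq v)
    (hw : ∀ n, WeakForm (ν n) (u₀ n) (u n))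
    (h0 : ∀ φ, IsSolenoidalTest φ → Tendsto (fun n => ∫ x, ∑ i, u₀ n x i * φ x i) atTop
      (nhds (∫ x, ∑ i, v₀ x i * φ x i))) : WeakForm ν₀ v₀ v := by
  intro φ hφ
  have hsol : IsSolenoidalTest fun x => φ (0, x) := by
    refine ⟨hφ.1.comp (contDiff_const.prodMk contDiff_id), ?_, fun x => hφ.2.2 (0, x)⟩
    refine HasCompactSupport.intro (hφ.2.1.isCompact.image continuous_snd) fun x hx => ?_
    exact image_eq_zero_of_notMem_tsupport fun h => hx ⟨_, h, rfl⟩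
  have hlim := (h0 _ hsol).neg
  have heq : ∀ n, _ := fun n => hw n φ hφ
  simp_rw [weak_lhs_expand _ (hu _) hφ] at heq
  rw [weak_lhs_expand _ hv hφ]
  refine tendsto_nhds_unique ?_ hlim
  simp_rw [← heq]
  refine (Tendsto.add ?_ (hν.mul ?_)).add ?_
  · exact tendsto_finsetSum _ fun i _ => h.linear hu hv (hφ.coeffs i).1.1 (hφ.coeffs i).1.2 i
  · exact tendsto_finsetSum _ fun i _ => h.linear hu hv (hφ.coeffs i).2.1.1 (hφ.coeffs i).2.1.2 i
  · exact tendsto_finsetSum _ fun i _ => tendsto_finsetSum _ fun j _ =>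
      h.quadratic hu hv ((hφ.coeffs i).2.2 j).1 ((hφ.coeffs i).2.2 j).2 i j

/-- A `3 × 3` matrix as a vector with the Euclidean (Frobenius) norm. -/
def flat (w : Fin 3 → Fin 3 → ℝ) : EuclideanSpace ℝ (Fin 3 × Fin 3) :=
  WithLp.toLp 2 fun k => w k.1 k.2

theorem continuous_flat : Continuous flat :=
  (PiLp.continuous_toLp 2 _).comp (continuous_pi fun k =>
    (continuous_apply k.2).comp (continuous_apply k.1))

theorem enorm_flat_sq (w : Fin 3 → Fin 3 → ℝ) :
    ‖flat w‖ₑ ^ 2 = ∑ i, ∑ j, ENNReal.ofReal (w i j ^ 2) := by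
  rw [← ofReal_norm, ← ENNReal.ofReal_pow (norm_nonneg _), EuclideanSpace.norm_sq_eq,
    Fintype.sum_prod_type]
  rw [ENNReal.ofReal_sum_of_nonneg fun i _ => Finset.sum_nonneg fun j _ => by positivity]
  refine Finset.sum_congr rfl fun i _ => ?_
  rw [ENNReal.ofReal_sum_of_nonneg fun i _ => by positivity]
  refine Finset.sum_congr rfl fun j _ => ?_
  simp [flat]

theorem eLpNorm_flat_sq {G : ℝ → E3 → Fin 3 → Fin 3 → ℝ}
    (hG : AEStronglyMeasurable (Function.uncurry G) μST) :
    eLpNorm (fun p : ℝ × E3 => flat (G p.1 p.2)) 2 μST ^ 2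
      = ∫⁻ t in Ioi (0:ℝ), gradSq G t := by
  rw [eLpNorm_two_sq]
  unfold μST at hG ⊢
  rw [lintegral_prod _ (by
    exact (continuous_flat.comp_aestronglyMeasurable hG).enorm.pow_const 2)]
  simp_rw [enorm_flat_sq]
  rfl

theorem memLp_flat {G : ℝ → E3 → Fin 3 → Fin 3 → ℝ} {κ : ℝ≥0∞} (hκ : κ ≠ ∞)
    (hG : AEStronglyMeasurable (Function.uncurry G) μST)
    (hb : ∫⁻ t in Ioi (0:ℝ), gradSq G t ≤ κ ^ 2) :
    MemLp (fun p : ℝ × E3 => flat (G p.1 p.2)) 2 μST ∧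
      eLpNorm (fun p : ℝ × E3 => flat (G p.1 p.2)) 2 μST ≤ κ := by
  have h : eLpNorm (fun p : ℝ × E3 => flat (G p.1 p.2)) 2 μST ≤ κ := by
    rwa [← ENNReal.pow_le_pow_left_iff (n := 2) (by norm_num), eLpNorm_flat_sq hG]
  exact ⟨⟨continuous_flat.comp_aestronglyMeasurable hG, h.trans_lt hκ.lt_top⟩, h⟩

theorem hasGradBound_of_isDistGrad {u : ℝ → E3 → E3} {G : ℝ → E3 → Fin 3 → Fin 3 → ℝ}
    {κ : ℝ≥0∞} (hκ : κ ≠ ∞) (hG : AEStronglyMeasurable (Function.uncurry G) μST)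
    (hb : ∫⁻ t in Ioi (0:ℝ), gradSq G t ≤ κ ^ 2) (hd : IsDistGrad u G) : HasGradBound κ u := by
  obtain ⟨h1, h2⟩ := memLp_flat hκ hG hb
  intro i
  have hm : AEStronglyMeasurable (fun p : ℝ × E3 =>
      (WithLp.toLp 2 fun j => G p.1 p.2 i j : E3)) μST := by
    have : Continuous fun w : Fin 3 → Fin 3 → ℝ => (WithLp.toLp 2 (w i) : E3) :=
      (PiLp.continuous_toLp 2 _).comp (continuous_apply i)
    exact this.comp_aestronglyMeasurable hG
  have hle : eLpNorm (fun p : ℝ × E3 => (WithLp.toLp 2 fun j => G p.1 p.2 i j : E3)) 2 μST ≤ κ := by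
    refine (eLpNorm_mono fun p => ?_).trans h2
    rw [← sq_le_sq₀ (norm_nonneg _) (norm_nonneg _), EuclideanSpace.norm_sq_eq,
      EuclideanSpace.norm_sq_eq, Fintype.sum_prod_type]
    exact Finset.single_le_sum (f := fun i => ∑ j, ‖(flat (G p.1 p.2)) (i, j)‖ ^ 2)
      (fun i _ => Finset.sum_nonneg fun j _ => by positivity) (Finset.mem_univ i)
  exact ⟨_, ⟨hm, hle.trans_lt hκ.lt_top⟩, hle, fun ψ hψ j => hd ψ hψ.1 hψ.2.1 hψ.2.2 i j⟩

theorem interiorTest_coord {ι : Type*} [Fintype ι] {Ψ : ℝ × E3 → EuclideanSpace ℝ ι}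
    (h : Ψ ∈ interiorTest (EuclideanSpace ℝ ι)) (k : ι) : (fun p => Ψ p k) ∈ interiorTest ℝ := by
  have hs : tsupport (fun p => Ψ p k) ⊆ tsupport Ψ := closure_mono fun p hp => by
    rw [Function.mem_support] at hp ⊢
    intro h0; exact hp (by rw [h0]; rfl)
  exact ⟨(EuclideanSpace.proj k : EuclideanSpace ℝ ι →L[ℝ] ℝ).contDiff.comp h.1,
    h.2.1.of_isClosed_subset (isClosed_tsupport _) hs, hs.trans h.2.2⟩

theorem interiorTest_single {ι : Type*} [Fintype ι] [DecidableEq ι] {ψ : ℝ × E3 → ℝ}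
    (h : ψ ∈ interiorTest ℝ) (k : ι) :
    (fun p => EuclideanSpace.single k (ψ p)) ∈ interiorTest (EuclideanSpace ℝ ι) := by
  have hs : tsupport (fun p => (EuclideanSpace.single k (ψ p) : EuclideanSpace ℝ ι)) ⊆ tsupport ψ :=
    closure_mono fun p hp => by
      rw [Function.mem_support] at hp ⊢
      intro h0; exact hp (by rw [h0]; simp)
  refine ⟨?_, h.2.1.of_isClosed_subset (isClosed_tsupport _) hs, hs.trans h.2.2⟩
  have : (fun p => (EuclideanSpace.single k (ψ p) : EuclideanSpace ℝ ι)) =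
      fun p => ψ p • (EuclideanSpace.single k (1:ℝ) : EuclideanSpace ℝ ι) := by
    ext p j; simp [PiLp.single_apply]
  rw [this]
  exact h.1.smul contDiff_const

theorem pd_slice_coeff {ψ : ℝ × E3 → ℝ} (h : ψ ∈ interiorTest ℝ) (j : Fin 3) :
    Continuous (fun p : ℝ × E3 => pd (fun y => ψ (p.1, y)) j p.2) ∧
      HasCompactSupport fun p : ℝ × E3 => pd (fun y => ψ (p.1, y)) j p.2 := by
  simp_rw [pd_slice h.1]
  exact ⟨(contDiff_fderiv_apply h.1 _).continuous, h.2.1.fderiv_apply ℝ _⟩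

/-- Gradient bounds pass to limits in `L²_loc`. -/
theorem exists_limit_gradient {u : ℕ → ℝ → E3 → E3} {v : ℝ → E3 → E3} (h : LocTendsto u v)
    (hu : ∀ n, LocSq (u n)) (hv : LocSq v) {G : ℕ → ℝ → E3 → Fin 3 → Fin 3 → ℝ} {κ : ℝ≥0∞}
    (hκ : κ ≠ ∞) (hd : ∀ n, IsDistGrad (u n) (G n))
    (hG : ∀ n, AEStronglyMeasurable (Function.uncurry (G n)) μST)
    (hb : ∀ n, ∫⁻ t in Ioi (0:ℝ), gradSq (G n) t ≤ κ ^ 2) :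
    ∃ G' : ℝ → E3 → Fin 3 → Fin 3 → ℝ, AEStronglyMeasurable (Function.uncurry G') μST ∧
      IsDistGrad v G' ∧ ∫⁻ t in Ioi (0:ℝ), gradSq G' t ≤ κ ^ 2 := by
  let F := EuclideanSpace ℝ (Fin 3 × Fin 3)
  have hInt : ∀ {w : ℝ → E3 → E3}, LocSq w → ∀ {ψ}, ψ ∈ interiorTest ℝ → ∀ i j,
      Integrable (fun p => w p.1 p.2 i * pd (fun y => ψ (p.1, y)) j p.2) μST :=
    fun hw _ hψ i j => hw.integrable_linear (pd_slice_coeff hψ j).1 (pd_slice_coeff hψ j).2 i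
  let l : interiorTest F →ₗ[ℝ] ℝ :=
    { toFun := fun Ψ => -∑ k : Fin 3 × Fin 3, ∫ p, v p.1 p.2 k.1 *
        pd (fun y => Ψ.1 (p.1, y) k) k.2 p.2 ∂μST
      map_add' := fun Ψ Φ => by
        rw [← neg_add, ← Finset.sum_add_distrib]
        congr 1
        refine Finset.sum_congr rfl fun k _ => ?_
        have hΨ := interiorTest_coord Ψ.2 k
        have hΦ := interiorTest_coord Φ.2 k
        rw [← integral_add (hInt hv hΨ _ _) (hInt hv hΦ _ _)]
        congr 1; ext p
        have := pd_add (hΨ.1.comp (contDiff_const (c := p.1) |>.prodMk contDiff_id))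
          (hΦ.1.comp (contDiff_const (c := p.1) |>.prodMk contDiff_id)) k.2 p.2
        rw [← mul_add]
        congr 1
      map_smul' := fun c Ψ => by
        simp only [RingHom.id_apply, smul_eq_mul, mul_neg, Finset.mul_sum]
        congr 1
        refine Finset.sum_congr rfl fun k _ => ?_
        have hΨ := interiorTest_coord Ψ.2 k
        rw [← integral_const_mul]
        congr 1; ext p
        have := pd_const_mul (hΨ.1.comp (contDiff_const (c := p.1) |>.prodMk contDiff_id)) c k.2 p.2
        rw [mul_left_comm]
        congr 1 }
  have hbound : ∀ Ψ : interiorTest F, l Ψ ≤ (κ * eLpNorm Ψ.1 2 μST).toReal := fun Ψ => by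
    have hlim : Tendsto (fun n => -∑ k : Fin 3 × Fin 3, ∫ p, u n p.1 p.2 k.1 *
        pd (fun y => Ψ.1 (p.1, y) k) k.2 p.2 ∂μST) atTop (nhds (l Ψ)) :=
      (tendsto_finsetSum _ fun k _ =>
        h.linear hu hv (pd_slice_coeff (interiorTest_coord Ψ.2 k) k.2).1
          (pd_slice_coeff (interiorTest_coord Ψ.2 k) k.2).2 k.1).neg
    refine le_of_tendsto hlim (Eventually.of_forall fun n => ?_)
    obtain ⟨hf, hfb⟩ := memLp_flat hκ (hG n) (hb n)
    have e : -∑ k : Fin 3 × Fin 3, ∫ p, u n p.1 p.2 k.1 *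
        pd (fun y => Ψ.1 (p.1, y) k) k.2 p.2 ∂μST
        = ∫ p, inner ℝ (flat (G n p.1 p.2)) (Ψ.1 p) ∂μST := by
      have hi : ∀ k : Fin 3 × Fin 3, Integrable
          (fun p : ℝ × E3 => G n p.1 p.2 k.1 k.2 * Ψ.1 p k) μST := fun k =>
        MemLp.integrable_mul (p := 2) (q := 2) (f := fun p : ℝ × E3 => G n p.1 p.2 k.1 k.2)
          (hf.continuousLinearMap_comp (EuclideanSpace.proj k : F →L[ℝ] ℝ))
          ((memLp_interiorTest 2 Ψ).continuousLinearMap_comp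
            (EuclideanSpace.proj k : F →L[ℝ] ℝ))
      have e1 : ∀ p : ℝ × E3, inner ℝ (flat (G n p.1 p.2)) (Ψ.1 p)
          = ∑ k : Fin 3 × Fin 3, G n p.1 p.2 k.1 k.2 * Ψ.1 p k := fun p => by
        rw [PiLp.inner_apply]
        exact Finset.sum_congr rfl fun k _ => by simp [flat, mul_comm]
      simp_rw [e1]
      rw [integral_finsetSum _ fun k _ => hi k, ← Finset.sum_neg_distrib]
      refine Finset.sum_congr rfl fun k _ => ?_
      have hk := interiorTest_coord Ψ.2 k
      rw [hd n _ hk.1 hk.2.1 hk.2.2 k.1 k.2, neg_neg]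
    rw [e]
    refine (le_abs_self _).trans ((integral_mul_le_eLpNorm_mul hf (memLp_interiorTest 2 Ψ)).trans
      (toReal_mono (mul_ne_top hκ (memLp_interiorTest 2 Ψ).2.ne) ?_))
    gcongr
  obtain ⟨g, hg, hgb, hgl⟩ := exists_memLp_of_bound l hκ hbound
  let G' : ℝ → E3 → Fin 3 → Fin 3 → ℝ := fun t x i j => g (t, x) (i, j)
  have hGm : AEStronglyMeasurable (Function.uncurry G') μST := by
    have : Continuous fun w : F => fun i j : Fin 3 => w (i, j) :=
      continuous_pi fun i => continuous_pi fun j =>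
        (EuclideanSpace.proj (i, j) : F →L[ℝ] ℝ).continuous
    exact this.comp_aestronglyMeasurable hg.1
  refine ⟨G', hGm, fun ψ h1 h2 h3 i j => ?_, ?_⟩
  · have hψ : ψ ∈ interiorTest ℝ := ⟨h1, h2, h3⟩
    have := hgl ⟨_, interiorTest_single hψ (i, j)⟩
    have e1 : l ⟨_, interiorTest_single hψ (i, j)⟩ =
        -∫ p, v p.1 p.2 i * pd (fun y => ψ (p.1, y)) j p.2 ∂μST := by
      change -∑ k : Fin 3 × Fin 3, _ = _
      rw [Finset.sum_eq_single (i, j)]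
      · simp
      · intro k _ hk
        simp [hk, pd]
      · simp
    rw [e1] at this
    rw [← neg_eq_iff_eq_neg, this]
    congr 1; ext p
    change inner ℝ (g p) (EuclideanSpace.single (i, j) (ψ p) : F) = _
    rw [EuclideanSpace.inner_single_right]
    exact mul_comm _ _
  · rw [← eLpNorm_flat_sq hGm]
    exact pow_le_pow_left' hgb 2

theorem exists_subseq_tendsto_zero {α : Type*} [MeasurableSpace α] {μ : Measure α}
    {f : ℕ → α → ℝ≥0∞} (hf : ∀ n, AEMeasurable (f n) μ)
    (h : Tendsto (fun n => ∫⁻ x, f n x ∂μ) atTop (nhds 0)) :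
    ∃ σ : ℕ → ℕ, StrictMono σ ∧ ∀ᵐ x ∂μ, Tendsto (fun n => f (σ n) x) atTop (nhds 0) := by
  obtain ⟨σ, hσ, hle⟩ := extraction_forall_of_eventually'
    (P := fun n k => ∫⁻ x, f k x ∂μ ≤ (2⁻¹ : ℝ≥0∞) ^ n) fun n => by
      have : ∀ᶠ k in atTop, ∫⁻ x, f k x ∂μ < (2⁻¹ : ℝ≥0∞) ^ n :=
        h.eventually_lt_const (ENNReal.pow_pos (by simp) n)
      obtain ⟨N, hN⟩ := eventually_atTop.1 this
      exact ⟨N, fun k hk => (hN k hk).le⟩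
  refine ⟨σ, hσ, ?_⟩
  have hsum : ∫⁻ x, ∑' n, f (σ n) x ∂μ ≠ ∞ := by
    rw [lintegral_tsum fun n => hf _]
    refine ne_top_of_le_ne_top ?_ (ENNReal.tsum_le_tsum hle)
    rw [ENNReal.tsum_geometric]
    simp
  filter_upwards [ae_lt_top' (AEMeasurable.tsum fun n => hf (σ n)) hsum] with x hx
  exact ENNReal.tendsto_atTop_zero_of_tsum_ne_top hx.ne

theorem enorm_sq_E3 (w : E3) : ‖w‖ₑ ^ 2 = ∑ i, ‖w i‖ₑ ^ 2 := by
  simp_rw [← ofReal_norm, ← ofReal_pow (norm_nonneg _)]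
  rw [← ofReal_sum_of_nonneg fun _ _ => sq_nonneg _, EuclideanSpace.norm_sq_eq]

theorem IsTame.locSq {K : ℝ≥0∞} {u : ℝ → E3 → E3} (h : IsTame K u) (hK : K ≠ ∞) : LocSq u :=
  fun _ hs i => MemLp.coord (h.memLp_compact hK hs) i

theorem MemLp.of_le_smul {α : Type*} [MeasurableSpace α] {μ ν : Measure α} {f : α → ℝ}
    (h : MemLp f 2 μ) {c : ℝ≥0∞} (hc : c ≠ ∞) (hle : ν ≤ c • μ) : MemLp f 2 ν :=
  (h.smul_measure hc).mono_measure hle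

theorem IsDivFree.of_tendsto {u : ℕ → E3 → E3} {v : E3 → E3} (hu : ∀ n, MemLp (u n) 2 volume)
    (hd : ∀ n, IsDivFree (u n)) (hv : AEStronglyMeasurable v volume)
    (h : ∀ s : Set E3, IsCompact s →
      Tendsto (fun n => ∫⁻ x in s, ‖u n x - v x‖ₑ ^ 2) atTop (nhds 0)) : IsDivFree v := by
  intro φ hφ hc
  have key : ∀ i, Tendsto (fun n => ∫ x, u n x i * pd φ i x) atTop
        (nhds (∫ x, v x i * pd φ i x)) ∧ Integrable (fun x => v x i * pd φ i x) ∧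
        ∀ n, Integrable (fun x => u n x i * pd φ i x) := fun i => by
    set a := pd φ i
    have hac : Continuous a := (hφ.pd i).continuous
    have has : HasCompactSupport a := hc.pd i
    set s := tsupport a
    have hs : IsCompact s := has
    have e : ∀ f : E3 → ℝ, ∫ x, f x * a x = ∫ x in s, f x * a x := fun f =>
      (setIntegral_eq_integral_of_forall_compl_eq_zero fun p hp => by
        rw [image_eq_zero_of_notMem_tsupport hp, mul_zero]).symm
    have hsub : Tendsto (fun n => eLpNorm (fun x => u n x - v x) 2 (volume.restrict s)) atTop
        (nhds 0) := tendsto_eLpNorm_two_iff.2 (h s hs)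
    have hsubi : Tendsto (fun n => eLpNorm (fun x => u n x i - v x i) 2 (volume.restrict s)) atTop
        (nhds 0) := by
      refine tendsto_of_tendsto_of_tendsto_of_le_of_le tendsto_const_nhds hsub (fun _ => zero_le)
        fun n => eLpNorm_mono fun x => ?_
      exact PiLp.norm_apply_le (u n x - v x) i
    have hvm : AEStronglyMeasurable (fun x => v x i) (volume.restrict s) :=
      ((EuclideanSpace.proj i : E3 →L[ℝ] ℝ).continuous.comp_aestronglyMeasurable hv).restrict
    have hui : ∀ n, MemLp (fun x => u n x i) 2 (volume.restrict s) := fun n =>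
      (MemLp.coord (hu n) i).restrict s
    have hvi : MemLp (fun x => v x i) 2 (volume.restrict s) := by
      obtain ⟨n, hn⟩ := (hsubi.eventually_lt_const (zero_lt_one)).exists
      have : MemLp (fun x => u n x i - v x i) 2 (volume.restrict s) :=
        ⟨(hui n).1.sub hvm, hn.trans one_lt_top⟩
      refine ((hui n).sub this).ae_eq (Eventually.of_forall fun x => ?_)
      exact sub_sub_cancel _ _
    have ha2 : MemLp a 2 (volume.restrict s) := (hac.memLp_of_hasCompactSupport has).restrict s
    have hI : ∀ f : E3 → ℝ, MemLp f 2 (volume.restrict s) → Integrable fun x => f x * a x :=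
      fun f hf => by
        have h : IntegrableOn (fun x => f x * a x) s := hf.integrable_mul ha2
        refine (integrableOn_iff_integrable_of_support_subset fun p hp => ?_).1 h
        refine subset_tsupport a ?_
        rw [Function.mem_support] at hp ⊢
        exact right_ne_zero_of_mul hp
    refine ⟨?_, hI _ hvi, fun n => hI _ (hui n)⟩
    simp_rw [e]
    exact tendsto_integral_mul_of_eLpNorm hui hvi (fun _ => ha2) ha2 hsubi (by simp)
  rw [integral_finsetSum _ fun i _ => (key i).2.1]
  refine tendsto_nhds_unique (tendsto_finsetSum _ fun i _ => (key i).1) ?_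
  refine tendsto_const_nhds.congr fun n => ?_
  rw [← integral_finsetSum _ fun i _ => (key i).2.2 n]
  exact (hd n φ hφ hc).symm

theorem exists_limit_tame {K κ : ℝ≥0∞} (hK : K ≠ ∞) (hκ : κ ≠ ∞) {u : ℕ → ℝ → E3 → E3}
    (hu : ∀ n, IsTame K (u n)) (hg : ∀ n, HasGradBound κ (u n))
    (hweak : ∀ᵐ t ∂volume.restrict (Ioi (0:ℝ)), ∀ f : E3 → E3, MemLp f 2 volume →
      CauchySeq fun n => ∫ x, ∑ i, u n t x i * f x i) :
    ∃ σ : ℕ → ℕ, StrictMono σ ∧ ∃ v : ℝ → E3 → E3, StronglyMeasurable (Function.uncurry v) ∧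
      LocSq v ∧ LocTendsto (fun n => u (σ n)) v ∧
      (∀ᵐ t ∂volume.restrict (Ioi (0:ℝ)), IsDivFree (v t)) ∧
      ∀ᵐ t ∂volume.restrict (Ioi (0:ℝ)), ∀ᵐ x, Tendsto (fun n => u (σ n) t x) atTop
        (nhds (v t x)) := by
  obtain ⟨v, hv, hlim⟩ := exists_strong_limit hK hκ hu hg hweak
  set F : ℕ → ℝ × E3 → ℝ≥0∞ := fun n p => ‖u n p.1 p.2 - v p‖ₑ ^ 2 with hF
  have hFm : ∀ n, Measurable (F n) := fun n => by
    have := ((hu n).meas.sub hv).enorm.pow_const 2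
    exact this
  have hF0 : Tendsto (fun n => ∫⁻ p, F n p ∂μW) atTop (nhds 0) := by
    have : ∀ n, ∫⁻ p, F n p ∂μW = ∑ i, ∫⁻ p, ‖u n p.1 p.2 i - v p i‖ₑ ^ 2 ∂μW := fun n => by
      rw [← lintegral_finsetSum']
      · exact lintegral_congr fun p => enorm_sq_E3 _
      · exact fun i _ => ((((hlim i).1 n).1.sub (hlim i).2.1.1).enorm.pow_const 2)
    simp_rw [this]
    rw [← Finset.sum_const_zero (s := (Finset.univ : Finset (Fin 3)))]
    exact tendsto_finsetSum _ fun i _ => tendsto_eLpNorm_two_iff.1 (hlim i).2.2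
  have hwm : Measurable fun p => ENNReal.ofReal (weight p) :=
    continuous_weight.measurable.ennreal_ofReal
  set H : ℕ → ℝ → ℝ≥0∞ := fun n t => ∫⁻ x, ENNReal.ofReal (weight (t, x)) * F n (t, x) with hH
  have hHm : ∀ n, Measurable (H n) := fun n => (hwm.mul (hFm n)).lintegral_prod_right'
  have hHF : ∀ n, ∫⁻ t in Ioi (0:ℝ), H n t = ∫⁻ p, F n p ∂μW := fun n => by
    unfold μW μST
    rw [lintegral_withDensity_eq_lintegral_mul _ hwm (hFm n),
      lintegral_prod _ (hwm.mul (hFm n)).aemeasurable]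
    rfl
  obtain ⟨σ, hσ, hσH⟩ := exists_subseq_tendsto_zero (fun n => (hHm n).aemeasurable)
    (hF0.congr fun n => (hHF n).symm)
  obtain ⟨τ, hτ, hτF⟩ := exists_subseq_tendsto_zero (f := fun n => F (σ n))
    (fun n => (hFm _).aemeasurable) (hF0.comp hσ.tendsto_atTop)
  have hac : μST ≪ μW := withDensity_absolutelyContinuous' hwm.aemeasurable
    (Eventually.of_forall fun p => (ofReal_pos.2 (weight_pos p)).ne')
  refine ⟨σ ∘ τ, hσ.comp hτ, fun t x => v (t, x), hv, fun s hs i => ?_, fun s hs i => ?_, ?_, ?_⟩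
  · obtain ⟨c, hc, hle⟩ := lintegral_compact_le_weight hs
    exact MemLp.of_le_smul (hlim i).2.1 hc hle
  · obtain ⟨c, hc, hle⟩ := lintegral_compact_le_weight hs
    rw [tendsto_eLpNorm_two_iff]
    have h0 := ENNReal.Tendsto.const_mul (tendsto_eLpNorm_two_iff.1
      ((hlim i).2.2.comp (hσ.comp hτ).tendsto_atTop)) (Or.inr hc)
    rw [mul_zero] at h0
    refine tendsto_of_tendsto_of_tendsto_of_le_of_le tendsto_const_nhds h0 (fun _ => zero_le)
      fun n => (lintegral_mono' hle le_rfl).trans ?_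
    rw [lintegral_smul_measure]
    rfl
  · filter_upwards [hσH] with t ht
    refine IsDivFree.of_tendsto (fun n => (hu (σ n)).memLp hK t) (fun n => (hu (σ n)).div t)
      (hv.comp_measurable measurable_prodMk_left).aestronglyMeasurable fun s hs => ?_
    obtain ⟨δ, hδ, hle⟩ : ∃ δ > 0, ∀ x ∈ s, δ ≤ weight (t, x) := by
      rcases s.eq_empty_or_nonempty with rfl | hne
      · exact ⟨1, one_pos, by simp⟩
      · obtain ⟨p, hp, hmin⟩ := hs.exists_isMinOn hne
          (continuous_weight.comp (Continuous.prodMk_right t)).continuousOn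
        exact ⟨weight (t, p), weight_pos _, fun q hq => hmin hq⟩
    have h0 := ENNReal.Tendsto.const_mul ht (Or.inr (inv_ne_top.2 (ofReal_pos.2 hδ).ne'))
    rw [mul_zero] at h0
    refine tendsto_of_tendsto_of_tendsto_of_le_of_le tendsto_const_nhds h0 (fun _ => zero_le)
      fun n => ?_
    rw [mul_comm, ← div_eq_mul_inv, ENNReal.le_div_iff_mul_le (Or.inl (ofReal_pos.2 hδ).ne')
      (Or.inl ofReal_ne_top), mul_comm, ← lintegral_const_mul' _ _ ofReal_ne_top]
    refine (setLIntegral_mono' hs.measurableSet fun x hx => ?_).trans (setLIntegral_le_lintegral s _)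
    exact mul_le_mul_left (ofReal_le_ofReal (hle x hx)) _
  · have := hac.ae_le hτF
    unfold μST at this
    filter_upwards [Measure.ae_ae_of_ae_prod this] with t ht
    filter_upwards [ht] with x hx
    rw [tendsto_iff_edist_tendsto_0]
    have h2 := (ENNReal.continuous_rpow_const (y := (1/2:ℝ))).tendsto 0 |>.comp hx
    rw [zero_rpow_of_pos (by norm_num)] at h2
    refine h2.congr fun n => ?_
    simp only [Function.comp, hF, edist_eq_enorm_sub]
    rw [← ENNReal.rpow_natCast, ← ENNReal.rpow_mul]
    norm_num

theorem measurable_eLpNorm_slice {u : ℝ → E3 → E3} (hu : StronglyMeasurable (Function.uncurry u))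
    (s : ℝ≥0∞) : Measurable fun t => eLpNorm (u t) s volume := by
  have hm : Measurable fun p : ℝ × E3 => ‖u p.1 p.2‖ₑ := hu.enorm
  by_cases h0 : s = 0
  · simp [h0]
  by_cases h1 : s = ∞
  · simp_rw [h1, eLpNorm_exponent_top]
    refine measurable_of_Iic fun c => ?_
    have : (fun t => eLpNormEssSup (u t) volume) ⁻¹' Iic c =
        {t | volume (Prod.mk t ⁻¹' {p : ℝ × E3 | c < ‖u p.1 p.2‖ₑ}) = 0} := by
      ext t
      have : volume (Prod.mk t ⁻¹' {p : ℝ × E3 | c < ‖u p.1 p.2‖ₑ}) = 0 ↔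
          ∀ᵐ x, ‖u t x‖ₑ ≤ c := by
        rw [ae_iff]; simp [Set.preimage]
      change eLpNormEssSup (u t) volume ≤ c ↔ _
      refine Iff.trans ?_ this.symm
      exact ⟨fun h => (enorm_ae_le_eLpNormEssSup (u t) volume).mono fun x hx => hx.trans h,
        fun h => essSup_le_of_ae_le _ h⟩
    rw [this]
    exact measurable_measure_prodMk_left (measurableSet_lt measurable_const hm)
      (measurableSet_singleton 0)
  · simp_rw [eLpNorm_eq_lintegral_rpow_enorm_toReal h0 h1]
    exact (Measurable.lintegral_prod_right' (hm.pow_const _)).pow_const _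

theorem mixedNorm_le_of_tendsto {u : ℕ → ℝ → E3 → E3} {v : ℝ → E3 → E3}
    (hu : ∀ n, StronglyMeasurable (Function.uncurry (u n)))
    (h : ∀ᵐ t ∂volume.restrict (Ioi (0:ℝ)), ∀ᵐ x, Tendsto (fun n => u n t x) atTop (nhds (v t x)))
    {r s C : ℝ≥0∞} (hr : r ≠ 0) (hC : ∀ᶠ n in atTop, mixedNorm r s (Ioi 0) (u n) ≤ C) :
    mixedNorm r s (Ioi 0) v ≤ C := by
  obtain ⟨N, hN⟩ := eventually_atTop.1 hC
  have hlim : ∀ᵐ t ∂volume.restrict (Ioi (0:ℝ)),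
      eLpNorm (v t) s volume ≤ liminf (fun n => eLpNorm (u (n + N) t) s volume) atTop := by
    filter_upwards [h] with t ht
    refine Lp.eLpNorm_lim_le_liminf_eLpNorm (fun n => ?_) _ ?_
    · exact ((hu _).comp_measurable measurable_prodMk_left).aestronglyMeasurable
    · filter_upwards [ht] with x hx
      exact hx.comp (tendsto_add_atTop_nat N)
  have hN' : ∀ n, mixedNorm r s (Ioi 0) (u (n + N)) ≤ C := fun n => hN _ (by omega)
  unfold mixedNorm at hN' ⊢
  split_ifs at hN' ⊢ with hrt
  · refine essSup_le_of_ae_le _ ?_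
    have : ∀ᵐ t ∂volume.restrict (Ioi (0:ℝ)), ∀ n, eLpNorm (u (n + N) t) s volume ≤ C :=
      ae_all_iff.2 fun n => (ENNReal.ae_le_essSup _).mono fun t ht => ht.trans (hN' n)
    filter_upwards [hlim, this] with t h1 h2
    refine h1.trans ?_
    exact liminf_le_of_le (by isBoundedDefault) fun b hb => by
      obtain ⟨n, hn⟩ := hb.exists
      exact hn.trans (h2 n)
  · have hr0 : 0 < r.toReal := toReal_pos hr hrt
    have hpow : ∀ x : ℝ≥0∞, x ^ (1 / r.toReal) ≤ C ↔ x ≤ C ^ r.toReal := fun x => by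
      rw [one_div, ENNReal.rpow_inv_le_iff hr0]
    simp only [hpow] at hN' ⊢
    calc ∫⁻ t in Ioi (0:ℝ), eLpNorm (v t) s volume ^ r.toReal
        ≤ ∫⁻ t in Ioi (0:ℝ), liminf (fun n => eLpNorm (u (n + N) t) s volume ^ r.toReal) atTop := by
          refine lintegral_mono_ae ?_
          filter_upwards [hlim] with t ht
          refine (ENNReal.rpow_le_rpow ht hr0.le).trans (le_of_eq ?_)
          exact (ENNReal.monotone_rpow_of_nonneg hr0.le).map_liminf_of_continuousAt _
            ENNReal.continuous_rpow_const.continuousAt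
      _ ≤ liminf (fun n => ∫⁻ t in Ioi (0:ℝ), eLpNorm (u (n + N) t) s volume ^ r.toReal) atTop :=
          lintegral_liminf_le fun n => (measurable_eLpNorm_slice (hu _) s).pow_const _
      _ ≤ C ^ r.toReal := liminf_le_of_le (by isBoundedDefault) fun b hb => by
          obtain ⟨n, hn⟩ := hb.exists
          exact hn.trans (hN' n)

theorem eLpNorm_ae_le_mixedNorm (u : ℝ → E3 → E3) (s : ℝ≥0∞) :
    ∀ᵐ t ∂volume.restrict (Ioi (0:ℝ)), eLpNorm (u t) s volume ≤ mixedNorm ∞ s (Ioi 0) u := by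
  simp only [mixedNorm, if_true]
  exact ENNReal.ae_le_essSup _

theorem mixedNorm_congr {u v : ℝ → E3 → E3}
    (h : ∀ᵐ t ∂volume.restrict (Ioi (0:ℝ)), u t =ᵐ[volume] v t) (r s : ℝ≥0∞) :
    mixedNorm r s (Ioi 0) u = mixedNorm r s (Ioi 0) v := by
  have h' : (fun t => eLpNorm (u t) s volume) =ᵐ[volume.restrict (Ioi (0:ℝ))]
      fun t => eLpNorm (v t) s volume := h.mono fun t ht => eLpNorm_congr_ae ht
  unfold mixedNorm
  split_ifs
  · exact essSup_congr_ae h'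
  · congr 1
    exact lintegral_congr_ae (h'.mono fun t ht => by simp only [ht])

theorem IsDivFree.congr {v w : E3 → E3} (hv : IsDivFree v) (h : v =ᵐ[volume] w) : IsDivFree w := by
  intro φ hφ hc
  rw [← hv φ hφ hc]
  exact integral_congr_ae (h.mono fun x hx => by simp only [hx])

theorem IsDistGrad.congr {u w : ℝ → E3 → E3} {G : ℝ → E3 → Fin 3 → Fin 3 → ℝ}
    (hu : IsDistGrad u G) (h : Function.uncurry u =ᵐ[μST] Function.uncurry w) :
    IsDistGrad w G := by
  intro ψ h1 h2 h3 i j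
  rw [← hu ψ h1 h2 h3 i j]
  refine integral_congr_ae (h.mono fun p hp => ?_)
  have hp' : u p.1 p.2 = w p.1 p.2 := hp
  simp only [hp']

theorem WeakForm.congr {ν : ℝ} {u₀ : E3 → E3} {u w : ℝ → E3 → E3}
    (hu : WeakForm ν u₀ u) (h : Function.uncurry u =ᵐ[μST] Function.uncurry w) :
    WeakForm ν u₀ w := by
  intro φ hφ
  rw [← hu φ hφ]
  refine integral_congr_ae (h.mono fun p hp => ?_)
  have hp' : u p.1 p.2 = w p.1 p.2 := hp
  simp only [hp']

/-- Every weak solution has a representative all of whose time slices are solenoidal and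
bounded in `L²`. -/
theorem IsWeakNS.exists_tame {ν : ℝ} {u₀ : E3 → E3} {u : ℝ → E3 → E3}
    {G : ℝ → E3 → Fin 3 → Fin 3 → ℝ} {K : ℝ≥0∞} (h : IsWeakNS ν u₀ u G)
    (hK : mixedNorm ∞ 2 (Ioi 0) u ≤ K) :
    ∃ u' : ℝ → E3 → E3, IsTame K u' ∧ IsWeakNS ν u₀ u' G ∧
      ∀ r s, mixedNorm r s (Ioi 0) u' = mixedNorm r s (Ioi 0) u := by
  obtain ⟨hm, hb, hd, hG, hGb, hdist, hw⟩ := h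
  set w := hm.mk with hwdef
  have hae : Function.uncurry u =ᵐ[μST] w := hm.ae_eq_mk
  have h1 : ∀ᵐ t ∂volume.restrict (Ioi (0:ℝ)), ∀ᵐ x, u t x = w (t, x) := by
    unfold μST at hae
    exact Measure.ae_ae_of_ae_prod hae
  obtain ⟨T, hT, hTm, hP⟩ := ((h1.and hd).and (eLpNorm_ae_le_mixedNorm u 2)).exists_measurable_mem
  have hwm : StronglyMeasurable w := hm.stronglyMeasurable_mk
  have hw'm : StronglyMeasurable ((T ×ˢ univ).indicator w) :=
    hwm.indicator (hTm.prod MeasurableSet.univ)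
  let u' : ℝ → E3 → E3 := fun t x => (T ×ˢ univ).indicator w (t, x)
  have hin : ∀ t ∈ T, ∀ x, u' t x = w (t, x) := fun t ht x =>
    indicator_of_mem (show (t, x) ∈ T ×ˢ univ from ⟨ht, mem_univ _⟩) _
  have hout : ∀ t ∉ T, u' t = fun _ => 0 := fun t ht => funext fun x =>
    indicator_of_notMem (fun hx : (t, x) ∈ T ×ˢ univ => ht hx.1) _
  have hslice : ∀ t ∈ T, u t =ᵐ[volume] u' t := fun t ht =>
    (hP t ht).1.1.mono fun x hx => by rw [hin t ht, hx]
  have hcong : ∀ᵐ t ∂volume.restrict (Ioi (0:ℝ)), u' t =ᵐ[volume] u t := by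
    filter_upwards [hT] with t ht using (hslice t ht).symm
  have huu' : Function.uncurry u =ᵐ[μST] Function.uncurry u' := by
    have h2 : ∀ᵐ p ∂μST, p.1 ∈ T := by
      unfold μST
      exact Measure.quasiMeasurePreserving_fst.ae hT
    filter_upwards [hae, h2] with p hp hpT
    rw [hp]
    exact (hin p.1 hpT p.2).symm
  have hnorm := mixedNorm_congr hcong
  have htame : IsTame K u' := by
    refine ⟨hw'm, fun t => ?_, fun t => ?_⟩
    · by_cases ht : t ∈ T
      · rw [← eLpNorm_congr_ae (hslice t ht)]
        exact (hP t ht).2.trans hK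
      · rw [hout t ht]; simp
    · by_cases ht : t ∈ T
      · exact (hP t ht).1.2.congr (hslice t ht)
      · rw [hout t ht]; intro φ _ _; simp
  refine ⟨u', htame, ⟨hw'm.aestronglyMeasurable, ?_, ?_, hG, hGb, hdist.congr huu',
    WeakForm.congr hw huu'⟩, hnorm⟩
  · rwa [hnorm]
  · exact Eventually.of_forall htame.div

theorem gradL2_le_iff {G : ℝ → E3 → Fin 3 → Fin 3 → ℝ} {κ : ℝ≥0∞} :
    gradL2 G ≤ κ ↔ ∫⁻ t in Ioi (0:ℝ), gradSq G t ≤ κ ^ 2 := by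
  unfold gradL2
  rw [one_div, ENNReal.rpow_inv_le_iff (by norm_num)]
  norm_num

/-- Sequential compactness of weak solutions at fixed viscosity. -/
theorem exists_weakNS_of_bounded {K κ : ℝ≥0∞} (hK : K ≠ ∞) (hκ : κ ≠ ∞) {ν : ℝ}
    {u₀ : ℕ → E3 → E3} {v₀ : E3 → E3} {u : ℕ → ℝ → E3 → E3}
    {G : ℕ → ℝ → E3 → Fin 3 → Fin 3 → ℝ} (h : ∀ n, IsWeakNS ν (u₀ n) (u n) (G n))
    (hu : ∀ n, mixedNorm ∞ 2 (Ioi 0) (u n) ≤ K) (hG : ∀ n, gradL2 (G n) ≤ κ)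
    (h0 : ∀ φ, IsSolenoidalTest φ → Tendsto (fun n => ∫ x, ∑ i, u₀ n x i * φ x i) atTop
      (nhds (∫ x, ∑ i, v₀ x i * φ x i))) :
    ∃ v G', IsWeakNS ν v₀ v G' ∧ gradL2 G' ≤ κ ∧ ∀ r s C, r ≠ 0 →
      (∀ᶠ n in atTop, mixedNorm r s (Ioi 0) (u n) ≤ C) → mixedNorm r s (Ioi 0) v ≤ C := by
  choose w hw hwNS hwn using fun n => (h n).exists_tame (hu n)
  have hgrad : ∀ n, HasGradBound κ (w n) := fun n => by
    obtain ⟨-, -, -, h4, -, h6, -⟩ := hwNS n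
    exact hasGradBound_of_isDistGrad hκ h4 (gradL2_le_iff.1 (hG n)) h6
  obtain ⟨σ, hσ, hweak⟩ := exists_subseq_weak hK ν hw (fun n => (hwNS n).2.2.2.2.2.2)
    fun φ hφ => (h0 φ hφ).cauchySeq
  obtain ⟨τ, hτ, v, hvm, hvs, hvt, hvd, hva⟩ := exists_limit_tame hK hκ (fun n => hw (σ n))
    (fun n => hgrad (σ n)) hweak
  obtain ⟨G', hG'm, hG'd, hG'b⟩ := exists_limit_gradient hvt
    (fun n => (hw _).locSq hK) hvs hκ (fun n => (hwNS (σ (τ n))).2.2.2.2.2.1)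
    (fun n => (hwNS _).2.2.2.1) (fun n => gradL2_le_iff.1 (hG _))
  have hlsc : ∀ r s C, r ≠ 0 →
      (∀ᶠ n in atTop, mixedNorm r s (Ioi 0) (u n) ≤ C) → mixedNorm r s (Ioi 0) v ≤ C :=
    fun r s C hr hC => mixedNorm_le_of_tendsto (fun n => (hw (σ (τ n))).meas) hva hr <| by
      filter_upwards [(hσ.comp hτ).tendsto_atTop.eventually hC] with n hn
      rw [hwn]
      exact hn
  refine ⟨v, G', ⟨hvm.aestronglyMeasurable, ?_, hvd, hG'm, ?_, hG'd, ?_⟩, gradL2_le_iff.2 hG'b,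
    hlsc⟩
  · exact (hlsc ∞ 2 K (by simp) (Eventually.of_forall hu)).trans_lt hK.lt_top
  · exact hG'b.trans_lt (pow_lt_top hκ.lt_top)
  · exact WeakForm.of_tendsto (ν := fun _ => ν) tendsto_const_nhds hvt
      (fun n => (hw _).locSq hK) hvs (fun n => (hwNS _).2.2.2.2.2.2)
      fun φ hφ => (h0 φ hφ).comp (hσ.comp hτ).tendsto_atTop

theorem measurableEmbedding_mul {a : ℝ} (ha : 0 < a) : MeasurableEmbedding fun t : ℝ => a * t :=
  (Homeomorph.mulLeft₀ a ha.ne').measurableEmbedding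

theorem measurableEmbedding_affine {β : ℝ} (hβ : 0 < β) (y : E3) :
    MeasurableEmbedding fun x : E3 => β • x + y :=
  ((Homeomorph.smulOfNeZero β hβ.ne').trans (Homeomorph.addRight y)).measurableEmbedding

theorem measurableEmbedding_spaceTime {a β : ℝ} (ha : 0 < a) (hβ : 0 < β) (y : E3) :
    MeasurableEmbedding fun p : ℝ × E3 => (a * p.1, β • p.2 + y) :=
  ((Homeomorph.mulLeft₀ a ha.ne').prodCongr
    ((Homeomorph.smulOfNeZero β hβ.ne').trans (Homeomorph.addRight y))).measurableEmbedding

theorem map_time {a : ℝ} (ha : 0 < a) : (volume.restrict (Ioi (0:ℝ))).map (fun t => a * t) =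
    ENNReal.ofReal a⁻¹ • volume.restrict (Ioi (0:ℝ)) := by
  have h : (fun t => a * t) ⁻¹' Ioi (0:ℝ) = Ioi 0 := by
    ext t; simp [ha]
  have := (measurableEmbedding_mul ha).restrict_map volume (Ioi (0:ℝ))
  rw [h] at this
  rw [← this, Real.map_volume_mul_left ha.ne', abs_of_pos (inv_pos.2 ha), Measure.restrict_smul]

theorem map_space {β : ℝ} (hβ : 0 < β) (y : E3) : (volume : Measure E3).map (fun x => β • x + y) =
    ENNReal.ofReal (β ^ 3)⁻¹ • volume := by
  have h1 := Measure.map_addHaar_smul (volume : Measure E3) hβ.ne'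
  rw [finrank_euclideanSpace_fin, abs_of_pos (by positivity)] at h1
  have h2 : (fun x : E3 => β • x + y) = (fun x => x + y) ∘ fun x => β • x := rfl
  rw [h2, ← Measure.map_map (measurable_add_const y) (measurable_const_smul β), h1,
    Measure.map_smul, map_add_right_eq_self]

theorem map_spaceTime {a β : ℝ} (ha : 0 < a) (hβ : 0 < β) (y : E3) :
    μST.map (fun p => (a * p.1, β • p.2 + y)) =
      (ENNReal.ofReal a⁻¹ * ENNReal.ofReal (β ^ 3)⁻¹) • μST := by
  unfold μST
  have := Measure.map_prod_map (volume.restrict (Ioi (0:ℝ))) (volume : Measure E3)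
    (measurableEmbedding_mul ha).measurable (measurableEmbedding_affine hβ y).measurable
  rw [map_time ha, map_space hβ y] at this
  rw [Measure.prod_smul_left, Measure.prod_smul_right, smul_smul] at this
  exact this.symm

theorem integral_spaceTime {a β : ℝ} (ha : 0 < a) (hβ : 0 < β) (y : E3) (f : ℝ × E3 → ℝ) :
    ∫ p, f (a * p.1, β • p.2 + y) ∂μST = a⁻¹ * (β ^ 3)⁻¹ * ∫ p, f p ∂μST := by
  rw [← (measurableEmbedding_spaceTime ha hβ y).integral_map f, map_spaceTime ha hβ,
    integral_smul_measure, toReal_mul, toReal_ofReal (by positivity), toReal_ofReal (by positivity)]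
  rfl

theorem integral_space {β : ℝ} (hβ : 0 < β) (y : E3) (f : E3 → ℝ) :
    ∫ x, f (β • x + y) = (β ^ 3)⁻¹ * ∫ x, f x := by
  rw [← (measurableEmbedding_affine hβ y).integral_map f, map_space hβ,
    integral_smul_measure, toReal_ofReal (by positivity)]
  rfl

theorem quasiMeasurePreserving_time {a : ℝ} (ha : 0 < a) :
    Measure.QuasiMeasurePreserving (fun t => a * t) (volume.restrict (Ioi (0:ℝ)))
      (volume.restrict (Ioi (0:ℝ))) :=
  ⟨(measurableEmbedding_mul ha).measurable, by rw [map_time ha]; exact Measure.smul_absolutelyContinuous⟩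

theorem quasiMeasurePreserving_spaceTime {a β : ℝ} (ha : 0 < a) (hβ : 0 < β) (y : E3) :
    Measure.QuasiMeasurePreserving (fun p : ℝ × E3 => (a * p.1, β • p.2 + y)) μST μST :=
  ⟨(measurableEmbedding_spaceTime ha hβ y).measurable, by
    rw [map_spaceTime ha hβ]; exact Measure.smul_absolutelyContinuous⟩

theorem eLpNorm_affine {β : ℝ} (hβ : 0 < β) (α : ℝ) (y : E3) (w : E3 → E3) (s : ℝ≥0∞) :
    eLpNorm (fun x => α • w (β • x + y)) s volume =
      ‖α‖ₑ * ENNReal.ofReal (β ^ 3)⁻¹ ^ (1 / s).toReal * eLpNorm w s volume := by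
  have h1 : eLpNorm (fun x => α • w (β • x + y)) s volume =
      ‖α‖ₑ * eLpNorm (fun x => w (β • x + y)) s volume :=
    eLpNorm_const_smul α (fun x => w (β • x + y)) s volume
  have h2 := (measurableEmbedding_affine hβ y).eLpNorm_map_measure (g := w) (p := s)
    (μ := volume)
  rw [map_space hβ, eLpNorm_smul_measure_of_ne_zero (by
    rw [ne_eq, ofReal_eq_zero, not_le]; positivity)] at h2
  rw [h1, mul_assoc]
  congr 1
  exact h2.symm

/-- Rescaling of a velocity field. -/
def rescale (α β : ℝ) (y : E3) (u : ℝ → E3 → E3) : ℝ → E3 → E3 :=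
  fun t x => α • u (α * β * t) (β • x + y)

/-- Rescaling of a velocity gradient. -/
def rescaleGrad (α β : ℝ) (y : E3) (G : ℝ → E3 → Fin 3 → Fin 3 → ℝ) :
    ℝ → E3 → Fin 3 → Fin 3 → ℝ :=
  fun t x i j => α * β * G (α * β * t) (β • x + y) i j

theorem mixedNorm_rescale_le {α β : ℝ} (hα : 0 < α) (hβ : 0 < β) (y : E3) (u : ℝ → E3 → E3)
    {r s : ℝ≥0∞} (hr : r ≠ 0) :
    mixedNorm r s (Ioi 0) (rescale α β y u) ≤
      ENNReal.ofReal α * ENNReal.ofReal (β ^ 3)⁻¹ ^ (1 / s).toReal *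
        ENNReal.ofReal (α * β)⁻¹ ^ (1 / r).toReal * mixedNorm r s (Ioi 0) u := by
  have hab : 0 < α * β := mul_pos hα hβ
  set k := ENNReal.ofReal α * ENNReal.ofReal (β ^ 3)⁻¹ ^ (1 / s).toReal with hk
  have hslice : ∀ t, eLpNorm (rescale α β y u t) s volume =
      k * eLpNorm (u (α * β * t)) s volume := fun t => by
    rw [hk, ← Real.enorm_of_nonneg hα.le]
    exact eLpNorm_affine hβ α y _ s
  unfold mixedNorm
  simp_rw [hslice]
  split_ifs with hrt
  · subst hrt
    simp only [div_top, toReal_zero, rpow_zero, mul_one]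
    refine essSup_le_of_ae_le _ ?_
    filter_upwards [(quasiMeasurePreserving_time hab).ae
      (ENNReal.ae_le_essSup fun t => eLpNorm (u t) s volume)] with t ht
    exact mul_le_mul_right ht k
  · have hr0 : 0 < r.toReal := toReal_pos hr hrt
    have hkt : k ≠ ∞ := mul_ne_top ofReal_ne_top (rpow_ne_top_of_nonneg toReal_nonneg ofReal_ne_top)
    clear_value k
    simp_rw [ENNReal.mul_rpow_of_nonneg _ _ hr0.le]
    rw [lintegral_const_mul' _ _ (rpow_ne_top_of_nonneg hr0.le hkt),
      ← (measurableEmbedding_mul hab).lintegral_map (fun t => eLpNorm (u t) s volume ^ r.toReal),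
      map_time hab, lintegral_smul_measure, smul_eq_mul,
      ENNReal.mul_rpow_of_nonneg _ _ (by positivity), ENNReal.mul_rpow_of_nonneg _ _ (by positivity),
      ← ENNReal.rpow_mul, mul_one_div_cancel hr0.ne', ENNReal.rpow_one, ← mul_assoc,
      ENNReal.toReal_div, toReal_one]

theorem gradSq_rescaleGrad {α β : ℝ} (hβ : 0 < β) (y : E3)
    (G : ℝ → E3 → Fin 3 → Fin 3 → ℝ) (t : ℝ) :
    gradSq (rescaleGrad α β y G) t =
      ENNReal.ofReal ((α * β) ^ 2) * ENNReal.ofReal (β ^ 3)⁻¹ * gradSq G (α * β * t) := by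
  unfold gradSq
  simp_rw [rescaleGrad, mul_pow, ← mul_pow α β, ofReal_mul (sq_nonneg (α * β)), ← Finset.mul_sum]
  rw [lintegral_const_mul' _ _ ofReal_ne_top, ← (measurableEmbedding_affine hβ y).lintegral_map
    (fun x => ∑ i, ∑ j, ENNReal.ofReal (G (α * β * t) x i j ^ 2)), map_space hβ,
    lintegral_smul_measure, smul_eq_mul]
  exact (mul_assoc _ _ _).symm

theorem gradL2_rescaleGrad {α β : ℝ} (hα : 0 < α) (hβ : 0 < β) (y : E3)
    (G : ℝ → E3 → Fin 3 → Fin 3 → ℝ) :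
    gradL2 (rescaleGrad α β y G) = ENNReal.ofReal (√(α * β) * √(β ^ 3)⁻¹) * gradL2 G := by
  have hab : 0 < α * β := mul_pos hα hβ
  unfold gradL2
  simp_rw [gradSq_rescaleGrad hβ y G]
  rw [lintegral_const_mul' _ _ (mul_ne_top ofReal_ne_top ofReal_ne_top),
    ← (measurableEmbedding_mul hab).lintegral_map (fun t => gradSq G t), map_time hab,
    lintegral_smul_measure, smul_eq_mul, ← mul_assoc, ← ofReal_mul (by positivity),
    ← ofReal_mul (by positivity), ENNReal.mul_rpow_of_nonneg _ _ (by positivity),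
    ENNReal.ofReal_rpow_of_pos (by positivity), ← Real.sqrt_eq_rpow, ← Real.sqrt_mul hab.le]
  congr 3
  field_simp

theorem pd_affine {f : E3 → ℝ} (hf : ContDiff ℝ (⊤ : ℕ∞) f) (d : ℝ) (b : E3) (j : Fin 3) (x : E3) :
    pd (fun y => f (d • y + b)) j x = d * pd f j (d • x + b) := by
  have h1 : HasFDerivAt (fun y : E3 => d • y + b) (d • ContinuousLinearMap.id ℝ E3) x :=
    ((hasFDerivAt_id x).const_smul d).add_const b
  have h2 : HasFDerivAt (fun y : E3 => f (d • y + b)) _ x :=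
    (hf.hasFDerivAt_top (d • x + b)).comp x h1
  rw [pd_eq_of_hasFDerivAt h2]
  simp [pd]

theorem ContDiff.comp_affine {F : Type*} [NormedAddCommGroup F] [NormedSpace ℝ F] {f : E3 → F}
    (hf : ContDiff ℝ (⊤ : ℕ∞) f) (d : ℝ) (b : E3) :
    ContDiff ℝ (⊤ : ℕ∞) fun y => f (d • y + b) :=
  hf.comp ((contDiff_id.const_smul d).add contDiff_const)

theorem ContDiff.comp_affine_spaceTime {F : Type*} [NormedAddCommGroup F] [NormedSpace ℝ F]
    {f : ℝ × E3 → F} (hf : ContDiff ℝ (⊤ : ℕ∞) f) (c d : ℝ) (b : E3) :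
    ContDiff ℝ (⊤ : ℕ∞) fun q : ℝ × E3 => f (c * q.1, d • q.2 + b) :=
  hf.comp ((contDiff_const.mul contDiff_fst).prodMk ((contDiff_snd.const_smul d).add contDiff_const))

theorem ContDiff.slice {F : Type*} [NormedAddCommGroup F] [NormedSpace ℝ F]
    {f : ℝ × E3 → F} (hf : ContDiff ℝ (⊤ : ℕ∞) f) (t : ℝ) :
    ContDiff ℝ (⊤ : ℕ∞) fun y => f (t, y) :=
  hf.comp (contDiff_const.prodMk contDiff_id)

theorem hasCompactSupport_comp_affine {F : Type*} [Zero F] {f : E3 → F}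
    (hf : HasCompactSupport f) {d : ℝ} (hd : d ≠ 0) (b : E3) :
    HasCompactSupport fun y => f (d • y + b) :=
  hf.comp_homeomorph ((Homeomorph.smulOfNeZero d hd).trans (Homeomorph.addRight b))

theorem hasCompactSupport_comp_affine_spaceTime {F : Type*} [Zero F] {f : ℝ × E3 → F}
    (hf : HasCompactSupport f) {c d : ℝ} (hc : c ≠ 0) (hd : d ≠ 0) (b : E3) :
    HasCompactSupport fun q : ℝ × E3 => f (c * q.1, d • q.2 + b) :=
  hf.comp_homeomorph ((Homeomorph.mulLeft₀ c hc).prodCongr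
    ((Homeomorph.smulOfNeZero d hd).trans (Homeomorph.addRight b)))

theorem affine_leftInverse {β : ℝ} (hβ : β ≠ 0) (y x : E3) :
    β⁻¹ • (β • x + y) + -(β⁻¹ • y) = x := by
  rw [smul_add, smul_smul, inv_mul_cancel₀ hβ, one_smul, add_neg_cancel_right]

theorem IsDivFree.comp_affine {v : E3 → E3} (hv : IsDivFree v) (α : ℝ) {β : ℝ} (hβ : 0 < β)
    (y : E3) : IsDivFree fun x => α • v (β • x + y) := by
  intro φ hφ hc
  have h1 := hv _ (hφ.comp_affine β⁻¹ (-(β⁻¹ • y)))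
    (hasCompactSupport_comp_affine hc (inv_ne_zero hβ.ne') _)
  have h2 := integral_space hβ y
    (fun x => ∑ i, v x i * pd (fun y' => φ (β⁻¹ • y' + -(β⁻¹ • y))) i x)
  rw [h1, mul_zero] at h2
  simp_rw [pd_affine hφ, affine_leftInverse hβ.ne'] at h2
  have h3 : ∀ x, ∑ i, (α • v (β • x + y)) i * pd φ i x =
      α * β * ∑ i, v (β • x + y) i * (β⁻¹ * pd φ i x) := fun x => by
    rw [Finset.mul_sum]
    refine Finset.sum_congr rfl fun i _ => ?_
    simp only [PiLp.smul_apply, smul_eq_mul]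
    field_simp
  simp_rw [h3]
  rw [integral_const_mul, h2, mul_zero]

theorem IsDistGrad.rescale {u : ℝ → E3 → E3} {G : ℝ → E3 → Fin 3 → Fin 3 → ℝ}
    (h : IsDistGrad u G) {α β : ℝ} (hα : 0 < α) (hβ : 0 < β) (y : E3) :
    IsDistGrad (rescale α β y u) (rescaleGrad α β y G) := by
  intro ψ h1 h2 h3 i j
  have hab : 0 < α * β := mul_pos hα hβ
  set b := -(β⁻¹ • y) with hb
  have hcont : Continuous fun q : ℝ × E3 => ((α * β)⁻¹ * q.1, β⁻¹ • q.2 + b) := by fun_prop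
  have key := h (fun q => ψ ((α * β)⁻¹ * q.1, β⁻¹ • q.2 + b)) (h1.comp_affine_spaceTime _ _ _)
    (hasCompactSupport_comp_affine_spaceTime h2 (inv_ne_zero hab.ne') (inv_ne_zero hβ.ne') _)
    (fun q hq => by
      have hq' : ((α * β)⁻¹ * q.1, β⁻¹ • q.2 + b) ∈ tsupport ψ :=
        closure_minimal (t := (fun q : ℝ × E3 => ((α * β)⁻¹ * q.1, β⁻¹ • q.2 + b)) ⁻¹' tsupport ψ)
          (fun p hp => subset_tsupport ψ hp) ((isClosed_tsupport ψ).preimage hcont) hq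
      have : 0 < (α * β)⁻¹ * q.1 := h3 hq'
      exact (mul_pos_iff_of_pos_left (inv_pos.2 hab)).1 this) i j
  have e1 := integral_spaceTime hab hβ y
    fun p => u p.1 p.2 i * pd (fun y' => ψ ((α * β)⁻¹ * p.1, β⁻¹ • y' + b)) j p.2
  have e2 := integral_spaceTime hab hβ y
    fun p => G p.1 p.2 i j * ψ ((α * β)⁻¹ * p.1, β⁻¹ • p.2 + b)
  simp only at e1 e2
  rw [key] at e1
  have e3 : ∀ t x, pd (fun y' => ψ ((α * β)⁻¹ * t, β⁻¹ • y' + b)) j x =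
      β⁻¹ * pd (fun y' => ψ ((α * β)⁻¹ * t, y')) j (β⁻¹ • x + b) := fun t x =>
    pd_affine (h1.slice _) _ _ _ _
  simp_rw [e3, hb, affine_leftInverse hβ.ne', inv_mul_cancel_left₀ hab.ne'] at e1 e2
  have e4 : ∀ p : ℝ × E3, _root_.rescale α β y u p.1 p.2 i * pd (fun y' => ψ (p.1, y')) j p.2 =
      (α * β) * (u (α * β * p.1) (β • p.2 + y) i * (β⁻¹ * pd (fun y' => ψ (p.1, y')) j p.2)) :=
    fun p => by
      simp only [_root_.rescale, PiLp.smul_apply, smul_eq_mul]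
      field_simp
  have e5 : ∀ p : ℝ × E3, rescaleGrad α β y G p.1 p.2 i j * ψ p =
      (α * β) * (G (α * β * p.1) (β • p.2 + y) i j * ψ (p.1, p.2)) := fun p => by
    simp only [rescaleGrad]; ring
  simp_rw [e4, e5, integral_const_mul, e1, e2]
  ring

theorem WeakForm.rescale {ν : ℝ} {u₀ : E3 → E3} {u : ℝ → E3 → E3} (h : WeakForm ν u₀ u)
    {α β : ℝ} (hα : 0 < α) (hβ : 0 < β) (y : E3) :
    WeakForm (ν * α / β) (fun x => α • u₀ (β • x + y)) (rescale α β y u) := by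
  intro φ hφ
  have hab : 0 < α * β := mul_pos hα hβ
  set b := -(β⁻¹ • y) with hb
  set Φ : ℝ × E3 → E3 := fun q => φ ((α * β)⁻¹ * q.1, β⁻¹ • q.2 + b) with hΦ
  have hslice : ∀ t i, ContDiff ℝ (⊤ : ℕ∞) fun y' => φ (t, y') i := fun t i =>
    (hφ.1.coord i).slice t
  have hpd : ∀ t i j, (pd (fun y' => Φ (t, y') i) j) =
      fun x => β⁻¹ * pd (fun y' => φ ((α * β)⁻¹ * t, y') i) j (β⁻¹ • x + b) := fun t i j =>
    funext fun x => pd_affine (hslice ((α * β)⁻¹ * t) i) β⁻¹ b j x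
  have hΦt : IsTest Φ := by
    refine ⟨hφ.1.comp_affine_spaceTime _ _ _, hasCompactSupport_comp_affine_spaceTime hφ.2.1
      (inv_ne_zero hab.ne') (inv_ne_zero hβ.ne') _, fun p => ?_⟩
    simp_rw [hpd, ← Finset.mul_sum]
    rw [hφ.2.2 ((α * β)⁻¹ * p.1, β⁻¹ • p.2 + b), mul_zero]
  have hinv : ∀ p : ℝ × E3, ((α * β)⁻¹ * (α * β * p.1), β⁻¹ • (β • p.2 + y) + b) = p := fun p => by
    rw [hb, affine_leftInverse hβ.ne', inv_mul_cancel_left₀ hab.ne']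
  have hinv1 : ∀ t : ℝ, (α * β)⁻¹ * (α * β * t) = t := fun t => inv_mul_cancel_left₀ hab.ne' t
  have hinv2 : ∀ x : E3, β⁻¹ • (β • x + y) + b = x := fun x => affine_leftInverse hβ.ne' y x
  have hT : ∀ (p : ℝ × E3) i, timeDeriv Φ (α * β * p.1, β • p.2 + y) i =
      (α * β)⁻¹ * timeDeriv φ p i := fun p i => by
    have := deriv_comp_mul_left (α * β)⁻¹ (fun τ => φ (τ, p.2) i) (α * β * p.1)
    rw [hinv1] at this
    simp only [timeDeriv, hΦ, hinv2]
    exact this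
  have hGr : ∀ (p : ℝ × E3) i j, spaceGrad Φ (α * β * p.1, β • p.2 + y) i j =
      β⁻¹ * spaceGrad φ p i j := fun p i j => by
    simp only [spaceGrad, hpd, hinv1, hinv2]
  have hL : ∀ (p : ℝ × E3) i, spaceLap Φ (α * β * p.1, β • p.2 + y) i =
      β⁻¹ * (β⁻¹ * spaceLap φ p i) := fun p i => by
    simp only [spaceLap, Finset.mul_sum]
    refine Finset.sum_congr rfl fun j _ => ?_
    change pd (pd (fun z => Φ (α * β * p.1, z) i) j) j (β • p.2 + y) = _
    rw [hpd, hinv1, pd_const_mul (((hslice _ _).pd j).comp_affine _ _), pd_affine ((hslice _ _).pd j),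
      hinv2]
  have key := h Φ hΦt
  have e1 := integral_spaceTime hab hβ y fun p =>
    (∑ i, u p.1 p.2 i * (timeDeriv Φ p i + ν * spaceLap Φ p i)) +
         ∑ i, ∑ j, u p.1 p.2 i * u p.1 p.2 j * spaceGrad Φ p i j
  have e2 := integral_space hβ y fun x => ∑ i, u₀ x i * Φ (0, x) i
  rw [key] at e1
  simp only [hT, hGr, hL] at e1
  have hΦ0 : ∀ x, Φ (0, β • x + y) = φ (0, x) := fun x => by
    simp only [hΦ, hinv2, mul_zero]
  simp only [hΦ0] at e2
  have e3 : ∀ p : ℝ × E3, ((∑ i, _root_.rescale α β y u p.1 p.2 i *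
      (timeDeriv φ p i + ν * α / β * spaceLap φ p i)) +
         ∑ i, ∑ j, _root_.rescale α β y u p.1 p.2 i * _root_.rescale α β y u p.1 p.2 j *
          spaceGrad φ p i j) = (α ^ 2 * β) *
      ((∑ i, u (α * β * p.1) (β • p.2 + y) i *
        ((α * β)⁻¹ * timeDeriv φ p i + ν * (β⁻¹ * (β⁻¹ * spaceLap φ p i)))) +
         ∑ i, ∑ j, u (α * β * p.1) (β • p.2 + y) i * u (α * β * p.1) (β • p.2 + y) j *
          (β⁻¹ * spaceGrad φ p i j)) := fun p => by
    simp only [_root_.rescale, PiLp.smul_apply, smul_eq_mul, mul_add, Finset.mul_sum]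
    rw [← Finset.sum_add_distrib, ← Finset.sum_add_distrib]
    refine Finset.sum_congr rfl fun i _ => ?_
    congr 1
    · field_simp
    · refine Finset.sum_congr rfl fun j _ => ?_
      field_simp
  have e4 : ∀ x, ∑ i, (α • u₀ (β • x + y)) i * φ (0, x) i =
      α * ∑ i, u₀ (β • x + y) i * φ (0, x) i := fun x => by
    simp only [PiLp.smul_apply, smul_eq_mul, Finset.mul_sum, mul_assoc]
  simp_rw [e3, e4, integral_const_mul, e1, e2]
  field_simp

/-- Rescaling and translating weak solutions. -/
theorem IsWeakNS.rescale {ν : ℝ} {u₀ : E3 → E3} {u : ℝ → E3 → E3}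
    {G : ℝ → E3 → Fin 3 → Fin 3 → ℝ} (h : IsWeakNS ν u₀ u G) {α β : ℝ} (hα : 0 < α) (hβ : 0 < β)
    (y : E3) : IsWeakNS (ν * α / β) (fun x => α • u₀ (β • x + y)) (rescale α β y u)
      (rescaleGrad α β y G) := by
  obtain ⟨hm, hb, hd, hG, hGb, hdist, hw⟩ := h
  have hab : 0 < α * β := mul_pos hα hβ
  have hq := quasiMeasurePreserving_spaceTime hab hβ y
  refine ⟨(hm.comp_quasiMeasurePreserving hq).const_smul α, ?_, ?_, ?_, ?_, hdist.rescale hα hβ y,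
    WeakForm.rescale hw hα hβ y⟩
  · refine (mixedNorm_rescale_le hα hβ y u (by simp)).trans_lt (mul_lt_top (Ne.lt_top ?_) hb)
    exact mul_ne_top (mul_ne_top ofReal_ne_top (rpow_ne_top_of_nonneg toReal_nonneg ofReal_ne_top))
      (rpow_ne_top_of_nonneg toReal_nonneg ofReal_ne_top)
  · filter_upwards [(quasiMeasurePreserving_time hab).ae hd] with t ht
    exact ht.comp_affine α hβ y
  · exact (hG.comp_quasiMeasurePreserving hq).const_smul (α * β)
  · have h1 : gradL2 G ≠ ∞ := by
      unfold gradL2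
      exact rpow_ne_top_of_nonneg (by norm_num) hGb.ne
    have h2 : gradL2 (rescaleGrad α β y G) ≠ ∞ := by
      rw [gradL2_rescaleGrad hα hβ]
      exact mul_ne_top ofReal_ne_top h1
    exact (gradL2_le_iff.1 le_rfl).trans_lt (pow_lt_top h2.lt_top)

/-- A weak solution with all three norms bounded by `N`. -/
def HasBoundedSolution (r s : ℝ≥0∞) (N : ℕ) (ν : ℝ) (u₀ : E3 → E3) : Prop :=
  ∃ u G, IsWeakNS ν u₀ u G ∧ mixedNorm ∞ 2 (Ioi 0) u ≤ N ∧
    ENNReal.ofReal √ν * gradL2 G ≤ N ∧ mixedNorm r s (Ioi 0) u ≤ N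

theorem HasBoundedSolution.of_tendsto {r s : ℝ≥0∞} (hr : r ≠ 0) {N : ℕ} {ν : ℝ} (hν : 0 < ν)
    {u₀ : ℕ → E3 → E3} {v₀ : E3 → E3} (h : ∀ n, HasBoundedSolution r s N ν (u₀ n))
    (h0 : ∀ φ, IsSolenoidalTest φ → Tendsto (fun n => ∫ x, ∑ i, u₀ n x i * φ x i) atTop
      (nhds (∫ x, ∑ i, v₀ x i * φ x i))) : HasBoundedSolution r s N ν v₀ := by
  choose u G h1 h2 h3 h4 using h
  have hsq : ENNReal.ofReal √ν ≠ 0 := (ofReal_pos.2 (Real.sqrt_pos.2 hν)).ne'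
  have hle : ∀ x : ℝ≥0∞, ENNReal.ofReal √ν * x ≤ N ↔ x ≤ N / ENNReal.ofReal √ν := fun x => by
    rw [ENNReal.le_div_iff_mul_le (Or.inl hsq) (Or.inl ofReal_ne_top), mul_comm]
  simp_rw [hle] at h3
  obtain ⟨v, G', hv, hG, hn⟩ := exists_weakNS_of_bounded (natCast_ne_top N)
    (div_ne_top (natCast_ne_top N) hsq) h1 h2 h3 h0
  exact ⟨v, G', hv, hn ∞ 2 N (by simp) (Eventually.of_forall h2), (hle _).2 hG,
    hn r s N hr (Eventually.of_forall h4)⟩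

theorem IsWeakNS.congr_datum {ν : ℝ} {u₀ v₀ : E3 → E3} {u : ℝ → E3 → E3}
    {G : ℝ → E3 → Fin 3 → Fin 3 → ℝ} (h : IsWeakNS ν u₀ u G) (h0 : u₀ =ᵐ[volume] v₀) :
    IsWeakNS ν v₀ u G := by
  obtain ⟨h1, h2, h3, h4, h5, h6, h7⟩ := h
  refine ⟨h1, h2, h3, h4, h5, h6, fun φ hφ => (h7 φ hφ).trans ?_⟩
  congr 1
  exact integral_congr_ae (h0.mono fun x hx => by simp only [hx])

theorem HasBoundedSolution.congr {r s : ℝ≥0∞} {N : ℕ} {ν : ℝ} {u₀ v₀ : E3 → E3}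
    (h : HasBoundedSolution r s N ν u₀) (h0 : u₀ =ᵐ[volume] v₀) :
    HasBoundedSolution r s N ν v₀ := by
  obtain ⟨u, G, h1, h2⟩ := h
  exact ⟨u, G, h1.congr_datum h0, h2⟩

theorem tendsto_integral_datum {u : ℕ → Lp E3 2 (volume : Measure E3)}
    {v : Lp E3 2 (volume : Measure E3)} (h : Tendsto u atTop (nhds v)) {φ : E3 → E3}
    (hφ : IsSolenoidalTest φ) :
    Tendsto (fun n => ∫ x, ∑ i, u n x i * φ x i) atTop (nhds (∫ x, ∑ i, v x i * φ x i)) := by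
  have e : ∀ w : Lp E3 2 (volume : Measure E3), ∫ x, ∑ i, w x i * φ x i =
      inner ℝ w (hφ.memLp.toLp φ) := fun w => by
    rw [← inner_Lp_eq (Lp.memLp w) hφ.memLp, Lp.toLp_coeFn]
  simp_rw [e]
  exact h.inner tendsto_const_nhds

/-- Bounded solvability at all small viscosities. -/
def boundedData (r s : ℝ≥0∞) (N : ℕ) : Set L2σ :=
  {u₀ | ∀ ν : ℝ, 0 < ν → ν * (N + 1) ≤ 1 →
    HasBoundedSolution r s N ν ((u₀ : Lp E3 2 (volume : Measure E3)) : E3 → E3)}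

theorem isClosed_boundedData {r : ℝ≥0∞} (hr : r ≠ 0) (s : ℝ≥0∞) (N : ℕ) :
    IsClosed (boundedData r s N) := by
  refine IsSeqClosed.isClosed fun u v hu huv ν hν hνN => ?_
  refine HasBoundedSolution.of_tendsto hr hν (fun n => hu n ν hν hνN) fun φ hφ => ?_
  exact tendsto_integral_datum ((continuous_subtype_val.tendsto v).comp huv) hφ

theorem mem_boundedData_of_limsup {r s : ℝ≥0∞} {u₀ : L2σ}
    (h : limsup (fun ν : ℝ =>
        ⨅ (u : ℝ → E3 → E3) (G : ℝ → E3 → Fin 3 → Fin 3 → ℝ)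
          (_ : IsWeakNS ν ((u₀ : Lp E3 2 (volume : Measure E3)) : E3 → E3) u G),
          (mixedNorm ∞ 2 (Ioi 0) u + ENNReal.ofReal (Real.sqrt ν) * gradL2 G +
            mixedNorm r s (Ioi 0) u))
        (nhdsWithin (0:ℝ) (Ioi 0)) < ∞) : ∃ N, u₀ ∈ boundedData r s N := by
  obtain ⟨M, hM1, hM2⟩ := ENNReal.lt_iff_exists_nnreal_btwn.1 h
  have hev := eventually_lt_of_limsup_lt hM1
  obtain ⟨δ, hδ, hlt⟩ := (nhdsGT_basis (0:ℝ)).eventually_iff.1 hev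
  obtain ⟨N₁, hN₁⟩ := exists_nat_ge M
  obtain ⟨N₂, hN₂⟩ := exists_nat_gt δ⁻¹
  refine ⟨max N₁ N₂, fun ν hν hνN => ?_⟩
  have hνδ : ν < δ := by
    have h1 : δ⁻¹ < (max N₁ N₂ : ℕ) + 1 :=
      hN₂.trans (lt_of_le_of_lt (Nat.cast_le.2 (le_max_right _ _)) (lt_add_one _))
    have h2 : 1 < δ * ((max N₁ N₂ : ℕ) + 1) := by
      rw [inv_lt_iff_one_lt_mul₀' hδ] at h1
      exact h1
    by_contra! h3
    have h4 : δ * ((max N₁ N₂ : ℕ) + 1) ≤ ν * ((max N₁ N₂ : ℕ) + 1) := by gcongr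
    linarith
  have := hlt (x := ν) ⟨hν, hνδ⟩
  simp only [iInf_lt_iff] at this
  obtain ⟨u, G, hNS, hb⟩ := this
  have hle : (M : ℝ≥0∞) ≤ (max N₁ N₂ : ℕ) := by
    have : M ≤ ((max N₁ N₂ : ℕ) : NNReal) := hN₁.trans (Nat.cast_le.2 (le_max_left _ _))
    exact_mod_cast ENNReal.coe_le_coe.2 this
  have hb' := hb.le.trans hle
  exact ⟨u, G, hNS, (le_self_add.trans le_self_add).trans hb',
    (le_add_self.trans le_self_add).trans hb', le_add_self.trans hb'⟩

/-- Baire category: bounded solvability holds uniformly on some ball of data. -/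
theorem exists_ball_boundedData {r s : ℝ≥0∞} (hr : r ≠ 0)
    (hyp : ¬ IsMeagre {u₀ : L2σ |
      limsup (fun ν : ℝ =>
        ⨅ (u : ℝ → E3 → E3) (G : ℝ → E3 → Fin 3 → Fin 3 → ℝ)
          (_ : IsWeakNS ν ((u₀ : Lp E3 2 (volume : Measure E3)) : E3 → E3) u G),
          (mixedNorm ∞ 2 (Ioi 0) u + ENNReal.ofReal (Real.sqrt ν) * gradL2 G +
            mixedNorm r s (Ioi 0) u))
        (nhdsWithin (0:ℝ) (Ioi 0)) < ∞}) :
    ∃ N, ∃ v : L2σ, ∃ ε > 0, Metric.ball v ε ⊆ boundedData r s N := by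
  by_contra! hcon
  refine hyp ((isMeagre_iUnion fun N => IsNowhereDense.isMeagre
    ((isClosed_boundedData hr s N).isNowhereDense_iff.2 ?_)).mono fun u₀ hu₀ =>
      mem_iUnion.2 (mem_boundedData_of_limsup hu₀))
  refine eq_empty_of_forall_notMem fun v hv => ?_
  obtain ⟨ε, hε, hsub⟩ := Metric.isOpen_iff.1 isOpen_interior v hv
  exact hcon N v ε hε (hsub.trans interior_subset)

theorem IsDivFree.add {v w : E3 → E3} (hv : IsDivFree v) (hw : IsDivFree w)
    (hv2 : MemLp v 2 volume) (hw2 : MemLp w 2 volume) : IsDivFree fun x => v x + w x := by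
  intro φ hφ hc
  have hInt : ∀ {u : E3 → E3}, MemLp u 2 volume →
      Integrable (fun x => ∑ i, u x i * pd φ i x) := fun {u} hu =>
    integrable_finsetSum _ fun i _ => (MemLp.coord hu i).integrable_mul
      ((hφ.pd i).continuous.memLp_of_hasCompactSupport (p := 2) (hc.pd i))
  have := integral_add (hInt hv2) (hInt hw2)
  rw [hv φ hφ hc, hw φ hφ hc, add_zero] at this
  rw [← this]
  congr 1; ext x
  rw [← Finset.sum_add_distrib]
  exact Finset.sum_congr rfl fun i _ => by simp [add_mul]

theorem MemLp.comp_add_right {E : Type*} [NormedAddCommGroup E] {v : E3 → E} {p : ℝ≥0∞}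
    (hv : MemLp v p volume) (y : E3) : MemLp (fun x => v (x + y)) p volume :=
  hv.comp_measurePreserving (measurePreserving_add_right volume y)

/-- Translates to infinity converge weakly to zero in `L²`. -/
theorem tendsto_integral_translate_mul {f g : E3 → ℝ} (hf : MemLp f 2 volume)
    (hg : Continuous g) (hgc : HasCompactSupport g) {y : ℕ → E3}
    (hy : Tendsto (fun n => ‖y n‖) atTop atTop) :
    Tendsto (fun n => ∫ x, f (x + y n) * g x) atTop (nhds 0) := by
  have hmeas : MeasurableSet (tsupport g) := hgc.isCompact.measurableSet
  have key : Tendsto (fun n => eLpNorm (fun x => f (x + y n) - 0) 2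
      (volume.restrict (tsupport g))) atTop (nhds 0) := by
    rw [tendsto_eLpNorm_two_iff]
    have e : ∀ n, ∫⁻ x in tsupport g, ‖f (x + y n) - 0‖ₑ ^ 2 =
        ∫⁻ x, (tsupport g).indicator (fun _ => (1:ℝ≥0∞)) (x - y n) * ‖f x‖ₑ ^ 2 := fun n => by
      rw [← lintegral_indicator hmeas, ← lintegral_add_right_eq_self (fun x =>
      (tsupport g).indicator (fun _ => (1:ℝ≥0∞)) (x - y n) * ‖f x‖ₑ ^ 2) (y n)]
      refine lintegral_congr fun x => ?_
      by_cases hx : x ∈ tsupport g <;> simp [hx]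
    simp_rw [e]
    have hz : (0 : ℝ≥0∞) = ∫⁻ _ : E3, 0 := by simp
    rw [hz]
    refine tendsto_lintegral_of_dominated_convergence' (fun x => ‖f x‖ₑ ^ 2) ?_ ?_ ?_ ?_
    · exact fun n => (((measurable_const.indicator hmeas).comp
        (measurable_id.sub_const _)).aemeasurable).mul (hf.1.enorm.pow_const 2)
    · refine fun n => ae_of_all _ fun x => ?_
      by_cases hx : x - y n ∈ tsupport g <;> simp [hx]
    · rw [← eLpNorm_two_sq]
      exact pow_ne_top hf.2.ne
    · refine ae_of_all _ fun x => tendsto_const_nhds.congr' ?_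
      obtain ⟨R, hR⟩ := hgc.isCompact.isBounded.exists_norm_le
      filter_upwards [hy.eventually_gt_atTop (R + ‖x‖)] with n hn
      have : x - y n ∉ tsupport g := fun h => by
        have h1 := hR _ h
        have h2 := norm_sub_norm_le (y n) x
        rw [norm_sub_rev] at h1
        linarith
      simp [this]
  have hmg : MemLp g 2 (volume.restrict (tsupport g)) :=
    (hg.memLp_of_hasCompactSupport hgc).restrict _
  have := tendsto_integral_mul_of_eLpNorm (fun n => (MemLp.comp_add_right hf (y n)).restrict _)
    (f₀ := fun _ => 0) MemLp.zero' (fun _ => hmg) hmg key (by simp)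
  simp only [zero_mul, integral_zero] at this
  refine this.congr fun n => setIntegral_eq_integral_of_forall_compl_eq_zero fun x hx => ?_
  rw [image_eq_zero_of_notMem_tsupport hx, mul_zero]

/-- Solvability on a ball of data around an arbitrary centre implies solvability on a ball
around the origin. -/
theorem hasBoundedSolution_of_ball {r s : ℝ≥0∞} (hr : r ≠ 0) {N : ℕ} {v : L2σ} {ε : ℝ}
    (hball : Metric.ball v ε ⊆ boundedData r s N) {w : E3 → E3} (hw : MemLp w 2 volume)
    (hdiv : IsDivFree w) (hwε : eLpNorm w 2 volume < ENNReal.ofReal ε) {ν : ℝ} (hν : 0 < ν)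
    (hνN : ν * (N + 1) ≤ 1) : HasBoundedSolution r s N ν w := by
  set v₀ : E3 → E3 := ((v : Lp E3 2 (volume : Measure E3)) : E3 → E3) with hv₀
  have hv2 : MemLp v₀ 2 volume := Lp.memLp _
  have hvd : IsDivFree v₀ := v.2
  let y : ℕ → E3 := fun n => (n:ℝ) • EuclideanSpace.single 0 1
  have hy : Tendsto (fun n => ‖y n‖) atTop atTop := by
    simpa [y, norm_smul] using tendsto_natCast_atTop_atTop
  have hsol : ∀ n, HasBoundedSolution r s N ν fun x => v₀ (x + y n) + w x := fun n => by
    have hw2 : MemLp (fun x => w (x + -y n)) 2 volume := MemLp.comp_add_right hw _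
    have hmem : MemLp (fun x => v₀ x + w (x + -y n)) 2 volume := hv2.add hw2
    have hd : IsDivFree fun x => v₀ x + w (x + -y n) :=
      hvd.add (isDivFree_shift hdiv _) hv2 hw2
    let d : L2σ := ⟨hmem.toLp _, hd.congr hmem.coeFn_toLp.symm⟩
    have hdist : d ∈ Metric.ball v ε := by
      rw [← Metric.eball_ofReal, Metric.mem_eball, Subtype.edist_eq]
      have e1 : (v : Lp E3 2 (volume : Measure E3)) = hv2.toLp v₀ := (Lp.toLp_coeFn _ hv2).symm
      rw [e1]
      change edist (hmem.toLp _) (hv2.toLp v₀) < _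
      rw [Lp.edist_toLp_toLp]
      have e2 : ((fun x => v₀ x + w (x + -y n)) - v₀) = fun x => w (x + -y n) := by
        ext1 x; simp
      rw [e2]
      have := eLpNorm_comp_measurePreserving (p := 2) hw.1
        (measurePreserving_add_right volume (-y n))
      exact lt_of_eq_of_lt this hwε
    obtain ⟨u, G, h1, h2, h3, h4⟩ := (hball hdist ν hν hνN).congr hmem.coeFn_toLp
    have h5 := h1.rescale one_pos one_pos (y n)
    simp only [mul_one, div_one, one_smul, add_neg_cancel_right] at h5
    refine ⟨_, _, h5, ?_, ?_, ?_⟩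
    · refine (mixedNorm_rescale_le one_pos one_pos _ u (by simp)).trans ?_
      simpa using h2
    · rw [gradL2_rescaleGrad one_pos one_pos]
      simpa using h3
    · refine (mixedNorm_rescale_le one_pos one_pos _ u hr).trans ?_
      simpa using h4
  refine HasBoundedSolution.of_tendsto hr hν hsol fun φ hφ => ?_
  have hφc : ∀ i, Continuous fun x => φ x i := fun i =>
    (EuclideanSpace.proj i : E3 →L[ℝ] ℝ).continuous.comp hφ.1.continuous
  have hφs : ∀ i, HasCompactSupport fun x => φ x i := fun i =>
    hφ.2.1.comp_left (g := fun z : E3 => z i) rfl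
  have hφ2 : ∀ i, MemLp (fun x => φ x i) 2 volume := fun i => MemLp.coord hφ.memLp i
  have hi1 : ∀ n i, Integrable fun x => v₀ (x + y n) i * φ x i := fun n i =>
    (MemLp.coord (MemLp.comp_add_right hv2 (y n)) i).integrable_mul (hφ2 i)
  have hi2 : ∀ i, Integrable fun x => w x i * φ x i := fun i =>
    (MemLp.coord hw i).integrable_mul (hφ2 i)
  have e : ∀ n, ∫ x, ∑ i, (v₀ (x + y n) + w x) i * φ x i =
      (∑ i, ∫ x, v₀ (x + y n) i * φ x i) + ∫ x, ∑ i, w x i * φ x i := fun n => by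
    rw [← integral_finsetSum _ fun i _ => hi1 n i, ← integral_add
      (integrable_finsetSum _ fun i _ => hi1 n i) (integrable_finsetSum _ fun i _ => hi2 i)]
    congr 1; ext x
    rw [← Finset.sum_add_distrib]
    exact Finset.sum_congr rfl fun i _ => by simp [add_mul]
  simp_rw [e]
  have hlim := tendsto_finsetSum (Finset.univ : Finset (Fin 3)) fun i _ =>
    tendsto_integral_translate_mul (MemLp.coord hv2 i) (hφc i) (hφs i) hy
  simpa using hlim.add_const (∫ x, ∑ i, w x i * φ x i)

/-- Uniform solvability for small data and small viscosities. -/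
def SmallDataSolvable (r s : ℝ≥0∞) (N : ℕ) (ε : ℝ) : Prop :=
  ∀ w : E3 → E3, MemLp w 2 volume → IsDivFree w → eLpNorm w 2 volume < ENNReal.ofReal ε →
    ∀ ν : ℝ, 0 < ν → ν * (N + 1) ≤ 1 → HasBoundedSolution r s N ν w

theorem scaling_identity {A b ρ σ : ℝ} (hA : 0 < A) (hb : 0 < b) :
    A * b ^ 3 * ((b ^ 2) ^ 3)⁻¹ ^ σ * (A * b ^ 3 * b ^ 2)⁻¹ ^ ρ =
      A ^ (1 - ρ) * b ^ (3 - 6 * σ - 5 * ρ) := by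
  have h1 : ((b ^ 2) ^ 3)⁻¹ = b ^ (-6 : ℝ) := by
    rw [Real.rpow_neg hb.le, ← pow_mul, ← Real.rpow_natCast]; norm_num
  have h2 : (A * b ^ 3 * b ^ 2)⁻¹ = A ^ (-1 : ℝ) * b ^ (-5 : ℝ) := by
    rw [Real.rpow_neg hb.le, Real.rpow_neg_one, mul_assoc, ← pow_add, mul_inv,
      ← Real.rpow_natCast]
    norm_num
  have h3 : b ^ 3 = b ^ (3 : ℝ) := by rw [← Real.rpow_natCast]; norm_num
  rw [h1, h2, h3, Real.mul_rpow (by positivity) (by positivity), ← Real.rpow_mul hA.le,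
    ← Real.rpow_mul hb.le, ← Real.rpow_mul hb.le]
  have e1 : A ^ (1 - ρ) = A * A ^ (-1 * ρ) := by
    rw [sub_eq_add_neg, Real.rpow_add hA, Real.rpow_one, neg_one_mul]
  have e2 : b ^ (3 - 6 * σ - 5 * ρ) = b ^ (3 : ℝ) * b ^ (-6 * σ) * b ^ (-5 * ρ) := by
    rw [← Real.rpow_add hb, ← Real.rpow_add hb]
    congr 1; ring
  rw [e1, e2]
  ring

theorem SmallDataSolvable.exists_solution {r s : ℝ≥0∞} (hr : r ≠ 0) {N : ℕ} {ε : ℝ}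
    (H : SmallDataSolvable r s N ε) {u₀ : E3 → E3} (hu : MemLp u₀ 2 volume) (hd : IsDivFree u₀)
    {A b ν : ℝ} (hA : 0 < A) (hb : 0 < b) (hν : 0 < ν)
    (huA : eLpNorm u₀ 2 volume < ENNReal.ofReal (A * ε)) (hνb : ν * (N + 1) ≤ A * b) :
    ∃ u G, IsWeakNS ν u₀ u G ∧ mixedNorm ∞ 2 (Ioi 0) u ≤ ENNReal.ofReal (A * N) ∧
      ENNReal.ofReal √ν * gradL2 G ≤ ENNReal.ofReal (A * N) ∧
      mixedNorm r s (Ioi 0) u ≤ ENNReal.ofReal (A ^ (1 - (1 / r).toReal) *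
        b ^ (3 - 6 * (1 / s).toReal - 5 * (1 / r).toReal) * N) := by
  have hα : 0 < A * b ^ 3 := by positivity
  have hβ : 0 < b ^ 2 := by positivity
  have hN : ENNReal.ofReal (N : ℝ) = N := ofReal_natCast N
  have hwε : eLpNorm (fun x => (A * b ^ 3)⁻¹ • u₀ ((b ^ 2)⁻¹ • x + 0)) 2 volume <
      ENNReal.ofReal ε := by
    have e3 : (((b ^ 2)⁻¹ ^ 3)⁻¹) = (b ^ 3) ^ 2 := by field_simp
    have e4 : ENNReal.ofReal ε = ENNReal.ofReal A⁻¹ * ENNReal.ofReal (A * ε) := by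
      rw [← ofReal_mul (by positivity), inv_mul_cancel_left₀ hA.ne']
    rw [eLpNorm_affine (by positivity), e3, Real.enorm_of_nonneg (by positivity),
      toReal_div, toReal_one, toReal_ofNat, ofReal_rpow_of_pos (by positivity),
      ← Real.sqrt_eq_rpow, Real.sqrt_sq (by positivity), ← ofReal_mul (by positivity), mul_inv,
      inv_mul_cancel_right₀ (by positivity), e4]
    exact (ENNReal.mul_lt_mul_iff_right (ofReal_pos.2 (inv_pos.2 hA)).ne' ofReal_ne_top).2 huA
  have hw2 : MemLp (fun x => (A * b ^ 3)⁻¹ • u₀ ((b ^ 2)⁻¹ • x + 0)) 2 volume := by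
    have hq : Measure.QuasiMeasurePreserving (fun x : E3 => (b ^ 2)⁻¹ • x + 0) := by
      refine ⟨(measurableEmbedding_affine (inv_pos.2 hβ) 0).measurable, ?_⟩
      rw [map_space (inv_pos.2 hβ)]
      exact Measure.smul_absolutelyContinuous
    have hm := (hu.1.comp_quasiMeasurePreserving hq).const_smul (A * b ^ 3)⁻¹
    exact ⟨hm, hwε.trans ofReal_lt_top⟩
  obtain ⟨u, G, h1, h2, h3, h4⟩ := H _ hw2 (hd.comp_affine _ (inv_pos.2 hβ) 0) hwε
    (ν / (A * b)) (by positivity) (by rw [div_mul_eq_mul_div]; exact div_le_one_of_le₀ hνb (by positivity))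
  have h5 := h1.rescale hα hβ 0
  have e1 : ν / (A * b) * (A * b ^ 3) / b ^ 2 = ν := by field_simp
  have e2 : (fun x : E3 => (A * b ^ 3) • (A * b ^ 3)⁻¹ • u₀ ((b ^ 2)⁻¹ • (b ^ 2 • x + 0) + 0)) =
      u₀ := by
    ext1 x
    rw [smul_inv_smul₀ hα.ne', add_zero, add_zero, inv_smul_smul₀ hβ.ne']
  rw [e1, e2] at h5
  have e3 : √((b ^ 2) ^ 3)⁻¹ = (b ^ 3)⁻¹ := by
    rw [← pow_mul, mul_comm, pow_mul, ← inv_pow, Real.sqrt_sq (by positivity)]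
  refine ⟨_, _, h5, ?_, ?_, ?_⟩
  · refine (mixedNorm_rescale_le hα hβ 0 u (by simp)).trans ?_
    refine (mul_le_mul_right h2 _).trans (le_of_eq ?_)
    rw [div_top, toReal_zero, rpow_zero, mul_one, toReal_div, toReal_one, toReal_ofNat,
      ofReal_rpow_of_pos (by positivity), ← Real.sqrt_eq_rpow, e3, ← hN,
      ← ofReal_mul (by positivity), ← ofReal_mul (by positivity), mul_inv_cancel_right₀]
    positivity
  · rw [gradL2_rescaleGrad hα hβ]
    have e4 : √ν * (√(A * b ^ 3 * b ^ 2) * (b ^ 3)⁻¹) = A * √(ν / (A * b)) := by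
      rw [← Real.sqrt_sq (show 0 ≤ (b ^ 3)⁻¹ by positivity), ← Real.sqrt_mul (by positivity),
        ← Real.sqrt_mul (by positivity)]
      nth_rw 2 [← Real.sqrt_sq hA.le]
      rw [← Real.sqrt_mul (by positivity)]
      congr 1
      field_simp
    rw [← mul_assoc, ← ofReal_mul (by positivity), e3, e4, ofReal_mul hA.le, mul_assoc,
      ofReal_mul hA.le, hN]
    exact mul_le_mul_right h3 _
  · refine (mixedNorm_rescale_le hα hβ 0 u hr).trans ?_
    refine (mul_le_mul_right h4 _).trans (le_of_eq ?_)
    rw [ofReal_rpow_of_pos (by positivity), ofReal_rpow_of_pos (by positivity),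
      ← ofReal_mul (by positivity), ← ofReal_mul (by positivity), scaling_identity hA hb, ← hN,
      ← ofReal_mul (by positivity)]

theorem exists_solenoidalTest_ne_zero : ∃ φ, IsSolenoidalTest φ ∧ ∫ x, ∑ i, φ x i * φ x i ≠ 0 := by
  let f : ContDiffBump (0 : E3) := ⟨1, 2, one_pos, one_lt_two⟩
  have hf : ContDiff ℝ (⊤ : ℕ∞) f := f.contDiff
  have hfc : HasCompactSupport f := f.hasCompactSupport
  let φ : E3 → E3 := fun x => WithLp.toLp 2 ![-pd f 1 x, pd f 0 x, 0]
  have hφ : ContDiff ℝ (⊤ : ℕ∞) φ := by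
    rw [contDiff_euclidean]
    intro i
    fin_cases i
    · exact (hf.pd 1).neg
    · exact hf.pd 0
    · exact contDiff_const
  have hφ0 : ∀ x, φ x 0 = -1 * pd f 1 x := fun x => (neg_one_mul _).symm
  have hsol : IsSolenoidalTest φ := by
    refine ⟨hφ, ?_, fun x => ?_⟩
    · refine HasCompactSupport.intro hfc.isCompact fun x hx => ?_
      have h : ∀ j, pd f j x = 0 := fun j =>
        image_eq_zero_of_notMem_tsupport fun h => hx (tsupport_pd_subset f j h)
      ext i
      fin_cases i <;> simp [φ, h]
    · have h2 : pd (fun y => φ y 2) 2 x = 0 := by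
        change pd (fun _ => 0) 2 x = 0
        simp [pd]
      rw [Fin.sum_univ_three, h2, add_zero]
      simp_rw [hφ0]
      rw [pd_const_mul (hf.pd 1)]
      change _ + pd (fun y => pd f 0 y) 1 x = 0
      rw [pd_comm hf]
      ring
  refine ⟨φ, hsol, fun h => ?_⟩
  have hcont : Continuous fun x => ∑ i, φ x i * φ x i := by
    have := hφ.continuous
    fun_prop
  have hInt : Integrable fun x => ∑ i, φ x i * φ x i := integrable_finsetSum _ fun i _ =>
    (MemLp.coord hsol.memLp i).integrable_mul (MemLp.coord hsol.memLp i)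
  have hnn : ∀ x, 0 ≤ ∑ i, φ x i * φ x i := fun x =>
    Finset.sum_nonneg fun i _ => mul_self_nonneg _
  rw [integral_eq_zero_iff_of_nonneg hnn hInt] at h
  have h0 := (hcont.ae_eq_iff_eq volume continuous_const).1 h
  have hpd : ∀ x, pd f 0 x = 0 := fun x => by
    have h1 : ∑ i, φ x i * φ x i = 0 := congrFun h0 x
    rw [Finset.sum_eq_zero_iff_of_nonneg fun i _ => mul_self_nonneg _] at h1
    exact mul_self_eq_zero.1 (h1 1 (Finset.mem_univ _))
  have hline : ∀ t : ℝ, HasDerivAt (fun t : ℝ => f (t • EuclideanSpace.single 0 1)) 0 t := fun t => by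
    have h1 := (hf.differentiable (by simp) (t • EuclideanSpace.single 0 1)).hasFDerivAt
    have h2 := h1.comp_hasDerivAt t ((hasDerivAt_id t).smul_const (EuclideanSpace.single 0 1))
    have h3 : fderiv ℝ f (t • EuclideanSpace.single 0 1)
        ((1:ℝ) • EuclideanSpace.single (0 : Fin 3) (1:ℝ)) = 0 := by
      rw [one_smul]; exact hpd _
    exact h3 ▸ h2
  have hc := is_const_of_deriv_eq_zero (fun t => (hline t).differentiableAt)
    (fun t => (hline t).deriv) 0 2
  simp only [zero_smul] at hc
  rw [f.one_of_mem_closedBall (by simp [f]), f.zero_of_le_dist (by simp [f, norm_smul])] at hc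
  exact one_ne_zero hc

/-- The zero field solves the Navier–Stokes equations only with zero datum. -/
theorem WeakForm.integral_eq_zero {ν : ℝ} {φ : E3 → E3} (hφ : IsSolenoidalTest φ)
    (h : WeakForm ν φ fun _ _ => 0) : ∫ x, ∑ i, φ x i * φ x i = 0 := by
  let f : ContDiffBump (0 : ℝ) := ⟨1, 2, one_pos, one_lt_two⟩
  have h1 := h _ (isTest_smul f.contDiff f.hasCompactSupport hφ)
  have h2 : f 0 = 1 := f.one_of_mem_closedBall (by simp [f])
  simpa [h2] using h1

theorem locTendsto_zero {K : ℝ≥0∞} (hK : K ≠ ∞) {u : ℕ → ℝ → E3 → E3}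
    (hu : ∀ n, IsTame K (u n)) (h : ∀ᵐ t ∂volume.restrict (Ioi (0:ℝ)), ∀ R : ℝ,
      Tendsto (fun n => ∫⁻ x in Metric.closedBall 0 R, ‖u n t x‖ₑ ^ 2) atTop (nhds 0)) :
    LocTendsto u fun _ _ => 0 := by
  intro S hS i
  rw [tendsto_eLpNorm_two_iff]
  obtain ⟨R, hR⟩ := hS.isBounded.exists_norm_le
  have hsub : S ⊆ Metric.closedBall (0:ℝ) R ×ˢ Metric.closedBall (0:E3) R := fun p hp => by
    have := hR p hp
    rw [Prod.norm_def, sup_le_iff] at this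
    simpa using this
  have hmeas : ∀ n, Measurable fun p : ℝ × E3 => ‖u n p.1 p.2‖ₑ ^ 2 := fun n =>
    (hu n).meas.measurable.enorm.pow_const 2
  have hle : ∀ n, ∫⁻ p in S, ‖(u n p.1 p.2) i - (0 : E3) i‖ₑ ^ 2 ∂μST ≤
      ∫⁻ t in Metric.closedBall (0:ℝ) R, (∫⁻ x in Metric.closedBall (0:E3) R, ‖u n t x‖ₑ ^ 2)
        ∂volume.restrict (Ioi (0:ℝ)) := fun n => by
    rw [← lintegral_prod _ (hmeas n).aemeasurable, Measure.prod_restrict]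
    refine (lintegral_mono fun p => ?_).trans (lintegral_mono_set hsub)
    refine pow_le_pow_left' ?_ 2
    rw [enorm_le_iff_norm_le]
    simpa using PiLp.norm_apply_le (u n p.1 p.2) i
  refine tendsto_of_tendsto_of_tendsto_of_le_of_le tendsto_const_nhds ?_ (fun _ => zero_le) hle
  have hz : (0 : ℝ≥0∞) = ∫⁻ _ in Metric.closedBall (0:ℝ) R, 0 ∂volume.restrict (Ioi (0:ℝ)) := by
    simp
  rw [hz]
  refine tendsto_lintegral_of_dominated_convergence (fun _ => K ^ 2) ?_ ?_ ?_ ?_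
  · exact fun n => (hmeas n).lintegral_prod_right'
  · refine fun n => ae_of_all _ fun t => (setLIntegral_le_lintegral _ _).trans ?_
    rw [← eLpNorm_two_sq]
    exact pow_le_pow_left' ((hu n).bound t) 2
  · rw [setLIntegral_const]
    refine mul_ne_top (pow_ne_top hK) ?_
    exact ((Measure.restrict_apply_le _ _).trans_lt
      (isCompact_closedBall (0:ℝ) R).measure_lt_top).ne
  · exact ae_restrict_of_ae (h.mono fun t ht => ht R)

theorem integral_eq_zero_of_locTendsto_zero {K : ℝ≥0∞} (hK : K ≠ ∞) {u : ℕ → ℝ → E3 → E3}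
    (hu : ∀ n, IsTame K (u n)) (h : LocTendsto u fun _ _ => 0) {ν : ℕ → ℝ} {ν₀ : ℝ}
    (hν : Tendsto ν atTop (nhds ν₀)) {φ : E3 → E3} (hφ : IsSolenoidalTest φ)
    (hw : ∀ n, WeakForm (ν n) φ (u n)) : ∫ x, ∑ i, φ x i * φ x i = 0 := by
  refine WeakForm.integral_eq_zero (ν := ν₀) hφ (WeakForm.of_tendsto hν h
    (fun n => (hu n).locSq hK) (fun _ _ _ => ?_) hw fun _ _ => tendsto_const_nhds)
  exact MemLp.zero'

theorem exists_subseq_eLpNorm_tendsto_zero {u : ℕ → ℝ → E3 → E3}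
    (hu : ∀ n, StronglyMeasurable (Function.uncurry (u n))) {r s : ℝ≥0∞} (hr : r ≠ 0)
    (h : Tendsto (fun n => mixedNorm r s (Ioi 0) (u n)) atTop (nhds 0)) :
    ∃ σ : ℕ → ℕ, StrictMono σ ∧ ∀ᵐ t ∂volume.restrict (Ioi (0:ℝ)),
      Tendsto (fun n => eLpNorm (u (σ n) t) s volume) atTop (nhds 0) := by
  by_cases hrt : r = ∞
  · subst hrt
    refine ⟨id, strictMono_id, ?_⟩
    filter_upwards [ae_all_iff.2 fun n => eLpNorm_ae_le_mixedNorm (u n) s] with t ht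
    exact tendsto_of_tendsto_of_tendsto_of_le_of_le tendsto_const_nhds h (fun _ => zero_le) ht
  · have hr0 : 0 < r.toReal := toReal_pos hr hrt
    simp only [mixedNorm, if_neg hrt] at h
    have h1 := h.ennrpow_const r.toReal
    simp_rw [← ENNReal.rpow_mul, one_div_mul_cancel hr0.ne', ENNReal.rpow_one,
      ENNReal.zero_rpow_of_pos hr0] at h1
    obtain ⟨σ, hσ, hlim⟩ := exists_subseq_tendsto_zero
      (fun n => ((measurable_eLpNorm_slice (hu n) s).pow_const _).aemeasurable) h1
    refine ⟨σ, hσ, hlim.mono fun t ht => ?_⟩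
    have h2 := ht.ennrpow_const (1 / r.toReal)
    simpa only [← ENNReal.rpow_mul, mul_one_div_cancel hr0.ne', ENNReal.rpow_one,
      ENNReal.zero_rpow_of_pos (one_div_pos.2 hr0)] using h2

theorem tendsto_lintegral_closedBall {f : ℕ → E3 → E3} (hf : ∀ n, AEStronglyMeasurable (f n))
    {s : ℝ≥0∞} (hs : 2 ≤ s) (h : Tendsto (fun n => eLpNorm (f n) s volume) atTop (nhds 0)) (R : ℝ) :
    Tendsto (fun n => ∫⁻ x in Metric.closedBall 0 R, ‖f n x‖ₑ ^ 2) atTop (nhds 0) := by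
  rw [← tendsto_eLpNorm_two_iff]
  set c := (volume.restrict (Metric.closedBall (0 : E3) R)) univ ^
    (1 / (2 : ℝ≥0∞).toReal - 1 / s.toReal) with hc
  have hct : c ≠ ∞ := by
    refine rpow_ne_top_of_nonneg (sub_nonneg.2 ?_) ?_
    · rw [← toReal_one, ← toReal_div, ← toReal_div]
      exact toReal_mono (by simp) (ENNReal.div_le_div_left hs 1)
    · rw [Measure.restrict_apply_univ]
      exact (isCompact_closedBall _ _).measure_lt_top.ne
  have hlim := ENNReal.Tendsto.mul_const (b := c) h (Or.inr hct)
  rw [zero_mul] at hlim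
  refine tendsto_of_tendsto_of_tendsto_of_le_of_le tendsto_const_nhds hlim (fun _ => zero_le)
    fun n => (eLpNorm_le_eLpNorm_mul_rpow_measure_univ hs (hf n).restrict).trans ?_
  exact mul_le_mul_left (eLpNorm_mono_measure _ Measure.restrict_le_self) _

theorem IsSolenoidalTest.isDivFree {φ : E3 → E3} (hφ : IsSolenoidalTest φ) : IsDivFree φ := by
  intro ψ hψ hc
  have h1 : ∀ i, ContDiff ℝ (⊤ : ℕ∞) fun x => φ x i := fun i => hφ.1.coord i
  have h2 : ∀ i, HasCompactSupport fun x => φ x i := fun i =>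
    hφ.2.1.comp_left (g := fun z : E3 => z i) rfl
  have hi : ∀ i, Integrable fun x => pd (fun y => φ y i) i x * ψ x := fun i =>
    (((h1 i).pd i).continuous.mul hψ.continuous).integrable_of_hasCompactSupport hc.mul_left
  have hj : ∀ i, Integrable fun x => φ x i * pd ψ i x := fun i =>
    ((h1 i).continuous.mul (hψ.pd i).continuous).integrable_of_hasCompactSupport (h2 i).mul_right
  have hk : ∀ i, ∫ x, φ x i * pd ψ i x = -∫ x, pd (fun y => φ y i) i x * ψ x := fun i =>
    integral_mul_fderiv_eq_neg_fderiv_mul_of_integrable (hi i) (hj i)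
      (((h1 i).continuous.mul hψ.continuous).integrable_of_hasCompactSupport hc.mul_left)
      (fun x _ => (h1 i).differentiable (by simp) x) (fun x _ => hψ.differentiable (by simp) x)
  rw [integral_finsetSum _ fun i _ => hj i]
  simp_rw [hk]
  rw [Finset.sum_neg_distrib, ← integral_finsetSum _ fun i _ => hi i]
  simp_rw [← Finset.sum_mul, hφ.2.2]
  simp

theorem SmallDataSolvable.exists_solenoidalTest {r s : ℝ≥0∞} (hr : r ≠ 0) {N : ℕ} {ε : ℝ}
    (hε : 0 < ε) (H : SmallDataSolvable r s N ε) :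
    ∃ φ, IsSolenoidalTest φ ∧ ∫ x, ∑ i, φ x i * φ x i ≠ 0 ∧ ∃ A : ℝ, 0 < A ∧
      ∀ b ν : ℝ, 0 < b → 0 < ν → ν * (N + 1) ≤ A * b →
      ∃ u G, IsWeakNS ν φ u G ∧ mixedNorm ∞ 2 (Ioi 0) u ≤ ENNReal.ofReal (A * N) ∧
      ENNReal.ofReal √ν * gradL2 G ≤ ENNReal.ofReal (A * N) ∧
      mixedNorm r s (Ioi 0) u ≤ ENNReal.ofReal (A ^ (1 - (1 / r).toReal) *
        b ^ (3 - 6 * (1 / s).toReal - 5 * (1 / r).toReal) * N) := by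
  obtain ⟨φ, hφ, hne⟩ := exists_solenoidalTest_ne_zero
  refine ⟨φ, hφ, hne, (eLpNorm φ 2 volume).toReal / ε + 1, by positivity, fun b ν hb hν hνb =>
    H.exists_solution hr hφ.memLp hφ.isDivFree (by positivity) hb hν ?_ hνb⟩
  rw [ENNReal.lt_ofReal_iff_toReal_lt hφ.memLp.2.ne, add_mul, div_mul_cancel₀ _ hε.ne', one_mul]
  exact lt_add_of_pos_right _ hε

theorem SmallDataSolvable.exponent_nonneg {r s : ℝ≥0∞} (hr : r ≠ 0) (hs : s ≠ 0) {N : ℕ} {ε : ℝ}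
    (hε : 0 < ε) (H : SmallDataSolvable r s N ε) :
    0 ≤ 3 - 6 * (1 / s).toReal - 5 * (1 / r).toReal := by
  by_contra! hE
  obtain ⟨φ, hφ, hne, A, hA, hsol⟩ := H.exists_solenoidalTest hr hε
  set E := 3 - 6 * (1 / s).toReal - 5 * (1 / r).toReal with hEdef
  let b : ℕ → ℝ := fun n => (N + 1) / A + n
  have hb : ∀ n, 0 < b n := fun n => by positivity
  have hbA : ∀ n, 1 * (N + 1 : ℝ) ≤ A * b n := fun n => by
    have : A * b n = N + 1 + A * n := by simp only [b]; field_simp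
    rw [this, one_mul]
    exact le_add_of_nonneg_right (by positivity)
  choose u G h1 h2 h3 h4 using fun n => hsol (b n) 1 (hb n) one_pos (hbA n)
  simp only [Real.sqrt_one, ofReal_one, one_mul] at h3
  obtain ⟨v, G', hv, -, hn⟩ := exists_weakNS_of_bounded ofReal_ne_top ofReal_ne_top h1 h2 h3
    fun _ _ => tendsto_const_nhds
  have hbt : Tendsto b atTop atTop := tendsto_atTop_add_const_left _ _ tendsto_natCast_atTop_atTop
  have hlim : Tendsto (fun n => ENNReal.ofReal (A ^ (1 - (1 / r).toReal) * b n ^ E * N)) atTop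
      (nhds 0) := by
    have h5 := (tendsto_rpow_neg_atTop (neg_pos.2 hE)).comp hbt
    have h6 := ENNReal.tendsto_ofReal ((h5.const_mul (A ^ (1 - (1 / r).toReal))).mul_const (N : ℝ))
    simpa using h6
  have hv0 : mixedNorm r s (Ioi 0) v = 0 := by
    refine nonpos_iff_eq_zero.1 (le_of_forall_gt_imp_ge_of_dense fun C hC => hn r s C hr ?_)
    exact (hlim.eventually_lt_const hC).mono fun n h => (h4 n).trans h.le
  obtain ⟨w, hw, hNS, hwn⟩ := hv.exists_tame (hn ∞ 2 _ (by simp) (Eventually.of_forall h2))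
  obtain ⟨σ, -, hae⟩ := exists_subseq_eLpNorm_tendsto_zero (fun _ : ℕ => hw.meas) hr
    (s := s) (by rw [hwn, hv0]; exact tendsto_const_nhds)
  refine hne (integral_eq_zero_of_locTendsto_zero ofReal_ne_top (fun _ => hw)
    (locTendsto_zero ofReal_ne_top (fun _ => hw) (hae.mono fun t ht R => ?_))
    tendsto_const_nhds hφ fun _ => hNS.2.2.2.2.2.2)
  have h0 := tendsto_nhds_unique tendsto_const_nhds ht
  rw [eLpNorm_eq_zero_iff (hw.slice_meas t).aestronglyMeasurable hs] at h0
  have h5 : ∫⁻ x in Metric.closedBall 0 R, ‖w t x‖ₑ ^ 2 = 0 := by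
    rw [lintegral_congr_ae (g := 0) (ae_restrict_of_ae (h0.mono fun x hx => by simp [hx]))]
    simp
  rw [h5]
  exact tendsto_const_nhds

theorem SmallDataSolvable.exponent_nonpos {r s : ℝ≥0∞} (hr : r ≠ 0) (hs : s ≠ 0) {N : ℕ} {ε : ℝ}
    (hε : 0 < ε) (H : SmallDataSolvable r s N ε) :
    3 - 6 * (1 / s).toReal - 5 * (1 / r).toReal ≤ 0 := by
  by_contra! hE
  have hs2 : 2 ≤ s := by
    by_contra! h
    have h1 : (1 / 2 : ℝ≥0∞).toReal ≤ (1 / s).toReal :=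
      toReal_mono (div_ne_top one_ne_top hs) (ENNReal.div_le_div_left h.le 1)
    have h2 : 0 ≤ (1 / r).toReal := toReal_nonneg
    rw [toReal_div, toReal_one, toReal_ofNat] at h1
    linarith
  obtain ⟨φ, hφ, hne, A, hA, hsol⟩ := H.exists_solenoidalTest hr hε
  set E := 3 - 6 * (1 / s).toReal - 5 * (1 / r).toReal with hEdef
  let b : ℕ → ℝ := fun n => 1 / ((n : ℝ) + 1)
  have hb : ∀ n, 0 < b n := fun n => by positivity
  have hbt : Tendsto b atTop (nhds 0) := tendsto_one_div_add_atTop_nhds_zero_nat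
  choose u G h1 h2 h3 h4 using fun n => hsol (b n) (A * b n / (N + 1)) (hb n)
    (by have := hb n; positivity) (div_mul_cancel₀ _ (by positivity)).le
  choose w hw hNS hwn using fun n => (h1 n).exists_tame (h2 n)
  have hlim : Tendsto (fun n => mixedNorm r s (Ioi 0) (w n)) atTop (nhds 0) := by
    have h5 := hbt.rpow_const (p := E) (Or.inr hE.le)
    rw [Real.zero_rpow hE.ne'] at h5
    have h6 := ENNReal.tendsto_ofReal ((h5.const_mul (A ^ (1 - (1 / r).toReal))).mul_const (N : ℝ))
    simp only [mul_zero, zero_mul, ofReal_zero] at h6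
    exact tendsto_of_tendsto_of_tendsto_of_le_of_le tendsto_const_nhds h6 (fun _ => zero_le)
      fun n => (hwn n r s).trans_le (h4 n)
  obtain ⟨σ, hσ, hae⟩ := exists_subseq_eLpNorm_tendsto_zero (fun n => (hw n).meas) hr hlim
  refine hne (integral_eq_zero_of_locTendsto_zero ofReal_ne_top (fun n => hw (σ n))
    (locTendsto_zero ofReal_ne_top (fun n => hw (σ n)) (hae.mono fun t ht R => ?_))
    (ν₀ := A * 0 / (N + 1)) (((hbt.const_mul A).div_const _).comp hσ.tendsto_atTop) hφ
    fun n => (hNS (σ n)).2.2.2.2.2.2)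
  exact tendsto_lintegral_closedBall
    (fun n => ((hw (σ n)).slice_meas t).aestronglyMeasurable) hs2 ht R

theorem mixedNorm_zero {r : ℝ≥0∞} (hr : r ≠ 0) (s : ℝ≥0∞) :
    mixedNorm r s (Ioi 0) (fun _ _ => 0) = 0 := by
  unfold mixedNorm
  split_ifs with h
  · simp only [eLpNorm_zero']
    exact ENNReal.essSup_eq_zero_iff.2 EventuallyEq.rfl
  · have := toReal_pos hr h
    simp [ENNReal.zero_rpow_of_pos this, this]

theorem isWeakNS_zero (ν : ℝ) {u₀ : E3 → E3} (h : u₀ =ᵐ[volume] 0) :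
    IsWeakNS ν u₀ (fun _ _ => 0) fun _ _ _ _ => 0 := by
  refine ⟨aestronglyMeasurable_const, by simp [mixedNorm_zero], ae_of_all _ fun t φ _ _ => by simp,
    aestronglyMeasurable_const, by simp [gradSq], fun ψ _ _ _ i j => by simp, fun φ _ => ?_⟩
  have : ∫ x, ∑ i, u₀ x i * φ (0, x) i = ∫ _ : E3, (0:ℝ) :=
    integral_congr_ae (h.mono fun x hx => by simp [hx])
  simp [this]

theorem gradL2_zero : gradL2 (fun _ _ _ _ => 0) = 0 := by
  simp [gradL2, gradSq]

theorem SmallDataSolvable.exists_bounds {r s : ℝ≥0∞} (hr : r ≠ 0) {N : ℕ} {ε : ℝ}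
    (hε : 0 < ε) (H : SmallDataSolvable r s N ε)
    (hE : 3 - 6 * (1 / s).toReal - 5 * (1 / r).toReal = 0) :
    ∃ C : ℝ, 0 < C ∧ ∀ ν : ℝ, 0 < ν → ∀ u₀ : L2σ, ∃ u G,
      IsWeakNS ν ((u₀ : Lp E3 2 (volume : Measure E3)) : E3 → E3) u G ∧
      mixedNorm ∞ 2 (Ioi 0) u + ENNReal.ofReal √ν * gradL2 G ≤
        ENNReal.ofReal (C * ‖(u₀ : Lp E3 2 (volume : Measure E3))‖) ∧
      mixedNorm r s (Ioi 0) u ≤ ENNReal.ofReal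
        (C * ‖(u₀ : Lp E3 2 (volume : Measure E3))‖ ^ (1 - (1 / r).toReal)) := by
  set c : ℝ := 2 / ε with hc
  have hc0 : 0 < c := by positivity
  refine ⟨2 * c * N + c ^ (1 - (1 / r).toReal) * N + 1, by positivity, fun ν hν u₀ => ?_⟩
  obtain ⟨U, hUd⟩ := u₀
  change ∃ u G, IsWeakNS ν U u G ∧ _ ≤ ENNReal.ofReal (_ * ‖U‖) ∧ _ ≤ ENNReal.ofReal (_ * ‖U‖ ^ _)
  rcases (norm_nonneg U).eq_or_lt with h0 | hM
  · have hz : U =ᵐ[volume] (0 : E3 → E3) := by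
      rw [eq_comm, norm_eq_zero] at h0
      rw [h0]
      exact Lp.coeFn_zero _ _ _
    refine ⟨_, _, isWeakNS_zero ν hz, ?_, ?_⟩
    · simp [mixedNorm_zero, gradL2_zero]
    · simp [mixedNorm_zero hr]
  · set M := ‖U‖ with hMdef
    have hA : 0 < c * M := by positivity
    have huA : eLpNorm U 2 volume < ENNReal.ofReal (c * M * ε) := by
      rw [ENNReal.lt_ofReal_iff_toReal_lt (Lp.memLp U).2.ne, ← Lp.norm_def, ← hMdef]
      have : c * M * ε = 2 * M := by rw [hc]; field_simp
      linarith
    obtain ⟨u, G, h1, h2, h3, h4⟩ := H.exists_solution hr (Lp.memLp U) hUd hA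
      (b := ν * (N + 1) / (c * M)) (by positivity) hν huA (mul_div_cancel₀ _ hA.ne').ge
    refine ⟨u, G, h1, (add_le_add h2 h3).trans ?_, h4.trans ?_⟩
    · rw [← ofReal_add (by positivity) (by positivity)]
      refine ofReal_le_ofReal ?_
      have : 0 ≤ (c ^ (1 - (1 / r).toReal) * N + 1) * M := by positivity
      linarith
    · rw [hE, Real.rpow_zero, mul_one, Real.mul_rpow hc0.le hM.le]
      refine ofReal_le_ofReal ?_
      have : 0 ≤ (2 * c * N + 1) * M ^ (1 - (1 / r).toReal) := by positivity
      linarith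

theorem stmt_5 (r s : ℝ≥0∞) (hr : 4/3 < r) (hs : 4/3 < s)
    (h1 : 1 < 2/r + 3/s) (h2 : 2/r + 3/s < 3/2)
    (hyp : ¬ IsMeagre {u₀ : L2σ |
      Filter.limsup (fun ν : ℝ =>
        ⨅ (u : ℝ → E3 → E3) (G : ℝ → E3 → Fin 3 → Fin 3 → ℝ)
          (_ : IsWeakNS ν ((u₀ : Lp E3 2 (volume : Measure E3)) : E3 → E3) u G),
          (mixedNorm ∞ 2 (Ioi 0) u + ENNReal.ofReal (Real.sqrt ν) * gradL2 G +
            mixedNorm r s (Ioi 0) u))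
        (nhdsWithin (0:ℝ) (Ioi 0)) < ∞}) :
    (5/(3*r) + 2/s = 1) ∧
    ∃ C : ℝ, 0 < C ∧ ∀ ν : ℝ, 0 < ν → ∀ u₀ : L2σ, ∃ u G,
      IsWeakNS ν ((u₀ : Lp E3 2 (volume : Measure E3)) : E3 → E3) u G ∧
      mixedNorm ∞ 2 (Ioi 0) u + ENNReal.ofReal (Real.sqrt ν) * gradL2 G
        ≤ ENNReal.ofReal (C * ‖(u₀ : Lp E3 2 (volume : Measure E3))‖) ∧
      mixedNorm r s (Ioi 0) u
        ≤ ENNReal.ofReal (C *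
            ‖(u₀ : Lp E3 2 (volume : Measure E3))‖ ^ ((2:ℝ) * ((2/r + 3/s).toReal - 1))) := by
  have hr0 : r ≠ 0 := (zero_le.trans_lt hr).ne'
  have hs0 : s ≠ 0 := (zero_le.trans_lt hs).ne'
  obtain ⟨N, v, ε, hε, hball⟩ := exists_ball_boundedData hr0 hyp
  have H : SmallDataSolvable r s N ε := fun w hw hd hwε ν hν hνN =>
    hasBoundedSolution_of_ball hr0 hball hw hd hwε hν hνN
  have hE := le_antisymm (H.exponent_nonpos hr0 hs0 hε) (H.exponent_nonneg hr0 hs0 hε)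
  have hdiv : ∀ {a : ℝ≥0∞} (k : ℝ≥0∞), k / a = k * (1 / a) := fun k => by
    rw [one_div, div_eq_mul_inv]
  have hrt : 1 / r ≠ ∞ := div_ne_top one_ne_top hr0
  have hst : 1 / s ≠ ∞ := div_ne_top one_ne_top hs0
  have hexp : (2:ℝ) * ((2 / r + 3 / s).toReal - 1) = 1 - (1 / r).toReal := by
    rw [hdiv 2, hdiv 3, toReal_add (mul_ne_top (by simp) hrt) (mul_ne_top (by simp) hst),
      toReal_mul, toReal_mul, toReal_ofNat, toReal_ofNat]
    linarith
  refine ⟨?_, ?_⟩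
  · have h3 : 5 / (3 * r) = 5 / 3 * (1 / r) := by
      rw [div_eq_mul_inv, ENNReal.mul_inv (by simp) (by simp), one_div, div_eq_mul_inv, mul_assoc]
    have ht : (5 / 3 : ℝ≥0∞) ≠ ∞ := div_ne_top (by simp) (by simp)
    rw [h3, hdiv 2, ← toReal_eq_toReal_iff' (add_ne_top.2 ⟨mul_ne_top ht hrt,
      mul_ne_top (by simp) hst⟩) one_ne_top, toReal_add (mul_ne_top ht hrt)
      (mul_ne_top (by simp) hst), toReal_mul, toReal_mul, toReal_div, toReal_ofNat, toReal_ofNat,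
      toReal_ofNat, toReal_one]
    linarith
  · simp_rw [hexp]
    exact H.exists_bounds hr0 hε hE
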